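/- arXiv:2404.09085 — 2 statements merged into one kernel-verified Lean document; each statement's English description precedes it below -/
import Mathlib

section
/- For every ε > 0 there is a constant C_ε such that the following holds. Let K, P ≥ 1/2 and 0 < N < K·P, let a : O∖{0} → ℂ be constant on associate classes, and for c ∈ O∖{0} put Φ(c) = Σ_m Σ_n a_m·conj(a_n)·S(m,n;c)·𝓗(2π·√(mn)/c), both sums over generators m, n with argument in [0, π/2) satisfying N < |m|, |n| ≤ √2·N (the value 𝓗(2π·√(mn)/c) is independent of the choice of square root since 𝓗 is even). Then Σ_{c ∈ O∖{0}} |Φ(c)|/|c|² ≤ C_ε·N^{2+ε}·((e^{−K²/9}/K + e^{−P²}/P)·N² + (1/K² + 1/P²)·N)·‖a_N‖₂². -/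
open scoped Real ComplexConjugate
open Complex

/-- `e[z] = exp(2πi Re z)`. -/
noncomputable def efn (z : ℂ) : ℂ := Complex.exp (2 * Real.pi * Complex.I * z.re)

/-- The Kloosterman sum `S(m, n; c)` over the Gaussian integers: the sum over invertible
residues `α` modulo `c` (with `δ` the inverse residue) of `e[(αm + δn)/c]`. -/
noncomputable def kloosterman (m n c : GaussianInt) : ℂ :=
  ∑ᶠ u : (GaussianInt ⧸ Ideal.span {c})ˣ,
    efn (((Quotient.out (u : GaussianInt ⧸ Ideal.span {c}) : GaussianInt) * m +
          (Quotient.out ((u⁻¹ : (GaussianInt ⧸ Ideal.span {c})ˣ) :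
              GaussianInt ⧸ Ideal.span {c}) : GaussianInt) * n : GaussianInt) / (c : ℂ))

/-- `n` is the distinguished generator of its ideal: nonzero with argument in `[0, π/2)`. -/
def IsGen (n : GaussianInt) : Prop :=
  n ≠ 0 ∧ 0 ≤ Complex.arg (n : ℂ) ∧ Complex.arg (n : ℂ) < Real.pi / 2

/-- distinguished generator in the annulus `N < |n| ≤ √2·N`. -/
def InAnn (N : ℝ) (n : GaussianInt) : Prop :=
  IsGen n ∧ N < ‖(n : ℂ)‖ ∧ ‖(n : ℂ)‖ ≤ Real.sqrt 2 * N

/-- `‖b_N‖₂² = Σ_{N < |n| ≤ √2 N} |b_n|²`, over distinguished generators. -/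
noncomputable def sqNorm (b : GaussianInt → ℂ) (N : ℝ) : ℝ :=
  ∑ᶠ n ∈ {n : GaussianInt | InAnn N n}, ‖b n‖ ^ 2

/-- The quadratic form
`B(θ,c,N) = Σ_m Σ_n b_m conj(b_n) S(m,n;c) cos(4π Re(√(mn) θ / c))`. -/
noncomputable def Bform (b : GaussianInt → ℂ) (θ : ℂ) (c : GaussianInt) (N : ℝ) : ℂ :=
  ∑ᶠ m ∈ {m : GaussianInt | InAnn N m}, ∑ᶠ n ∈ {n : GaussianInt | InAnn N n},
    b m * conj (b n) * kloosterman m n c *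
      Real.cos (4 * Real.pi * ((((m : ℂ) * (n : ℂ)) ^ ((1:ℂ)/2) * θ / (c : ℂ)).re))

/-- `trh(r,ω) = cosh r cos ω + i sinh r sin ω`. -/
noncomputable def trh (r ω : ℝ) : ℂ :=
  (Real.cosh r * Real.cos ω : ℝ) + Complex.I * (Real.sinh r * Real.sin ω : ℝ)

/-- `k(r) = √π K exp(−K²r²)`. -/
noncomputable def kfun (K r : ℝ) : ℝ := Real.sqrt Real.pi * K * Real.exp (-(K ^ 2 * r ^ 2))

/-- `θ(ω) = √π P Σ_{q∈ℤ} exp(−P²(ω+πq)²)`. -/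
noncomputable def thetafun (P ω : ℝ) : ℝ :=
  Real.sqrt Real.pi * P * ∑' q : ℤ, Real.exp (-(P ^ 2 * (ω + Real.pi * q) ^ 2))

/-- The Bessel integral
`𝓗(z) = −∫_ℝ ∫₀^π cos(2 Re(z trh(r,ω))) (k''(r)θ(ω) + k(r)θ''(ω)) dω dr`. -/
noncomputable def HH (K P : ℝ) (z : ℂ) : ℝ :=
  -(∫ r : ℝ, ∫ ω in (0:ℝ)..Real.pi,
      Real.cos (2 * (z * trh r ω).re) *
        (deriv (deriv (kfun K)) r * thetafun P ω +
          kfun K r * deriv (deriv (thetafun P)) ω))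

/-- `Φ(c) = Σ_m Σ_n a_m conj(a_n) S(m,n;c) 𝓗(2π √(mn)/c)`, the sums over distinguished
generators in the annulus `N < |·| ≤ √2 N`. -/
noncomputable def PhiSum (K P N : ℝ) (a : GaussianInt → ℂ) (c : GaussianInt) : ℂ :=
  ∑ᶠ m ∈ {m : GaussianInt | InAnn N m}, ∑ᶠ n ∈ {n : GaussianInt | InAnn N n},
    a m * conj (a n) * kloosterman m n c *
      ((HH K P (2 * Real.pi * ((m : ℂ) * (n : ℂ)) ^ ((1:ℂ)/2) / (c : ℂ)) : ℝ) : ℂ)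

namespace KT

section ring
variable {R : Type*} [CommRing R] [Fintype R] [DecidableEq R]

/-- number of `y` with `x*y=0` -/
def annc (x : R) : ℕ := (Finset.univ.filter fun y : R => x * y = 0).card

/-- number of zero-product pairs -/
def zpc (R : Type*) [CommRing R] [Fintype R] [DecidableEq R] : ℕ := ∑ x : R, annc x

/-- abstract Kloosterman sum -/
noncomputable def Kl (ψ : AddChar R ℂ) (a b : R) : ℂ := ∑ u : Rˣ, ψ (a * u + b * (u⁻¹ : Rˣ))

lemma annc_mul_le (x y : R) : annc (x * y) ≤ annc x * annc y := by
  unfold annc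
  rw [mul_comm]
  have hmaps : ∀ z ∈ (Finset.univ.filter fun z : R => x * y * z = 0),
      x * z ∈ (Finset.univ.filter fun z : R => y * z = 0) := by
    intro z hz
    simp only [Finset.mem_filter, Finset.mem_univ, true_and] at hz ⊢
    rw [← hz]; ring
  rw [mul_comm]
  refine Finset.card_le_mul_card_image_of_maps_to hmaps _ ?_
  intro w hw
  by_cases hne : (Finset.filter (fun z => x * z = w) (Finset.univ.filter fun z : R => x * y * z = 0)).Nonempty
  · obtain ⟨z0, hz0⟩ := hne
    refine Finset.card_le_card_of_injOn (fun z => z - z0) ?_ ?_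
    · intro z hz
      simp only [Finset.coe_filter, Finset.mem_filter, Finset.mem_univ, true_and, Set.mem_setOf_eq] at hz hz0 ⊢
      rw [mul_sub, hz.2, hz0.2, sub_self]
    · intro z _ z' _ h
      simpa using h
  · rw [Finset.not_nonempty_iff_eq_empty] at hne
    rw [hne]; simp

lemma triple_le : (Finset.univ.filter fun p : R × R × R => p.1 * p.2.1 * p.2.2 = 0).card ≤ zpc R ^ 2 := by
  have : (Finset.univ.filter fun p : R × R × R => p.1 * p.2.1 * p.2.2 = 0).card
      = ∑ x : R, ∑ y : R, annc (x * y) := by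
    unfold annc
    simp only [Finset.card_filter]
    rw [Fintype.sum_prod_type]
    refine Finset.sum_congr rfl fun x _ => ?_
    rw [Fintype.sum_prod_type]
  rw [this, sq, zpc, Finset.sum_mul_sum]
  exact Finset.sum_le_sum fun x _ => Finset.sum_le_sum fun y _ => annc_mul_le x y

/-- Parseval -/
lemma parseval {ψ : AddChar R ℂ} (hψ : ψ.IsPrimitive) {I : Type*} [Fintype I] (f g : I → R) :
    ∑ a : R, ∑ b : R, ‖∑ i, ψ (a * f i + b * g i)‖ ^ 2 =
      (Fintype.card R : ℝ) ^ 2 *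
        ((Finset.univ.filter fun p : I × I => f p.1 = f p.2 ∧ g p.1 = g p.2).card : ℝ) := by
  have key : ∀ a b : R, ((‖∑ i, ψ (a * f i + b * g i)‖ ^ 2 : ℝ) : ℂ) =
      ∑ i, ∑ j, ψ (a * (f i - f j)) * ψ (b * (g i - g j)) := by
    intro a b
    push_cast
    rw [← Complex.mul_conj', map_sum, Finset.sum_mul_sum]
    refine Finset.sum_congr rfl fun i _ => Finset.sum_congr rfl fun j _ => ?_
    rw [← AddChar.map_neg_eq_conj, ← AddChar.map_add_eq_mul, ← AddChar.map_add_eq_mul]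
    congr 1; ring
  apply Complex.ofReal_injective
  simp only [Complex.ofReal_sum]
  simp_rw [key]
  have : ∑ a : R, ∑ b : R, ∑ i, ∑ j, ψ (a * (f i - f j)) * ψ (b * (g i - g j))
      = ∑ i, ∑ j, (∑ a : R, ψ (a * (f i - f j))) * (∑ b : R, ψ (b * (g i - g j))) := by
    simp_rw [Finset.sum_mul_sum]
    calc _ = ∑ a : R, ∑ i, ∑ b : R, ∑ j, ψ (a * (f i - f j)) * ψ (b * (g i - g j)) :=
          Finset.sum_congr rfl fun a _ => Finset.sum_comm
      _ = ∑ i, ∑ a : R, ∑ b : R, ∑ j, ψ (a * (f i - f j)) * ψ (b * (g i - g j)) := Finset.sum_comm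
      _ = ∑ i, ∑ a : R, ∑ j, ∑ b : R, ψ (a * (f i - f j)) * ψ (b * (g i - g j)) :=
          Finset.sum_congr rfl fun i _ => Finset.sum_congr rfl fun a _ => Finset.sum_comm
      _ = _ := Finset.sum_congr rfl fun i _ => Finset.sum_comm
  rw [this]
  simp_rw [AddChar.sum_mulShift _ hψ, sub_eq_zero]
  rw [Finset.card_filter, Fintype.sum_prod_type]
  push_cast
  rw [Finset.mul_sum]
  refine Finset.sum_congr rfl fun i _ => ?_
  rw [Finset.mul_sum]
  refine Finset.sum_congr rfl fun j _ => ?_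
  by_cases h1 : f i = f j <;> by_cases h2 : g i = g j <;> simp [h1, h2, sq]

/-- the number of quadruples -/
def quadE (R : Type*) [CommRing R] [Fintype R] [DecidableEq R] : ℕ :=
  (Finset.univ.filter fun p : (Rˣ × Rˣ) × (Rˣ × Rˣ) =>
      ((p.1.1 : R) + p.1.2 = p.2.1 + p.2.2) ∧
      (((p.1.1⁻¹ : Rˣ) : R) + (p.1.2⁻¹ : Rˣ) = (p.2.1⁻¹ : Rˣ) + (p.2.2⁻¹ : Rˣ))).card

lemma sum_Kl_four {ψ : AddChar R ℂ} (hψ : ψ.IsPrimitive) :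
    ∑ a : R, ∑ b : R, ‖Kl ψ a b‖ ^ 4 = (Fintype.card R : ℝ) ^ 2 * quadE R := by
  rw [quadE, ← parseval hψ (fun p : Rˣ × Rˣ => (p.1 : R) + p.2)
    (fun p : Rˣ × Rˣ => ((p.1⁻¹ : Rˣ) : R) + (p.2⁻¹ : Rˣ))]
  refine Finset.sum_congr rfl fun a _ => Finset.sum_congr rfl fun b _ => ?_
  have : Kl ψ a b * Kl ψ a b =
      ∑ i : Rˣ × Rˣ, ψ (a * ((i.1 : R) + i.2) + b * (((i.1⁻¹ : Rˣ) : R) + (i.2⁻¹ : Rˣ))) := by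
    unfold Kl
    rw [Finset.sum_mul_sum, Fintype.sum_prod_type]
    refine Finset.sum_congr rfl fun i _ => Finset.sum_congr rfl fun j _ => ?_
    rw [← AddChar.map_add_eq_mul]
    congr 1; ring
  rw [← this, norm_mul]; ring

lemma quadE_le : quadE R ≤ annc (2 : R) * zpc R ^ 2 := by
  refine le_trans ?_ (Nat.mul_le_mul_left _ triple_le)
  unfold quadE
  set s := (Finset.univ.filter fun p : (Rˣ × Rˣ) × (Rˣ × Rˣ) =>
      ((p.1.1 : R) + p.1.2 = p.2.1 + p.2.2) ∧
      (((p.1.1⁻¹ : Rˣ) : R) + (p.1.2⁻¹ : Rˣ) = (p.2.1⁻¹ : Rˣ) + (p.2.2⁻¹ : Rˣ))) with hs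
  refine Finset.card_le_mul_card_image_of_maps_to
    (f := fun p : (Rˣ × Rˣ) × (Rˣ × Rˣ) =>
      (((p.1.1 : R) + p.1.2, (p.2.1 : R) - p.1.1, (p.2.1 : R) - p.1.2) : R × R × R)) ?_ _ ?_
  · rintro ⟨⟨u1, u2⟩, ⟨u3, u4⟩⟩ h
    simp only [hs, Finset.mem_filter, Finset.mem_univ, true_and] at h ⊢
    obtain ⟨h1, h2⟩ := h
    have e1 : (u1 : R) * (u1⁻¹ : Rˣ) = 1 := u1.mul_inv
    have e2 : (u2 : R) * (u2⁻¹ : Rˣ) = 1 := u2.mul_inv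
    have e3 : (u3 : R) * (u3⁻¹ : Rˣ) = 1 := u3.mul_inv
    have e4 : (u4 : R) * (u4⁻¹ : Rˣ) = 1 := u4.mul_inv
    generalize ((u1⁻¹ : Rˣ) : R) = v1 at *
    generalize ((u2⁻¹ : Rˣ) : R) = v2 at *
    generalize ((u3⁻¹ : Rˣ) : R) = v3 at *
    generalize ((u4⁻¹ : Rˣ) : R) = v4 at *
    generalize (u1 : R) = a1 at *
    generalize (u2 : R) = a2 at *
    generalize (u3 : R) = a3 at *
    generalize (u4 : R) = a4 at *
    have h4 : a4 = a1 + a2 - a3 := by rw [h1]; ring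
    have k1 : (v1 + v2) * (a1 * a2) = a1 + a2 := by linear_combination a2 * e1 + a1 * e2
    have k2 : (v3 + v4) * (a3 * a4) = a3 + a4 := by linear_combination a4 * e3 + a3 * e4
    -- s a3 a4 = (v1+v2) a1a2 a3a4 = (v3+v4)a3a4 a1 a2 = s a1 a2
    have k3 : (a1 + a2) * (a3 * a4) = (a1 + a2) * (a1 * a2) := by
      calc (a1 + a2) * (a3 * a4) = (v1 + v2) * (a1 * a2) * (a3 * a4) := by rw [k1]
        _ = (v3 + v4) * (a3 * a4) * (a1 * a2) := by rw [h2]; ring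
        _ = (a1 + a2) * (a1 * a2) := by rw [k2, h1]
    rw [h4] at k3
    linear_combination -k3
  · rintro ⟨x, y, z⟩ _
    by_cases hne : (Finset.filter (fun p : (Rˣ × Rˣ) × (Rˣ × Rˣ) =>
      (((p.1.1 : R) + p.1.2, (p.2.1 : R) - p.1.1, (p.2.1 : R) - p.1.2) : R × R × R) = (x, y, z)) s).Nonempty
    · obtain ⟨p0, hp0⟩ := hne
      unfold annc
      refine Finset.card_le_card_of_injOn (fun p => (p.2.1 : R) - p0.2.1) ?_ ?_
      · intro p hp
        simp only [Finset.coe_filter, Finset.mem_filter, Finset.mem_univ, true_and, Set.mem_setOf_eq, Prod.mk.injEq] at hp hp0 ⊢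
        obtain ⟨_, h1, h2, h3⟩ := hp
        obtain ⟨_, g1, g2, g3⟩ := hp0
        linear_combination h1 + h2 + h3 - g1 - g2 - g3
      · rintro ⟨⟨u1, u2⟩, ⟨u3, u4⟩⟩ hp ⟨⟨w1, w2⟩, ⟨w3, w4⟩⟩ hq h
        simp only [hs, Finset.coe_filter, Finset.mem_filter, Finset.mem_univ, true_and, Set.mem_setOf_eq, Prod.mk.injEq] at hp hq h ⊢
        obtain ⟨⟨h0, _⟩, h1, h2, h3⟩ := hp
        obtain ⟨⟨g0, _⟩, g1, g2, g3⟩ := hq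
        simp only [Units.ext_iff]
        refine ⟨⟨?_, ?_⟩, ?_, ?_⟩
        · linear_combination h + g2 - h2
        · linear_combination h + g3 - h3
        · linear_combination h
        · linear_combination h1 - h0 - g1 + g0 - h
    · rw [Finset.not_nonempty_iff_eq_empty] at hne
      rw [hne]; simp

lemma Kl_shift (ψ : AddChar R ℂ) (a b : R) (t : Rˣ) :
    Kl ψ (a * t) (b * (t⁻¹ : Rˣ)) = Kl ψ a b := by
  unfold Kl
  refine Fintype.sum_equiv (Equiv.mulLeft t) _ _ fun u => ?_
  simp only [Equiv.coe_mulLeft, Units.val_mul, mul_inv]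
  congr 1; ring

lemma norm_Kl_le (ψ : AddChar R ℂ) (a b : R) : ‖Kl ψ a b‖ ≤ Fintype.card Rˣ := by
  unfold Kl
  refine (norm_sum_le _ _).trans ?_
  simp

lemma Kl_four {ψ : AddChar R ℂ} (hψ : ψ.IsPrimitive) (a b : R) :
    (Fintype.card Rˣ : ℝ) * ‖Kl ψ a b‖ ^ 4 ≤ annc a * ((Fintype.card R : ℝ) ^ 2 * quadE R) := by
  have h1 : (Fintype.card Rˣ : ℝ) * ‖Kl ψ a b‖ ^ 4 =
      ∑ t : Rˣ, ‖Kl ψ (a * t) (b * (t⁻¹ : Rˣ))‖ ^ 4 := by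
    simp [Kl_shift]
  rw [h1, ← sum_Kl_four hψ, ← Fintype.sum_prod_type' (f := fun a b => ‖Kl ψ a b‖ ^ 4)]
  rw [← Finset.sum_fiberwise (s := (Finset.univ : Finset Rˣ))
    (g := fun t : Rˣ => ((a * (t : R), b * ((t⁻¹ : Rˣ) : R)) : R × R))]
  rw [Finset.mul_sum]
  refine Finset.sum_le_sum fun p _ => ?_
  calc _ = ∑ t ∈ Finset.univ.filter (fun t : Rˣ => ((a * (t : R), b * ((t⁻¹ : Rˣ) : R)) : R × R) = p),
        ‖Kl ψ p.1 p.2‖ ^ 4 := by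
        refine Finset.sum_congr rfl fun t ht => ?_
        simp only [Finset.mem_filter, Finset.mem_univ, true_and] at ht
        rw [← ht]
    _ = ((Finset.univ.filter (fun t : Rˣ => ((a * (t : R), b * ((t⁻¹ : Rˣ) : R)) : R × R) = p)).card : ℝ)
        * ‖Kl ψ p.1 p.2‖ ^ 4 := by simp
    _ ≤ _ := by
        gcongr
        by_cases hne : (Finset.univ.filter (fun t : Rˣ => ((a * (t : R), b * ((t⁻¹ : Rˣ) : R)) : R × R) = p)).Nonempty
        · obtain ⟨t0, ht0⟩ := hne
          unfold annc
          refine Finset.card_le_card_of_injOn (fun t => (t : R) - t0) ?_ ?_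
          · intro t ht
            simp only [Finset.coe_filter, Finset.mem_filter, Finset.mem_univ, true_and, Set.mem_setOf_eq] at ht ht0 ⊢
            have := ht.trans ht0.symm
            simp only [Prod.mk.injEq] at this
            rw [mul_sub, this.1, sub_self]
          · intro t _ t' _ h
            simpa [Units.ext_iff] using h
        · rw [Finset.not_nonempty_iff_eq_empty] at hne
          rw [hne]; simp

lemma Kl_five {ψ : AddChar R ℂ} (hψ : ψ.IsPrimitive) (a b : R) :
    ‖Kl ψ a b‖ ^ 5 ≤ annc a * ((Fintype.card R : ℝ) ^ 2 * (annc (2 : R) * (zpc R : ℝ) ^ 2)) := by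
  calc ‖Kl ψ a b‖ ^ 5 = ‖Kl ψ a b‖ * ‖Kl ψ a b‖ ^ 4 := by ring
    _ ≤ Fintype.card Rˣ * ‖Kl ψ a b‖ ^ 4 := by gcongr; exact norm_Kl_le _ _ _
    _ ≤ _ := Kl_four hψ a b
    _ ≤ _ := by
      gcongr
      exact_mod_cast quadE_le
end ring
end KT

namespace KT

abbrev QR (c : GaussianInt) : Type := GaussianInt ⧸ Ideal.span {c}

/-- basis of the Gaussian integers -/
noncomputable def gbasis : Module.Basis (Fin 2) ℤ GaussianInt :=
  Module.Basis.ofEquivFun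
    { toFun := fun z => ![z.re, z.im]
      invFun := fun v => ⟨v 0, v 1⟩
      left_inv := fun z => by cases z; rfl
      right_inv := fun v => by ext i; fin_cases i <;> rfl
      map_add' := fun x y => by ext i; fin_cases i <;> simp
      map_smul' := fun a x => by ext i; fin_cases i <;> simp }

lemma gbasis_repr (z : GaussianInt) (i : Fin 2) : gbasis.repr z i = ![z.re, z.im] i := rfl

lemma gbasis_zero : gbasis 0 = 1 := by
  apply gbasis.repr.injective
  ext i
  rw [Module.Basis.repr_self, gbasis_repr]
  fin_cases i <;> simp

lemma gbasis_one : gbasis 1 = ⟨0, 1⟩ := by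
  apply gbasis.repr.injective
  ext i
  rw [Module.Basis.repr_self, gbasis_repr]
  fin_cases i <;> simp

lemma algNorm (c : GaussianInt) : Algebra.norm ℤ c = c.norm := by
  rw [Algebra.norm_eq_matrix_det gbasis, Matrix.det_fin_two]
  simp only [Algebra.leftMulMatrix_eq_repr_mul, gbasis_repr, gbasis_zero, gbasis_one]
  simp [Zsqrtd.norm]

lemma card_QR (c : GaussianInt) : Nat.card (QR c) = c.norm.natAbs := by
  haveI : Module.Free ℤ GaussianInt := Module.Free.of_basis gbasis
  haveI : Module.Finite ℤ GaussianInt := Module.Finite.of_basis gbasis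
  have := Ideal.absNorm_span_singleton c
  rw [algNorm] at this
  rw [← this]
  rfl

lemma finite_QR {c : GaussianInt} (hc : c ≠ 0) : Finite (QR c) := by
  apply Nat.finite_of_card_ne_zero
  rw [card_QR]
  simpa using hc

noncomputable instance decQR (c : GaussianInt) : DecidableEq (QR c) := Classical.decEq _

lemma QR_mk_eq_zero {c x : GaussianInt} : (Ideal.Quotient.mk (Ideal.span {c}) x) = 0 ↔ c ∣ x := by
  rw [Ideal.Quotient.eq_zero_iff_mem, Ideal.mem_span_singleton]

lemma QR_mk_eq {c x y : GaussianInt} :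
    (Ideal.Quotient.mk (Ideal.span {c}) x) = Ideal.Quotient.mk (Ideal.span {c}) y ↔ c ∣ x - y := by
  rw [Ideal.Quotient.eq, Ideal.mem_span_singleton]

lemma QR_mk_out {c : GaussianInt} (x : QR c) : Ideal.Quotient.mk (Ideal.span {c}) (Quotient.out x) = x :=
  Quotient.out_eq x

lemma annc_mk_le {c m : GaussianInt} (hc : c ≠ 0) (hm : m ≠ 0) [Fintype (QR c)] :
    annc (Ideal.Quotient.mk (Ideal.span {c}) m) ≤ m.norm.natAbs := by
  haveI := finite_QR hm
  haveI := Fintype.ofFinite (QR m)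
  rw [← card_QR, Nat.card_eq_fintype_card]
  unfold annc
  have h : ∀ y : QR c, Ideal.Quotient.mk (Ideal.span {c}) m * y = 0 → ∃ k, m * Quotient.out y = c * k := by
    intro y hy
    rw [← QR_mk_out y, ← map_mul, QR_mk_eq_zero] at hy
    exact hy
  classical
  refine Finset.card_le_card_of_injOn
    (fun y => if hy : Ideal.Quotient.mk (Ideal.span {c}) m * y = 0 then
      Ideal.Quotient.mk (Ideal.span {m}) (h y hy).choose else 0) (fun _ _ => Finset.mem_coe.2 (Finset.mem_univ _)) ?_
  intro y hy y' hy' he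
  simp only [Finset.coe_filter, Finset.mem_univ, true_and, Set.mem_ofPred_eq] at hy hy'
  simp only [hy, hy', dite_true] at he
  rw [QR_mk_eq] at he
  have e1 := (h y hy).choose_spec
  have e2 := (h y' hy').choose_spec
  obtain ⟨l, hl⟩ := he
  rw [← QR_mk_out y, ← QR_mk_out y', QR_mk_eq]
  refine ⟨l, ?_⟩
  apply mul_left_cancel₀ hm
  linear_combination e1 - e2 + c * hl

/-- number of factorizations -/
noncomputable def facT (c : GaussianInt) : ℕ := Nat.card {p : GaussianInt × GaussianInt // p.1 * p.2 = c}

lemma norm_sq_eq (x : GaussianInt) : ‖(x : ℂ)‖ ^ 2 = (x.norm : ℝ) := by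
  rw [GaussianInt.intCast_real_norm, Complex.normSq_eq_norm_sq]

lemma one_le_norm {x : GaussianInt} (hx : x ≠ 0) : 1 ≤ ‖(x : ℂ)‖ := by
  have h1 : 1 ≤ x.norm := by
    have := GaussianInt.norm_pos.2 hx
    omega
  have : (1 : ℝ) ≤ ‖(x : ℂ)‖ ^ 2 := by rw [norm_sq_eq]; exact_mod_cast h1
  nlinarith [norm_nonneg (x : ℂ)]

lemma ball_subset (X : ℝ) : {z : GaussianInt | ‖(z : ℂ)‖ ≤ X} ⊆
    (fun p : ℤ × ℤ => (⟨p.1, p.2⟩ : GaussianInt)) '' (((Finset.Icc (-⌊X⌋) ⌊X⌋) ×ˢ (Finset.Icc (-⌊X⌋) ⌊X⌋) : Finset (ℤ × ℤ)) : Set (ℤ × ℤ)) := by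
  intro z hz
  have hz' : ‖(z : ℂ)‖ ≤ X := hz
  refine ⟨(z.re, z.im), ?_, by cases z; rfl⟩
  have h1 := Complex.abs_re_le_norm (z : ℂ)
  have h2 := Complex.abs_im_le_norm (z : ℂ)
  rw [← GaussianInt.intCast_re] at h1
  rw [← GaussianInt.intCast_im] at h2
  have h1' := abs_le.1 (h1.trans hz')
  have h2' := abs_le.1 (h2.trans hz')
  simp only [Finset.coe_product, Finset.coe_Icc, Set.mem_prod, Set.mem_Icc]
  refine ⟨⟨?_, ?_⟩, ?_, ?_⟩
  · have : -z.re ≤ ⌊X⌋ := Int.le_floor.2 (by push_cast; linarith)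
    omega
  · exact Int.le_floor.2 h1'.2
  · have : -z.im ≤ ⌊X⌋ := Int.le_floor.2 (by push_cast; linarith)
    omega
  · exact Int.le_floor.2 h2'.2

lemma finite_ball (X : ℝ) : {z : GaussianInt | ‖(z : ℂ)‖ ≤ X}.Finite :=
  (Set.Finite.image _ (Finset.finite_toSet _)).subset (ball_subset X)

lemma finset_ball_card {X : ℝ} (hX : 1 ≤ X) (s : Finset GaussianInt) (hs : ∀ z ∈ s, ‖(z : ℂ)‖ ≤ X) :
    (s.card : ℝ) ≤ 9 * X ^ 2 := by
  classical
  have h1 : s ⊆ ((Finset.Icc (-⌊X⌋) ⌊X⌋) ×ˢ (Finset.Icc (-⌊X⌋) ⌊X⌋)).image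
      (fun p : ℤ × ℤ => (⟨p.1, p.2⟩ : GaussianInt)) := by
    intro z hz
    have := ball_subset X (hs z hz)
    rw [← Finset.coe_image] at this
    exact_mod_cast this
  have h2 := (Finset.card_le_card h1).trans Finset.card_image_le
  have h0 : 0 ≤ ⌊X⌋ := Int.floor_nonneg.2 (by linarith)
  have hf : (⌊X⌋ : ℝ) ≤ X := Int.floor_le X
  have h3 : (((Finset.Icc (-⌊X⌋) ⌊X⌋) ×ˢ (Finset.Icc (-⌊X⌋) ⌊X⌋)).card : ℝ) = (2 * (⌊X⌋:ℝ) + 1) ^ 2 := by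
    rw [Finset.card_product, Int.card_Icc]
    have : (((⌊X⌋ + 1 - -⌊X⌋).toNat : ℕ) : ℤ) = 2 * ⌊X⌋ + 1 := by omega
    have h' : (((⌊X⌋ + 1 - -⌊X⌋).toNat : ℕ) : ℝ) = 2 * (⌊X⌋:ℝ) + 1 := by exact_mod_cast this
    push_cast
    rw [h']; ring
  have h4 : (s.card : ℝ) ≤ (2 * (⌊X⌋:ℝ) + 1) ^ 2 := by rw [← h3]; exact_mod_cast h2
  have h5 : (0:ℝ) ≤ ⌊X⌋ := by exact_mod_cast h0
  nlinarith

lemma finite_fac {c : GaussianInt} (hc : c ≠ 0) : Finite {p : GaussianInt × GaussianInt // p.1 * p.2 = c} := by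
  have : ({p : GaussianInt × GaussianInt | p.1 * p.2 = c}).Finite := by
    refine ((finite_ball ‖(c : ℂ)‖).prod (finite_ball ‖(c : ℂ)‖)).subset ?_
    rintro ⟨d, e⟩ h
    have h : d * e = c := h
    have hd : d ≠ 0 := by rintro rfl; simp at h; exact hc h.symm
    have he : e ≠ 0 := by rintro rfl; simp at h; exact hc h.symm
    have h1 := one_le_norm hd
    have h2 := one_le_norm he
    have h3 : ‖(c : ℂ)‖ = ‖(d : ℂ)‖ * ‖(e : ℂ)‖ := by rw [← h]; simp
    simp only [Set.mem_prod, Set.mem_ofPred_eq]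
    constructor <;> rw [h3] <;> nlinarith
  exact this.to_subtype

lemma facT_pos {c : GaussianInt} (hc : c ≠ 0) : 1 ≤ facT c := by
  haveI := finite_fac hc
  haveI : Nonempty {p : GaussianInt × GaussianInt // p.1 * p.2 = c} := ⟨⟨(1, c), by simp⟩⟩
  exact Nat.card_pos

lemma zpc_le {c : GaussianInt} (hc : c ≠ 0) [Fintype (QR c)] :
    zpc (QR c) ≤ c.norm.natAbs * facT c := by
  classical
  haveI := finite_fac hc
  haveI := Fintype.ofFinite {p : GaussianInt × GaussianInt // p.1 * p.2 = c}
  have hne : ∀ p : {p : GaussianInt × GaussianInt // p.1 * p.2 = c}, p.1.1 ≠ 0 ∧ p.1.2 ≠ 0 := by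
    rintro ⟨⟨d, e⟩, h⟩
    constructor
    · rintro rfl; simp at h; exact hc h.symm
    · rintro rfl; simp at h; exact hc h.symm
  haveI h1 : ∀ p : {p : GaussianInt × GaussianInt // p.1 * p.2 = c}, Fintype (QR p.1.1) :=
    fun p => by haveI := finite_QR (hne p).1; exact Fintype.ofFinite _
  haveI h2 : ∀ p : {p : GaussianInt × GaussianInt // p.1 * p.2 = c}, Fintype (QR p.1.2) :=
    fun p => by haveI := finite_QR (hne p).2; exact Fintype.ofFinite _
  have hz : zpc (QR c) = (Finset.univ.filter fun p : QR c × QR c => p.1 * p.2 = 0).card := by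
    unfold zpc annc
    simp only [Finset.card_filter]
    rw [Fintype.sum_prod_type]
  rw [hz]
  have hsub : (Finset.univ.filter fun p : QR c × QR c => p.1 * p.2 = 0) ⊆
      (Finset.univ : Finset {p : GaussianInt × GaussianInt // p.1 * p.2 = c}).biUnion fun p =>
        (Finset.univ : Finset (QR p.1.2 × QR p.1.1)).image fun w =>
          (Ideal.Quotient.mk (Ideal.span {c}) (p.1.1 * Quotient.out w.1),
           Ideal.Quotient.mk (Ideal.span {c}) (p.1.2 * Quotient.out w.2)) := by
    rintro ⟨x, y⟩ hxy
    simp only [Finset.mem_filter, Finset.mem_univ, true_and] at hxy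
    rw [← QR_mk_out x, ← QR_mk_out y, ← map_mul, QR_mk_eq_zero] at hxy
    obtain ⟨d, e, ⟨x1, hd⟩, ⟨y1, he⟩, hde⟩ := exists_dvd_and_dvd_of_dvd_mul hxy
    simp only [Finset.mem_biUnion, Finset.mem_univ, true_and, Finset.mem_image]
    refine ⟨⟨(d, e), hde.symm⟩, (Ideal.Quotient.mk (Ideal.span {e}) x1, Ideal.Quotient.mk (Ideal.span {d}) y1), ?_⟩
    rw [Prod.mk.injEq]
    constructor
    · conv_rhs => rw [← QR_mk_out x]
      rw [QR_mk_eq, hd]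
      refine (dvd_of_eq hde).trans ?_
      change d * e ∣ d * Quotient.out (Ideal.Quotient.mk (Ideal.span {e}) x1) - d * x1
      rw [← mul_sub]
      apply mul_dvd_mul_left
      rw [← QR_mk_eq]
      exact QR_mk_out _
    · conv_rhs => rw [← QR_mk_out y]
      rw [QR_mk_eq, he]
      refine (dvd_of_eq hde).trans ?_
      change d * e ∣ e * Quotient.out (Ideal.Quotient.mk (Ideal.span {d}) y1) - e * y1
      rw [← mul_sub, mul_comm d e]
      apply mul_dvd_mul_left
      rw [← QR_mk_eq]
      exact QR_mk_out _
  refine (Finset.card_le_card hsub).trans (Finset.card_biUnion_le.trans ?_)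
  calc _ ≤ ∑ p : {p : GaussianInt × GaussianInt // p.1 * p.2 = c}, c.norm.natAbs := by
        refine Finset.sum_le_sum fun p _ => Finset.card_image_le.trans ?_
        rw [Finset.card_univ, Fintype.card_prod, ← Nat.card_eq_fintype_card, ← Nat.card_eq_fintype_card,
          card_QR, card_QR, ← Int.natAbs_mul, ← Zsqrtd.norm_mul, mul_comm, p.2]
    _ = _ := by
      rw [Finset.sum_const, Finset.card_univ, smul_eq_mul, facT, Nat.card_eq_fintype_card, mul_comm]

lemma efn_add (x y : ℂ) : efn (x + y) = efn x * efn y := by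
  unfold efn; rw [← Complex.exp_add]; congr 1; simp; ring

lemma efn_zero : efn 0 = 1 := by simp [efn]

lemma efn_eq_one_iff (z : ℂ) : efn z = 1 ↔ ∃ n : ℤ, z.re = n := by
  unfold efn
  rw [Complex.exp_eq_one_iff]
  have hpi : (2 * (Real.pi : ℂ) * I) ≠ 0 := by simp [Real.pi_ne_zero]
  constructor
  · rintro ⟨n, hn⟩
    refine ⟨n, ?_⟩
    rw [mul_comm (n : ℂ)] at hn
    have := mul_left_cancel₀ hpi hn
    exact_mod_cast this
  · rintro ⟨n, hn⟩
    exact ⟨n, by rw [hn]; push_cast; ring⟩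

lemma efn_int (x : GaussianInt) : efn (x : ℂ) = 1 := by
  rw [efn_eq_one_iff]
  exact ⟨x.re, by simp⟩

lemma efn_congr {c x y : GaussianInt} (hc : c ≠ 0) (h : c ∣ x - y) : efn ((x : ℂ) / c) = efn ((y : ℂ) / c) := by
  obtain ⟨k, hk⟩ := h
  have hc' : (c : ℂ) ≠ 0 := by simpa using hc
  have : (x : ℂ) / c = (y : ℂ) / c + (k : ℂ) := by
    have hx : x = y + c * k := by rw [← hk]; ring
    rw [hx]; push_cast; field_simp; simp
  rw [this, efn_add, efn_int, mul_one]

/-- the additive character -/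
noncomputable def psi (c : GaussianInt) (hc : c ≠ 0) : AddChar (QR c) ℂ where
  toFun x := efn (((Quotient.out x : GaussianInt) : ℂ) / c)
  map_zero_eq_one' := by
    have : efn (((Quotient.out (0 : QR c) : GaussianInt) : ℂ) / c) = efn (((0 : GaussianInt) : ℂ) / c) := by
      apply efn_congr hc
      rw [← QR_mk_eq]
      exact QR_mk_out _
    rw [this]; simp [efn_zero]
  map_add_eq_mul' x y := by
    have : efn (((Quotient.out (x + y : QR c) : GaussianInt) : ℂ) / c) =
        efn (((Quotient.out x + Quotient.out y : GaussianInt) : ℂ) / c) := by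
      apply efn_congr hc
      rw [← QR_mk_eq, map_add]
      rw [QR_mk_out, QR_mk_out, QR_mk_out]
    rw [this, ← efn_add]
    congr 1; rw [GaussianInt.toComplex_add]; ring

lemma psi_mk {c : GaussianInt} (hc : c ≠ 0) (x : GaussianInt) :
    psi c hc (Ideal.Quotient.mk (Ideal.span {c}) x) = efn ((x : ℂ) / c) := by
  change efn _ = _
  apply efn_congr hc
  rw [← QR_mk_eq]
  exact QR_mk_out _

lemma psi_prim {c : GaussianInt} (hc : c ≠ 0) : (psi c hc).IsPrimitive := by
  intro a ha h
  apply ha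
  have hc' : (c : ℂ) ≠ 0 := by simpa using hc
  rw [← QR_mk_out a] at h ⊢
  set m : GaussianInt := Quotient.out a
  have key : ∀ x : GaussianInt, efn (((m * x : GaussianInt) : ℂ) / c) = 1 := by
    intro x
    rw [← psi_mk hc, map_mul, ← AddChar.mulShift_apply, h]; simp
  obtain ⟨r, hr⟩ := (efn_eq_one_iff _).1 (key 1)
  obtain ⟨s, hs⟩ := (efn_eq_one_iff _).1 (key ⟨0, 1⟩)
  rw [QR_mk_eq_zero]
  refine ⟨⟨r, -s⟩, ?_⟩
  rw [← GaussianInt.toComplex_inj]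
  have h1 : (m : ℂ) / c = r - s * I := by
    apply Complex.ext
    · simpa using hr
    · have : ((m * (⟨0, 1⟩ : GaussianInt) : GaussianInt) : ℂ) / c = (m : ℂ) / c * I := by
        rw [GaussianInt.toComplex_mul, GaussianInt.toComplex_def' 0 1]; push_cast; ring
      rw [this] at hs
      simp at hs ⊢
      linarith
  rw [div_eq_iff hc'] at h1
  rw [h1, GaussianInt.toComplex_mul, GaussianInt.toComplex_def' r (-s)]
  push_cast; ring

lemma kloosterman_eq {c : GaussianInt} (hc : c ≠ 0) [Fintype (QR c)] (m n : GaussianInt) :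
    kloosterman m n c = Kl (psi c hc) (Ideal.Quotient.mk (Ideal.span {c}) m) (Ideal.Quotient.mk (Ideal.span {c}) n) := by
  unfold kloosterman Kl
  rw [finsum_eq_sum_of_fintype]
  refine Finset.sum_congr rfl fun u _ => ?_
  rw [← psi_mk hc]
  congr 1
  rw [map_add, map_mul, map_mul, QR_mk_out, QR_mk_out, mul_comm, mul_comm (Ideal.Quotient.mk (Ideal.span {c}) n)]

lemma normc (c : GaussianInt) : (c.norm.natAbs : ℝ) = ‖(c : ℂ)‖ ^ 2 := by
  rw [norm_sq_eq, GaussianInt.natCast_natAbs_norm]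

/-- `q`-trivial bound and weak Kloosterman bound -/
lemma kloosterman_trivial {c : GaussianInt} (hc : c ≠ 0) (m n : GaussianInt) :
    ‖kloosterman m n c‖ ≤ ‖(c : ℂ)‖ ^ 2 := by
  haveI := finite_QR hc
  haveI := Fintype.ofFinite (QR c)
  rw [kloosterman_eq hc, ← normc, ← card_QR, Nat.card_eq_fintype_card]
  refine (norm_Kl_le _ _ _).trans ?_
  exact_mod_cast Fintype.card_le_of_injective _ Units.val_injective

lemma kloosterman_five {c : GaussianInt} (hc : c ≠ 0) {m : GaussianInt} (hm : m ≠ 0) (n : GaussianInt) :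
    ‖kloosterman m n c‖ ^ 5 ≤ 4 * ‖(m : ℂ)‖ ^ 2 * (‖(c : ℂ)‖ ^ 2) ^ 4 * (facT c : ℝ) ^ 2 := by
  haveI := finite_QR hc
  haveI := Fintype.ofFinite (QR c)
  rw [kloosterman_eq hc]
  refine (Kl_five (psi_prim hc) _ _).trans ?_
  have h1 : (annc (Ideal.Quotient.mk (Ideal.span {c}) m) : ℝ) ≤ ‖(m : ℂ)‖ ^ 2 := by
    rw [← normc]; exact_mod_cast annc_mk_le hc hm
  have h2 : (annc (2 : QR c) : ℝ) ≤ 4 := by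
    have := annc_mk_le (c := c) (m := 2) hc (by decide)
    have h : (2 : QR c) = Ideal.Quotient.mk (Ideal.span {c}) 2 := rfl
    rw [h]
    refine (Nat.cast_le.2 this).trans ?_
    norm_num [Zsqrtd.norm]
  have h3 : (zpc (QR c) : ℝ) ≤ ‖(c : ℂ)‖ ^ 2 * facT c := by
    rw [← normc]; exact_mod_cast zpc_le hc
  have h4 : (Fintype.card (QR c) : ℝ) = ‖(c : ℂ)‖ ^ 2 := by
    rw [← normc, ← card_QR, Nat.card_eq_fintype_card]
  rw [h4]
  calc _ ≤ ‖(m : ℂ)‖ ^ 2 * ((‖(c : ℂ)‖ ^ 2) ^ 2 * (4 * (‖(c : ℂ)‖ ^ 2 * facT c) ^ 2)) := by gcongr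
    _ = _ := by ring

end KT

namespace KT

open MeasureTheory

lemma summable_int_aux {s : ℝ} (hs : 1 < s) : Summable fun a : ℤ => (1 + |(a : ℝ)|) ^ (-s) := by
  have h := Real.summable_abs_int_rpow hs
  have h0 : Summable fun a : ℤ => (if a = 0 then (1:ℝ) else 0) :=
    (hasSum_ite_eq (0:ℤ) (1:ℝ)).summable
  refine Summable.of_nonneg_of_le (fun a => by positivity) (fun a => ?_) (h.add h0)
  by_cases ha : a = 0
  · subst ha
    simp
    exact Real.rpow_nonneg le_rfl _
  · simp only [ha, if_false, add_zero]
    have : (0:ℝ) < |(a : ℝ)| := by positivity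
    apply Real.rpow_le_rpow_of_nonpos this (by linarith) (by linarith)

/-- Gaussian integers as pairs -/
def geq : GaussianInt ≃ ℤ × ℤ where
  toFun z := (z.re, z.im)
  invFun p := ⟨p.1, p.2⟩
  left_inv z := by cases z; rfl
  right_inv p := rfl

lemma summable_gauss_aux {s : ℝ} (hs : 1 < s) :
    Summable fun z : GaussianInt => (1 + |(z.re : ℝ)|) ^ (-s) * (1 + |(z.im : ℝ)|) ^ (-s) := by
  have := Summable.mul_of_nonneg (summable_int_aux hs) (summable_int_aux hs)
    (fun a => by simp only [Pi.zero_apply]; positivity) (fun a => by simp only [Pi.zero_apply]; positivity)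
  exact (geq.summable_iff (f := fun p : ℤ × ℤ => (1 + |(p.1 : ℝ)|) ^ (-s) * (1 + |(p.2 : ℝ)|) ^ (-s))).2 this

lemma norm_sq_re_im (z : GaussianInt) : ‖(z : ℂ)‖ ^ 2 = (z.re : ℝ) ^ 2 + (z.im : ℝ) ^ 2 := by
  rw [norm_sq_eq, Zsqrtd.norm]; push_cast; ring

lemma summable_q {s : ℝ} (hs : 1 < s) :
    Summable fun z : {z : GaussianInt // z ≠ 0} => (‖((z : GaussianInt) : ℂ)‖ ^ 2) ^ (-s) := by
  have h1 := ((summable_gauss_aux hs).mul_left ((4:ℝ) ^ s)).comp_injective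
    (Subtype.val_injective (p := fun z : GaussianInt => z ≠ 0))
  refine Summable.of_nonneg_of_le (fun a => by positivity) (fun z => ?_) h1
  have hq := one_le_norm z.2
  have hq2 : 1 ≤ ‖((z : GaussianInt) : ℂ)‖ ^ 2 := by nlinarith
  simp only [Function.comp]
  rw [← Real.mul_rpow (by positivity) (by positivity)]
  have h4 : (4:ℝ) ^ s = (4⁻¹ : ℝ) ^ (-s) := by
    rw [Real.inv_rpow (by norm_num), Real.rpow_neg (by norm_num), inv_inv]
  rw [h4, ← Real.mul_rpow (by positivity) (by positivity)]
  apply Real.rpow_le_rpow_of_nonpos (by positivity) _ (by linarith)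
  have := norm_sq_re_im (z : GaussianInt)
  have e1 := sq_abs ((z : GaussianInt).re : ℝ)
  have e2 := sq_abs ((z : GaussianInt).im : ℝ)
  nlinarith [sq_nonneg (|((z : GaussianInt).re : ℝ)| - |((z : GaussianInt).im : ℝ)|),
    sq_nonneg (|((z : GaussianInt).re : ℝ)| - 1), sq_nonneg (|((z : GaussianInt).im : ℝ)| - 1)]

lemma summable_exp : Summable fun z : GaussianInt => Real.exp (-‖(z : ℂ)‖ ^ 2) := by
  refine Summable.of_nonneg_of_le (fun a => by positivity) (fun z => ?_)
    ((summable_gauss_aux (s := 2) (by norm_num)).mul_left 4)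
  have key : ∀ x : ℝ, Real.exp (-x ^ 2) ≤ 2 * (1 + |x|) ^ (-2 : ℝ) := by
    intro x
    rw [Real.rpow_neg (by positivity), Real.exp_neg, Real.rpow_two, ← div_eq_mul_inv, inv_eq_one_div,
      div_le_div_iff₀ (Real.exp_pos _) (by positivity)]
    have := Real.add_one_le_exp (x ^ 2)
    have e1 := sq_abs x
    nlinarith [sq_nonneg (|x| - 1)]
  rw [norm_sq_re_im, neg_add, Real.exp_add]
  calc _ ≤ (2 * (1 + |(z.re : ℝ)|) ^ (-2 : ℝ)) * (2 * (1 + |(z.im : ℝ)|) ^ (-2 : ℝ)) := by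
        gcongr
        · exact key _
        · exact key _
    _ = _ := by ring

/-- the Gaussian lattice constant -/
noncomputable def C0 : ℝ := ∑' z : GaussianInt, Real.exp (-‖(z : ℂ)‖ ^ 2)

lemma C0_nonneg : 0 ≤ C0 := tsum_nonneg fun _ => (Real.exp_pos _).le

lemma row_sum {c : GaussianInt} (hc : c ≠ 0) (s : Finset GaussianInt) (m : GaussianInt)
    [DecidablePred fun m' => c ∣ m - m'] :
    ∑ m' ∈ s.filter (fun m' => c ∣ m - m'), Real.exp (-(‖(m : ℂ) - m'‖ ^ 2 / ‖(c : ℂ)‖ ^ 2)) ≤ C0 := by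
  classical
  have hc' : (c : ℂ) ≠ 0 := by simpa using hc
  have hq : ∀ m' ∈ s.filter (fun m' => c ∣ m - m'), (m - m') = c * ((m - m') / c) := by
    intro m' hm'
    simp only [Finset.mem_filter] at hm'
    exact (EuclideanDomain.mul_div_cancel' hc hm'.2).symm
  have h1 : ∑ m' ∈ s.filter (fun m' => c ∣ m - m'), Real.exp (-(‖(m : ℂ) - m'‖ ^ 2 / ‖(c : ℂ)‖ ^ 2))
      = ∑ k ∈ (s.filter (fun m' => c ∣ m - m')).image (fun m' => (m - m') / c), Real.exp (-‖(k : ℂ)‖ ^ 2) := by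
    rw [Finset.sum_image]
    · refine Finset.sum_congr rfl fun m' hm' => ?_
      have : (m : ℂ) - m' = c * (((m - m') / c : GaussianInt) : ℂ) := by
        rw [← GaussianInt.toComplex_sub, ← GaussianInt.toComplex_mul, ← hq m' hm']
      rw [this, norm_mul]
      have hcn : ‖(c : ℂ)‖ ≠ 0 := by simpa using hc'
      congr 1; field_simp
    · intro a ha b hb h
      have e1 := hq a ha
      have e2 := hq b hb
      simp only at h
      rw [h] at e1
      have := e1.trans e2.symm
      simpa using this
  rw [h1]
  exact summable_exp.sum_le_tsum _ (fun _ _ => (Real.exp_pos _).le)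

/-- Schur test over congruence classes -/
lemma schur {c : GaussianInt} (hc : c ≠ 0) (s : Finset GaussianInt) (b : GaussianInt → ℂ)
    (W : GaussianInt → GaussianInt → ℂ) (D : ℝ) (hD : 0 ≤ D)
    (hW : ∀ m ∈ s, ∀ m' ∈ s, ‖W m m'‖ ≤ D * Real.exp (-(‖(m : ℂ) - m'‖ ^ 2 / ‖(c : ℂ)‖ ^ 2)))
    [∀ m m' : GaussianInt, Decidable (c ∣ m - m')] :
    ‖∑ m ∈ s, ∑ m' ∈ s, (if c ∣ m - m' then b m * conj (b m') * W m m' else 0)‖ ≤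
      D * C0 * ∑ m ∈ s, ‖b m‖ ^ 2 := by
  set w : GaussianInt → GaussianInt → ℝ := fun m m' =>
    if c ∣ m - m' then Real.exp (-(‖(m : ℂ) - m'‖ ^ 2 / ‖(c : ℂ)‖ ^ 2)) else 0 with hw
  have hw0 : ∀ m m', 0 ≤ w m m' := by
    intro m m'; simp only [hw]; split_ifs <;> positivity
  have hsymm : ∀ m m', w m m' = w m' m := by
    intro m m'
    by_cases h : c ∣ m - m'
    · have h' : c ∣ m' - m := (dvd_sub_comm).1 h
      simp only [hw, if_pos h, if_pos h', norm_sub_rev]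
    · have h' : ¬ c ∣ m' - m := fun h2 => h ((dvd_sub_comm).1 h2)
      simp only [hw, if_neg h, if_neg h']
  have hrow : ∀ m, ∑ m' ∈ s, w m m' ≤ C0 := by
    intro m
    have := row_sum hc s m
    rwa [Finset.sum_filter] at this
  have h1 : ‖∑ m ∈ s, ∑ m' ∈ s, (if c ∣ m - m' then b m * conj (b m') * W m m' else 0)‖ ≤
      ∑ m ∈ s, ∑ m' ∈ s, D * ((‖b m‖ ^ 2 / 2) * w m m' + (‖b m'‖ ^ 2 / 2) * w m m') := by
    refine (norm_sum_le _ _).trans (Finset.sum_le_sum fun m hm => (norm_sum_le _ _).trans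
      (Finset.sum_le_sum fun m' hm' => ?_))
    simp only [hw]
    split_ifs with h
    · rw [norm_mul, norm_mul, Complex.norm_conj]
      have := hW m hm m' hm'
      have h3 : ‖b m‖ * ‖b m'‖ ≤ ‖b m‖ ^ 2 / 2 + ‖b m'‖ ^ 2 / 2 := by nlinarith [sq_nonneg (‖b m‖ - ‖b m'‖)]
      calc ‖b m‖ * ‖b m'‖ * ‖W m m'‖ ≤ (‖b m‖ ^ 2 / 2 + ‖b m'‖ ^ 2 / 2) *
            (D * Real.exp (-(‖(m : ℂ) - m'‖ ^ 2 / ‖(c : ℂ)‖ ^ 2))) := by gcongr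
        _ = _ := by ring
    · simp
  refine h1.trans ?_
  have h2 : ∑ m ∈ s, ∑ m' ∈ s, D * ((‖b m‖ ^ 2 / 2) * w m m' + (‖b m'‖ ^ 2 / 2) * w m m')
      = D * (∑ m ∈ s, (‖b m‖ ^ 2 / 2) * ∑ m' ∈ s, w m m' + ∑ m' ∈ s, (‖b m'‖ ^ 2 / 2) * ∑ m ∈ s, w m' m) := by
    have e1 : ∑ m ∈ s, ∑ m' ∈ s, (‖b m'‖ ^ 2 / 2) * w m m' =
        ∑ m' ∈ s, (‖b m'‖ ^ 2 / 2) * ∑ m ∈ s, w m' m := by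
      rw [Finset.sum_comm]
      refine Finset.sum_congr rfl fun m _ => ?_
      rw [Finset.mul_sum]
      refine Finset.sum_congr rfl fun m' _ => ?_
      rw [hsymm]
    have e2 : ∑ m ∈ s, ∑ m' ∈ s, (‖b m‖ ^ 2 / 2) * w m m' =
        ∑ m ∈ s, (‖b m‖ ^ 2 / 2) * ∑ m' ∈ s, w m m' :=
      Finset.sum_congr rfl fun m _ => (Finset.mul_sum _ _ _).symm
    refine Eq.trans ?_ (congrArg (fun x => D * x) (congrArg₂ (· + ·) e2 e1))
    rw [← Finset.sum_add_distrib, Finset.mul_sum]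
    refine Finset.sum_congr rfl fun m _ => ?_
    rw [← Finset.sum_add_distrib, Finset.mul_sum]
  rw [h2, mul_assoc]
  gcongr
  rw [Finset.mul_sum, ← Finset.sum_add_distrib]
  refine Finset.sum_le_sum fun m _ => ?_
  have := mul_le_mul_of_nonneg_left (hrow m) (by positivity : 0 ≤ ‖b m‖ ^ 2 / 2)
  linarith

/-- square-integral with characters, summed over all residues -/
lemma sum_char_sq {c : GaussianInt} (hc : c ≠ 0) [Fintype (QR c)] (s : Finset GaussianInt)
    (b : GaussianInt → ℂ) (φ : GaussianInt → ℂ → ℂ)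
    (hφ : ∀ m ∈ s, ∀ m' ∈ s, Integrable fun t => φ m t * conj (φ m' t)) (D : ℝ) (hD : 0 ≤ D)
    (hW : ∀ m ∈ s, ∀ m' ∈ s, ‖∫ t, φ m t * conj (φ m' t)‖ ≤
      D * Real.exp (-(‖(m : ℂ) - m'‖ ^ 2 / ‖(c : ℂ)‖ ^ 2))) :
    (∀ u : QR c, Integrable fun t => ‖∑ m ∈ s, b m * psi c hc (u * Ideal.Quotient.mk _ m) * φ m t‖ ^ 2) ∧
    ∑ u : QR c, ∫ t, ‖∑ m ∈ s, b m * psi c hc (u * Ideal.Quotient.mk _ m) * φ m t‖ ^ 2 ≤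
      ‖(c : ℂ)‖ ^ 2 * (D * C0 * ∑ m ∈ s, ‖b m‖ ^ 2) := by
  classical
  set χ : QR c → GaussianInt → ℂ := fun u m => psi c hc (u * Ideal.Quotient.mk _ m) with hχ
  have expand : ∀ u : QR c, ∀ t : ℂ, ((‖∑ m ∈ s, b m * χ u m * φ m t‖ ^ 2 : ℝ) : ℂ) =
      ∑ m ∈ s, ∑ m' ∈ s, (b m * χ u m * conj (b m' * χ u m')) * (φ m t * conj (φ m' t)) := by
    intro u t
    push_cast
    rw [← Complex.mul_conj', map_sum, Finset.sum_mul_sum]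
    refine Finset.sum_congr rfl fun m _ => Finset.sum_congr rfl fun m' _ => ?_
    simp only [map_mul]; ring
  have hintC : ∀ u : QR c, Integrable fun t => ((‖∑ m ∈ s, b m * χ u m * φ m t‖ ^ 2 : ℝ) : ℂ) := by
    intro u
    simp_rw [expand]
    exact integrable_finsetSum _ fun m hm => integrable_finsetSum _ fun m' hm' =>
      (hφ m hm m' hm').const_mul _
  refine ⟨fun u => by simpa only [RCLike.re_to_complex, Complex.ofReal_re] using (hintC u).re, ?_⟩
  have hI : ∀ u : QR c, ((∫ t, ‖∑ m ∈ s, b m * χ u m * φ m t‖ ^ 2 : ℝ) : ℂ) =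
      ∑ m ∈ s, ∑ m' ∈ s, (b m * χ u m * conj (b m' * χ u m')) * ∫ t, (φ m t * conj (φ m' t)) := by
    intro u
    rw [← integral_complex_ofReal]
    simp_rw [expand]
    rw [integral_finsetSum _ fun m hm => integrable_finsetSum _ fun m' hm' => (hφ m hm m' hm').const_mul _]
    refine Finset.sum_congr rfl fun m hm => ?_
    rw [integral_finsetSum _ fun m' hm' => (hφ m hm m' hm').const_mul _]
    exact Finset.sum_congr rfl fun m' hm' => integral_const_mul _ _
  have horth : ∀ m m' : GaussianInt, ∑ u : QR c, χ u m * conj (χ u m') =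
      if c ∣ m - m' then ((‖(c : ℂ)‖ ^ 2 : ℝ) : ℂ) else 0 := by
    intro m m'
    have : ∀ u, χ u m * conj (χ u m') = psi c hc (u * (Ideal.Quotient.mk _ m - Ideal.Quotient.mk _ m')) := by
      intro u
      simp only [hχ]
      rw [← AddChar.map_neg_eq_conj, ← AddChar.map_add_eq_mul]
      congr 1; ring
    simp_rw [this]
    rw [AddChar.sum_mulShift _ (psi_prim hc), ← map_sub, ← Nat.card_eq_fintype_card, card_QR,
      ← normc]
    by_cases h : c ∣ m - m'
    · rw [if_pos h, if_pos (QR_mk_eq_zero.2 h)]; simp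
    · rw [if_neg h, if_neg (fun h2 => h (QR_mk_eq_zero.1 h2))]; simp
  have htot : ((∑ u : QR c, ∫ t, ‖∑ m ∈ s, b m * χ u m * φ m t‖ ^ 2 : ℝ) : ℂ) =
      ((‖(c : ℂ)‖ ^ 2 : ℝ) : ℂ) * ∑ m ∈ s, ∑ m' ∈ s,
        (if c ∣ m - m' then b m * conj (b m') * ∫ t, (φ m t * conj (φ m' t)) else 0) := by
    push_cast
    simp_rw [hI]
    rw [Finset.sum_comm, Finset.mul_sum]
    refine Finset.sum_congr rfl fun m _ => ?_
    rw [Finset.sum_comm, Finset.mul_sum]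
    refine Finset.sum_congr rfl fun m' _ => ?_
    have : ∀ u : QR c, (b m * χ u m * conj (b m' * χ u m')) * ∫ t, (φ m t * conj (φ m' t)) =
        (b m * conj (b m') * ∫ t, (φ m t * conj (φ m' t))) * (χ u m * conj (χ u m')) := by
      intro u; rw [map_mul]; ring
    simp_rw [this]
    rw [← Finset.mul_sum, horth]
    split_ifs
    · push_cast; ring
    · simp
  have hnn : 0 ≤ ∑ u : QR c, ∫ t, ‖∑ m ∈ s, b m * χ u m * φ m t‖ ^ 2 :=
    Finset.sum_nonneg fun u _ => integral_nonneg fun t => by positivity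
  calc _ = ‖((∑ u : QR c, ∫ t, ‖∑ m ∈ s, b m * χ u m * φ m t‖ ^ 2 : ℝ) : ℂ)‖ := by
        rw [Complex.norm_real, Real.norm_of_nonneg hnn]
    _ ≤ _ := by
      rw [htot, norm_mul, Complex.norm_real, Real.norm_of_nonneg (by positivity)]
      gcongr
      exact schur hc s b (fun m m' => ∫ t, (φ m t * conj (φ m' t))) D hD hW

/-- abstract double large sieve -/
lemma dls {c : GaussianInt} (hc : c ≠ 0) (s : Finset GaussianInt)
    (b d : GaussianInt → ℂ) (φ χ : GaussianInt → ℂ → ℂ)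
    (hφ : ∀ m ∈ s, ∀ m' ∈ s, Integrable fun t => φ m t * conj (φ m' t))
    (hχ : ∀ m ∈ s, ∀ m' ∈ s, Integrable fun t => χ m t * conj (χ m' t))
    (hφχ : ∀ m ∈ s, ∀ m' ∈ s, Integrable fun t => φ m t * χ m' t)
    (D1 D2 : ℝ) (hD1 : 0 ≤ D1) (hD2 : 0 ≤ D2)
    (hW1 : ∀ m ∈ s, ∀ m' ∈ s, ‖∫ t, φ m t * conj (φ m' t)‖ ≤
      D1 * Real.exp (-(‖(m : ℂ) - m'‖ ^ 2 / ‖(c : ℂ)‖ ^ 2)))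
    (hW2 : ∀ m ∈ s, ∀ m' ∈ s, ‖∫ t, χ m t * conj (χ m' t)‖ ≤
      D2 * Real.exp (-(‖(m : ℂ) - m'‖ ^ 2 / ‖(c : ℂ)‖ ^ 2)))
    (l : ℝ) (hl : 0 < l) :
    ‖∑ m ∈ s, ∑ n ∈ s, b m * d n * kloosterman m n c * ∫ t, φ m t * χ n t‖ ≤
      ‖(c : ℂ)‖ ^ 2 * C0 * (l * D1 * ∑ m ∈ s, ‖b m‖ ^ 2 + l⁻¹ * D2 * ∑ m ∈ s, ‖d m‖ ^ 2) := by
  haveI := finite_QR hc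
  haveI := Fintype.ofFinite (QR c)
  classical
  obtain ⟨iF, hF⟩ := sum_char_sq hc s b φ hφ D1 hD1 hW1
  obtain ⟨iG, hG⟩ := sum_char_sq hc s d χ hχ D2 hD2 hW2
  set F : QR c → ℂ → ℂ := fun u t => ∑ m ∈ s, b m * psi c hc (u * Ideal.Quotient.mk _ m) * φ m t with hFdef
  set G : QR c → ℂ → ℂ := fun u t => ∑ m ∈ s, d m * psi c hc (u * Ideal.Quotient.mk _ m) * χ m t with hGdef
  have hprod : ∀ u v : QR c, ∫ t, F u t * G v t = ∑ m ∈ s, ∑ n ∈ s,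
      b m * d n * (psi c hc (u * Ideal.Quotient.mk _ m) * psi c hc (v * Ideal.Quotient.mk _ n)) * ∫ t, φ m t * χ n t := by
    intro u v
    have : ∀ t, F u t * G v t = ∑ m ∈ s, ∑ n ∈ s,
      b m * d n * (psi c hc (u * Ideal.Quotient.mk _ m) * psi c hc (v * Ideal.Quotient.mk _ n)) * (φ m t * χ n t) := by
      intro t
      simp only [hFdef, hGdef]
      rw [Finset.sum_mul_sum]
      refine Finset.sum_congr rfl fun m _ => Finset.sum_congr rfl fun m' _ => ?_
      ring
    simp_rw [this]
    rw [integral_finsetSum _ fun m hm => integrable_finsetSum _ fun m' hm' => (hφχ m hm m' hm').const_mul _]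
    refine Finset.sum_congr rfl fun m hm => ?_
    rw [integral_finsetSum _ fun m' hm' => (hφχ m hm m' hm').const_mul _]
    exact Finset.sum_congr rfl fun m' hm' => integral_const_mul _ _
  have hsum : ∑ m ∈ s, ∑ n ∈ s, b m * d n * kloosterman m n c * ∫ t, φ m t * χ n t =
      ∑ u : (QR c)ˣ, ∫ t, F (u : QR c) t * G ((u⁻¹ : (QR c)ˣ) : QR c) t := by
    simp_rw [hprod]
    symm
    rw [Finset.sum_comm]
    refine Finset.sum_congr rfl fun m _ => ?_
    rw [Finset.sum_comm]
    refine Finset.sum_congr rfl fun n _ => ?_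
    symm
    rw [kloosterman_eq hc, Kl, Finset.mul_sum, Finset.sum_mul]
    refine Finset.sum_congr rfl fun u _ => ?_
    rw [← AddChar.map_add_eq_mul]
    congr 3
    ring
  rw [hsum]
  have hone : ∀ u v : QR c, ‖∫ t, F u t * G v t‖ ≤ l * (∫ t, ‖F u t‖ ^ 2) + l⁻¹ * ∫ t, ‖G v t‖ ^ 2 := by
    intro u v
    refine (norm_integral_le_integral_norm _).trans ?_
    rw [← integral_const_mul, ← integral_const_mul, ← integral_add ((iF u).const_mul _) ((iG v).const_mul _)]
    refine integral_mono_of_nonneg (Filter.Eventually.of_forall fun t => norm_nonneg _)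
      (((iF u).const_mul _).add ((iG v).const_mul _)) (Filter.Eventually.of_forall fun t => ?_)
    simp only [norm_mul]
    change ‖F u t‖ * ‖G v t‖ ≤ l * ‖F u t‖ ^ 2 + l⁻¹ * ‖G v t‖ ^ 2
    have hl1 : l * l⁻¹ = 1 := mul_inv_cancel₀ hl.ne'
    have h1 : 0 ≤ l⁻¹ * (l * ‖F u t‖ - ‖G v t‖) ^ 2 := by positivity
    have h2 : l⁻¹ * (l * ‖F u t‖ - ‖G v t‖) ^ 2 = (l * l⁻¹) * l * ‖F u t‖ ^ 2 - 2 * (l * l⁻¹) * (‖F u t‖ * ‖G v t‖) + l⁻¹ * ‖G v t‖ ^ 2 := by ring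
    rw [h2, hl1] at h1
    have : 0 ≤ ‖F u t‖ * ‖G v t‖ := by positivity
    linarith
  have hunit : ∀ f : QR c → ℝ, (∀ u, 0 ≤ f u) → ∑ u : (QR c)ˣ, f (u : QR c) ≤ ∑ u, f u := by
    intro f hf
    rw [← Finset.sum_image (f := f) (s := (Finset.univ : Finset (QR c)ˣ)) (g := fun u : (QR c)ˣ => (u : QR c))
      (fun a _ b _ h => Units.ext h)]
    exact Finset.sum_le_sum_of_subset_of_nonneg (Finset.subset_univ _) fun u _ _ => hf u
  calc _ ≤ ∑ u : (QR c)ˣ, (l * (∫ t, ‖F (u : QR c) t‖ ^ 2) + l⁻¹ * ∫ t, ‖G ((u⁻¹ : (QR c)ˣ) : QR c) t‖ ^ 2) :=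
        (norm_sum_le _ _).trans (Finset.sum_le_sum fun u _ => hone _ _)
    _ = l * (∑ u : (QR c)ˣ, ∫ t, ‖F (u : QR c) t‖ ^ 2) + l⁻¹ * ∑ u : (QR c)ˣ, ∫ t, ‖G (u : QR c) t‖ ^ 2 := by
        rw [Finset.sum_add_distrib, ← Finset.mul_sum, ← Finset.mul_sum]
        congr 2
        exact Fintype.sum_equiv (Equiv.inv _) _ _ fun u => rfl
    _ ≤ l * (‖(c : ℂ)‖ ^ 2 * (D1 * C0 * ∑ m ∈ s, ‖b m‖ ^ 2)) + l⁻¹ * (‖(c : ℂ)‖ ^ 2 * (D2 * C0 * ∑ m ∈ s, ‖d m‖ ^ 2)) := by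
        gcongr
        · exact (hunit (fun u => ∫ t, ‖F u t‖ ^ 2) fun u => integral_nonneg fun t => by positivity).trans hF
        · exact (hunit (fun u => ∫ t, ‖G u t‖ ^ 2) fun u => integral_nonneg fun t => by positivity).trans hG
    _ = _ := by ring
end KT

namespace KT

open MeasureTheory

lemma gauss_integrable {b : ℝ} (hb : 0 < b) (κ : ℂ) :
    Integrable fun t : ℂ => cexp (-(b : ℂ) * (‖t‖ : ℂ) ^ 2 + I * ((κ * t).re : ℝ)) := by
  have h := GaussianFourier.integrable_cexp_neg_mul_sq_norm_add (V := ℂ) (b := (b : ℂ)) (by simpa using hb) I (conj κ)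
  refine h.congr (Filter.Eventually.of_forall fun t => ?_)
  simp only [Complex.inner, Complex.conj_conj, mul_comm t κ]

lemma gauss_int {b : ℝ} (hb : 0 < b) (κ : ℂ) :
    ∫ t : ℂ, cexp (-(b : ℂ) * (‖t‖ : ℂ) ^ 2 + I * ((κ * t).re : ℝ)) =
      (π / b : ℝ) * (Real.exp (-(‖κ‖ ^ 2 / (4 * b))) : ℝ) := by
  have h := GaussianFourier.integral_cexp_neg_mul_sq_norm_add (V := ℂ) (b := (b : ℂ)) (by simpa using hb) I (conj κ)
  simp only [Complex.inner, Complex.conj_conj] at h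
  simp_rw [mul_comm κ]
  rw [h, Complex.finrank_real_complex]
  have : (((2:ℕ):ℂ) / 2) = 1 := by norm_num
  rw [this, Complex.cpow_one, Complex.I_sq, Complex.norm_conj]
  push_cast
  congr 2
  ring

lemma gauss_real {b : ℝ} (hb : 0 < b) (y : ℂ) :
    Integrable (fun t : ℂ => Real.exp (-b * ‖t - y‖ ^ 2)) ∧
    ∫ t : ℂ, Real.exp (-b * ‖t - y‖ ^ 2) = π / b := by
  have h1 : Integrable (fun t : ℂ => Real.exp (-b * ‖t‖ ^ 2)) := by
    have := (gauss_integrable hb 0).norm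
    refine this.congr (Filter.Eventually.of_forall fun t => ?_)
    simp only [zero_mul, Complex.zero_re, Complex.ofReal_zero, mul_zero, add_zero, Complex.norm_exp]
    congr 1
    norm_cast
  refine ⟨h1.comp_sub_right y, ?_⟩
  rw [integral_sub_right_eq_self (fun t : ℂ => Real.exp (-b * ‖t‖ ^ 2)) y,
    GaussianFourier.integral_rexp_neg_mul_sq_norm hb, Complex.finrank_real_complex]
  norm_num

lemma core_bound {c : GaussianInt} (hc : c ≠ 0) (s : Finset GaussianInt) (M : ℝ) (hM : 0 < M)
    (x : GaussianInt → ℂ) (hx : ∀ m ∈ s, ‖x m‖ ^ 2 ≤ M)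
    (hsep : ∀ m ∈ s, ∀ m' ∈ s, ‖(m : ℂ) - m'‖ ^ 2 ≤ 4 * M * ‖x m - x m'‖ ^ 2)
    (κ : ℂ) (h1 : 4 ≤ ‖κ‖ * ‖(c : ℂ)‖) (h2 : ‖κ‖ * ‖(c : ℂ)‖ ≤ 26) (b : GaussianInt → ℂ) :
    ‖∑ m ∈ s, ∑ n ∈ s, b m * conj (b n) * kloosterman m n c * cexp (I * ((κ * x m * x n).re : ℝ))‖ ≤
      ‖(c : ℂ)‖ ^ 2 * C0 * ((Real.exp (1/2) + 4 * Real.exp 2) * (3 + 26 * M / ‖(c : ℂ)‖)) *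
        ∑ m ∈ s, ‖b m‖ ^ 2 := by
  have hcp : 0 < ‖(c : ℂ)‖ := by have := one_le_norm hc; linarith
  have hκ : 0 < ‖κ‖ := by
    by_contra h
    have : ‖κ‖ = 0 := le_antisymm (not_lt.1 h) (norm_nonneg _)
    rw [this] at h1; linarith
  set α : ℝ := 1 / M with hα
  set β : ℝ := 8 / M + ‖κ‖ ^ 2 * M with hβ
  have hα0 : 0 < α := by positivity
  have hβ0 : 0 < β := by positivity
  have hαβ : α ≤ β / 8 := by
    rw [hα, hβ]; have : 0 ≤ ‖κ‖ ^ 2 * M := by positivity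
    rw [add_div, div_div, mul_comm M 8, ← div_div]; norm_num; positivity
  have hβκ : ‖κ‖ ^ 2 * M ≤ β := by rw [hβ]; have : 0 < 8 / M := by positivity
                                   linarith
  have hαM : α * M = 1 := by rw [hα]; field_simp
  set A : GaussianInt → ℝ := fun m => (β / π) * Real.exp (‖κ * x m‖ ^ 2 / (4 * β)) with hA
  have hA0 : ∀ m, 0 ≤ A m := fun m => by simp only [hA]; positivity
  have hAle : ∀ m ∈ s, A m ≤ (β / π) * Real.exp (1/4) := by
    intro m hm
    simp only [hA]
    refine mul_le_mul_of_nonneg_left (Real.exp_le_exp.2 ?_) (by positivity)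
    rw [norm_mul, mul_pow, div_le_iff₀ (by positivity)]
    have := mul_le_mul_of_nonneg_left (hx m hm) (by positivity : 0 ≤ ‖κ‖ ^ 2)
    linarith
  set φ : GaussianInt → ℂ → ℂ := fun m t =>
    (A m : ℂ) * cexp (I * ((κ * x m * t).re : ℝ) - (α / 2 : ℝ) * (‖t‖ : ℂ) ^ 2) with hφ
  set χ : GaussianInt → ℂ → ℂ := fun n t =>
    ((Real.exp (-β * ‖t - x n‖ ^ 2 + α / 2 * ‖t‖ ^ 2) : ℝ) : ℂ) with hχ
  have eφφ : ∀ m m' t, φ m t * conj (φ m' t) = ((A m * A m' : ℝ) : ℂ) *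
      cexp (-(α : ℂ) * (‖t‖ : ℂ) ^ 2 + I * (((κ * (x m - x m')) * t).re : ℝ)) := by
    intro m m' t
    simp only [hφ]
    rw [map_mul, ← Complex.exp_conj, Complex.conj_ofReal, mul_mul_mul_comm, ← Complex.exp_add]
    push_cast
    congr 2
    simp only [map_sub, map_mul, Complex.conj_I, Complex.conj_ofReal, map_pow, map_div₀, map_ofNat]
    have : (κ * (x m - x m') * t).re = (κ * x m * t).re - (κ * x m' * t).re := by
      rw [← Complex.sub_re]; congr 1; ring
    rw [this]
    push_cast
    ring
  have eφχ : ∀ m n t, φ m t * χ n t = (A m : ℂ) * cexp (I * ((κ * x m * x n).re : ℝ)) *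
      cexp (-(β : ℂ) * (‖t - x n‖ : ℂ) ^ 2 + I * (((κ * x m) * (t - x n)).re : ℝ)) := by
    intro m n t
    simp only [hφ, hχ]
    rw [Complex.ofReal_exp, mul_assoc (A m : ℂ), mul_assoc (A m : ℂ), ← Complex.exp_add, ← Complex.exp_add]
    congr 2
    have : (κ * x m * (t - x n)).re = (κ * x m * t).re - (κ * x m * x n).re := by
      rw [← Complex.sub_re]; congr 1; ring
    rw [this]
    push_cast
    ring
  have iφφ : ∀ m ∈ s, ∀ m' ∈ s, Integrable fun t => φ m t * conj (φ m' t) := by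
    intro m _ m' _
    simp_rw [eφφ]
    exact (gauss_integrable hα0 _).const_mul _
  have iφχ : ∀ m ∈ s, ∀ m' ∈ s, Integrable fun t => φ m t * χ m' t := by
    intro m _ m' _
    simp_rw [eφχ]
    exact ((gauss_integrable hβ0 (κ * x m)).comp_sub_right (x m')).const_mul _
  have vφχ : ∀ m n, ∫ t, φ m t * χ n t = cexp (I * ((κ * x m * x n).re : ℝ)) := by
    intro m n
    simp_rw [eφχ]
    rw [integral_const_mul, integral_sub_right_eq_self
      (fun t : ℂ => cexp (-(β : ℂ) * (‖t‖ : ℂ) ^ 2 + I * (((κ * x m) * t).re : ℝ))) (x n), gauss_int hβ0]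
    simp only [hA]
    have hp : (0:ℝ) < π := Real.pi_pos
    have : (β / π * Real.exp (‖κ * x m‖ ^ 2 / (4 * β))) * (π / β * Real.exp (-(‖κ * x m‖ ^ 2 / (4 * β)))) = 1 := by
      rw [Real.exp_neg]; have := Real.exp_pos (‖κ * x m‖ ^ 2 / (4 * β)); field_simp
    rw [mul_right_comm, ← Complex.ofReal_mul, ← Complex.ofReal_mul, this]; simp
  have pχχ : ∀ m ∈ s, ∀ m' ∈ s, ∀ t, ‖χ m t * conj (χ m' t)‖ ≤
      Real.exp 2 * Real.exp (-(‖(m : ℂ) - m'‖ ^ 2 / ‖(c : ℂ)‖ ^ 2)) * Real.exp (-(β / 4) * ‖t - x m‖ ^ 2) := by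
    intro m hm m' hm' t
    simp only [hχ]
    rw [norm_mul, Complex.norm_conj, Complex.norm_real, Complex.norm_real, Real.norm_of_nonneg (Real.exp_pos _).le,
      Real.norm_of_nonneg (Real.exp_pos _).le, ← Real.exp_add, ← Real.exp_add, ← Real.exp_add]
    apply Real.exp_le_exp.2
    have t1 : ‖x m - x m'‖ ^ 2 ≤ 2 * ‖t - x m‖ ^ 2 + 2 * ‖t - x m'‖ ^ 2 := by
      have : ‖x m - x m'‖ ≤ ‖t - x m'‖ + ‖t - x m‖ := by
        have : x m - x m' = (t - x m') - (t - x m) := by ring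
        rw [this]; exact norm_sub_le _ _
      nlinarith [sq_nonneg (‖t - x m'‖ - ‖t - x m‖), norm_nonneg (x m - x m')]
    have t2 : ‖t‖ ^ 2 ≤ 2 * ‖t - x m‖ ^ 2 + 2 * ‖x m‖ ^ 2 := by
      have : ‖t‖ ≤ ‖t - x m‖ + ‖x m‖ := by
        have : t = (t - x m) + x m := by ring
        calc ‖t‖ = ‖(t - x m) + x m‖ := by rw [← this]
          _ ≤ _ := norm_add_le _ _
      nlinarith [sq_nonneg (‖t - x m‖ - ‖x m‖), norm_nonneg t]
    have t3 : ‖(m : ℂ) - m'‖ ^ 2 / ‖(c : ℂ)‖ ^ 2 ≤ β / 4 * ‖x m - x m'‖ ^ 2 := by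
      rw [div_le_iff₀ (by positivity)]
      have e1 : 16 ≤ ‖κ‖ ^ 2 * ‖(c : ℂ)‖ ^ 2 := by rw [← mul_pow]; nlinarith
      have e2 : 16 * M ≤ β * ‖(c : ℂ)‖ ^ 2 := by
        have := mul_le_mul_of_nonneg_right hβκ (by positivity : 0 ≤ ‖(c : ℂ)‖ ^ 2)
        nlinarith
      have e3 := mul_le_mul_of_nonneg_right e2 (by positivity : 0 ≤ ‖x m - x m'‖ ^ 2 / 4)
      have := hsep m hm m' hm'
      nlinarith
    have t4 : α * ‖t‖ ^ 2 ≤ β / 4 * ‖t - x m‖ ^ 2 + 2 := by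
      have e1 := mul_le_mul_of_nonneg_left t2 hα0.le
      have e2 := mul_le_mul_of_nonneg_left (hx m hm) hα0.le
      have e3 := mul_le_mul_of_nonneg_right hαβ (by positivity : 0 ≤ ‖t - x m‖ ^ 2)
      nlinarith
    have t5 := mul_le_mul_of_nonneg_left t1 (by positivity : 0 ≤ β / 4)
    have t6 : 0 ≤ β * ‖t - x m'‖ ^ 2 := by positivity
    nlinarith
  have iχχ : ∀ m ∈ s, ∀ m' ∈ s, Integrable fun t => χ m t * conj (χ m' t) := by
    intro m hm m' hm'
    refine Integrable.mono' (((gauss_real (by positivity : 0 < β / 4) (x m)).1).const_mul _) ?_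
      (Filter.Eventually.of_forall (pχχ m hm m' hm'))
    apply Continuous.aestronglyMeasurable
    simp only [hχ, Complex.conj_ofReal]
    fun_prop
  have W1 : ∀ m ∈ s, ∀ m' ∈ s, ‖∫ t, φ m t * conj (φ m' t)‖ ≤
      ((β / π) ^ 2 * Real.exp (1/2) * (π / α)) * Real.exp (-(‖(m : ℂ) - m'‖ ^ 2 / ‖(c : ℂ)‖ ^ 2)) := by
    intro m hm m' hm'
    simp_rw [eφφ]
    rw [integral_const_mul, gauss_int hα0, ← Complex.ofReal_mul, ← Complex.ofReal_mul, Complex.norm_real,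
      Real.norm_of_nonneg (by have := hA0 m; have := hA0 m'; positivity), ← mul_assoc]
    have e1 : A m * A m' ≤ (β / π) ^ 2 * Real.exp (1/2) := by
      calc A m * A m' ≤ ((β / π) * Real.exp (1/4)) * ((β / π) * Real.exp (1/4)) := by
            gcongr
            · exact hAle m hm
            · exact hAle m' hm'
        _ = (β / π) ^ 2 * (Real.exp (1/4) * Real.exp (1/4)) := by ring
        _ = _ := by rw [← Real.exp_add]; norm_num
    have e2 : ‖(m : ℂ) - m'‖ ^ 2 / ‖(c : ℂ)‖ ^ 2 ≤ ‖κ * (x m - x m')‖ ^ 2 / (4 * α) := by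
      rw [norm_mul, div_le_div_iff₀ (by positivity) (by positivity)]
      have e1 : 16 ≤ ‖κ‖ ^ 2 * ‖(c : ℂ)‖ ^ 2 := by rw [← mul_pow]; nlinarith
      have e3 := mul_le_mul_of_nonneg_right e1 (by positivity : 0 ≤ ‖x m - x m'‖ ^ 2)
      have e4 := mul_le_mul_of_nonneg_right (hsep m hm m' hm') (by positivity : 0 ≤ 4 * α)
      have e5 : 4 * M * ‖x m - x m'‖ ^ 2 * (4 * α) = 16 * ‖x m - x m'‖ ^ 2 := by
        linear_combination (16 * ‖x m - x m'‖ ^ 2) * hαM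
      rw [mul_pow]; nlinarith
    gcongr
  have W2 : ∀ m ∈ s, ∀ m' ∈ s, ‖∫ t, χ m t * conj (χ m' t)‖ ≤
      (Real.exp 2 * (π / (β / 4))) * Real.exp (-(‖(m : ℂ) - m'‖ ^ 2 / ‖(c : ℂ)‖ ^ 2)) := by
    intro m hm m' hm'
    have := norm_integral_le_of_norm_le (((gauss_real (by positivity : 0 < β / 4) (x m)).1).const_mul
      (Real.exp 2 * Real.exp (-(‖(m : ℂ) - m'‖ ^ 2 / ‖(c : ℂ)‖ ^ 2))))
      (Filter.Eventually.of_forall (pχχ m hm m' hm'))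
    rw [integral_const_mul, (gauss_real (by positivity : 0 < β / 4) (x m)).2] at this
    linarith
  set R : ℝ := Real.sqrt (β / α) with hR
  have hR0 : 0 < R := Real.sqrt_pos.2 (by positivity)
  have hR2 : R ^ 2 = β / α := Real.sq_sqrt (by positivity)
  have hp : (0:ℝ) < π := Real.pi_pos
  have D := dls hc s b (fun n => conj (b n)) φ χ iφφ iχχ iφχ _ _ (by positivity) (by positivity) W1 W2
    (π / (β * R)) (by positivity)
  simp_rw [vφχ, Complex.norm_conj] at D
  refine D.trans (le_of_eq_of_le (b := ‖(c : ℂ)‖ ^ 2 * C0 * ((Real.exp (1/2) + 4 * Real.exp 2) * R) *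
        ∑ m ∈ s, ‖b m‖ ^ 2) ?_ ?_)
  · have e1 : π / (β * R) * ((β / π) ^ 2 * Real.exp (1/2) * (π / α)) = Real.exp (1/2) * R := by
      have : β = R ^ 2 * α := by rw [hR2]; field_simp
      rw [this]; field_simp
    have e2 : (π / (β * R))⁻¹ * (Real.exp 2 * (π / (β / 4))) = 4 * Real.exp 2 * R := by
      field_simp
    rw [e1, e2]; ring
  · have : R ≤ 3 + 26 * M / ‖(c : ℂ)‖ := by
      have e1 : ‖κ‖ ≤ 26 / ‖(c : ℂ)‖ := by rw [le_div_iff₀ hcp]; exact h2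
      have e2 : β / α ≤ (3 + ‖κ‖ * M) ^ 2 := by
        have : β / α = 8 + (‖κ‖ * M) ^ 2 := by
          rw [hβ, hα]; field_simp
        rw [this]; have : 0 ≤ ‖κ‖ * M := by positivity
        nlinarith
      have e3 : R ≤ 3 + ‖κ‖ * M := Real.sqrt_le_iff.2 ⟨by positivity, e2⟩
      have e4 := mul_le_mul_of_nonneg_right e1 hM.le
      have e5 : 26 * M / ‖(c : ℂ)‖ = 26 / ‖(c : ℂ)‖ * M := by ring
      linarith
    have := C0_nonneg
    gcongr

/-- the square root of a generator -/
noncomputable def rt (m : GaussianInt) : ℂ := (m : ℂ) ^ ((1:ℂ)/2)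

lemma rt_sq (m : GaussianInt) : rt m ^ 2 = m := by
  have := Complex.cpow_nat_inv_pow (m : ℂ) (n := 2) (by norm_num)
  rw [rt]; rw [show ((1:ℂ)/2) = ((2:ℕ):ℂ)⁻¹ by norm_num]; exact this

lemma rt_norm_sq (m : GaussianInt) : ‖rt m‖ ^ 2 = ‖(m : ℂ)‖ := by
  rw [← norm_pow, rt_sq]

lemma rt_mul {m n : GaussianInt} (hm : IsGen m) (hn : IsGen n) :
    ((m : ℂ) * (n : ℂ)) ^ ((1:ℂ)/2) = rt m * rt n := by
  have h1 : (m : ℂ) ≠ 0 := by simpa using hm.1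
  have h2 : (n : ℂ) ≠ 0 := by simpa using hn.1
  rw [rt, rt, Complex.cpow_def_of_ne_zero (mul_ne_zero h1 h2), Complex.cpow_def_of_ne_zero h1,
    Complex.cpow_def_of_ne_zero h2, ← Complex.exp_add, Complex.log_mul h1 h2, add_mul]
  have := hm.2; have := hn.2
  constructor <;> linarith [Real.pi_pos]

/-- spacing-based bound for the quadratic form -/
lemma B_bound : ∃ C : ℝ, 0 ≤ C ∧ ∀ (c : GaussianInt), c ≠ 0 → ∀ (s : Finset GaussianInt) (M : ℝ), 0 < M →
    (∀ m ∈ s, IsGen m ∧ ‖(m : ℂ)‖ ≤ M) → ∀ θ : ℂ, 1/2 ≤ ‖θ‖ → ‖θ‖ ≤ 2 → ∀ b : GaussianInt → ℂ,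
    ‖∑ m ∈ s, ∑ n ∈ s, b m * conj (b n) * kloosterman m n c *
      ((Real.cos (4 * π * (((m : ℂ) * (n : ℂ)) ^ ((1:ℂ)/2) * θ / (c : ℂ)).re) : ℝ) : ℂ)‖ ≤
      C * (‖(c : ℂ)‖ ^ 2 + M * ‖(c : ℂ)‖) * ∑ m ∈ s, ‖b m‖ ^ 2 := by
  refine ⟨26 * C0 * (Real.exp (1/2) + 4 * Real.exp 2), by have := C0_nonneg; positivity, ?_⟩
  intro c hc s M hM hs θ hθ1 hθ2 b
  have hcp : 0 < ‖(c : ℂ)‖ := by have := one_le_norm hc; linarith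
  have hc' : (c : ℂ) ≠ 0 := by simpa using hc
  set κ : ℂ := 4 * π * θ / c with hκ
  have nκ : ‖κ‖ * ‖(c : ℂ)‖ = 4 * π * ‖θ‖ := by
    rw [hκ, norm_div, norm_mul, norm_mul, Complex.norm_real, Real.norm_of_nonneg Real.pi_pos.le]
    simp only [Complex.norm_ofNat]; field_simp
  have hx : ∀ m ∈ s, ‖rt m‖ ^ 2 ≤ M := fun m hm => by rw [rt_norm_sq]; exact (hs m hm).2
  have hsep : ∀ m ∈ s, ∀ m' ∈ s, ‖(m : ℂ) - m'‖ ^ 2 ≤ 4 * M * ‖rt m - rt m'‖ ^ 2 := by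
    intro m hm m' hm'
    have : (m : ℂ) - m' = (rt m + rt m') * (rt m - rt m') := by rw [← rt_sq m, ← rt_sq m']; ring
    rw [this, norm_mul, mul_pow]
    gcongr
    have e1 := norm_add_le (rt m) (rt m')
    have := hx m hm; have := hx m' hm'
    nlinarith [sq_nonneg (‖rt m‖ - ‖rt m'‖), norm_nonneg (rt m + rt m')]
  have p3 := Real.pi_gt_three
  have p4 := Real.pi_lt_d2
  have k1 : 4 ≤ ‖κ‖ * ‖(c : ℂ)‖ := by rw [nκ]; nlinarith
  have k2 : ‖κ‖ * ‖(c : ℂ)‖ ≤ 26 := by rw [nκ]; nlinarith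
  have B1 := core_bound hc s M hM rt hx hsep κ k1 k2 b
  have B2 := core_bound hc s M hM rt hx hsep (-κ) (by rwa [norm_neg]) (by rwa [norm_neg]) b
  have key : ∑ m ∈ s, ∑ n ∈ s, b m * conj (b n) * kloosterman m n c *
      ((Real.cos (4 * π * (((m : ℂ) * (n : ℂ)) ^ ((1:ℂ)/2) * θ / (c : ℂ)).re) : ℝ) : ℂ) =
      (1/2) * (∑ m ∈ s, ∑ n ∈ s, b m * conj (b n) * kloosterman m n c * cexp (I * ((κ * rt m * rt n).re : ℝ))
      + ∑ m ∈ s, ∑ n ∈ s, b m * conj (b n) * kloosterman m n c * cexp (I * (((-κ) * rt m * rt n).re : ℝ))) := by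
    rw [← Finset.sum_add_distrib, Finset.mul_sum]
    refine Finset.sum_congr rfl fun m hm => ?_
    rw [← Finset.sum_add_distrib, Finset.mul_sum]
    refine Finset.sum_congr rfl fun n hn => ?_
    rw [rt_mul (hs m hm).1 (hs n hn).1]
    have e1 : 4 * π * (rt m * rt n * θ / (c : ℂ)).re = (κ * rt m * rt n).re := by
      rw [hκ]
      have : 4 * (π : ℂ) * θ / c * rt m * rt n = ((4 * π : ℝ) : ℂ) * (rt m * rt n * θ / (c : ℂ)) := by
        push_cast; ring
      rw [this, Complex.re_ofReal_mul]
    have e2 : ((-κ) * rt m * rt n).re = - (κ * rt m * rt n).re := by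
      rw [neg_mul, neg_mul, Complex.neg_re]
    rw [e1, e2, Complex.ofReal_cos, Complex.cos]
    push_cast
    rw [mul_comm I, mul_comm I]
    ring
  rw [key, norm_mul]
  have hn : ‖(1/2 : ℂ)‖ = 1/2 := by norm_num
  rw [hn]
  have hadd := norm_add_le (∑ m ∈ s, ∑ n ∈ s, b m * conj (b n) * kloosterman m n c * cexp (I * ((κ * rt m * rt n).re : ℝ)))
    (∑ m ∈ s, ∑ n ∈ s, b m * conj (b n) * kloosterman m n c * cexp (I * (((-κ) * rt m * rt n).re : ℝ)))
  have fin : ‖(c : ℂ)‖ ^ 2 * C0 * ((Real.exp (1/2) + 4 * Real.exp 2) * (3 + 26 * M / ‖(c : ℂ)‖)) *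
        ∑ m ∈ s, ‖b m‖ ^ 2 ≤ 26 * C0 * (Real.exp (1/2) + 4 * Real.exp 2) *
        (‖(c : ℂ)‖ ^ 2 + M * ‖(c : ℂ)‖) * ∑ m ∈ s, ‖b m‖ ^ 2 := by
    have : ‖(c : ℂ)‖ ^ 2 * (3 + 26 * M / ‖(c : ℂ)‖) ≤ 26 * (‖(c : ℂ)‖ ^ 2 + M * ‖(c : ℂ)‖) := by
      have : ‖(c : ℂ)‖ ^ 2 * (3 + 26 * M / ‖(c : ℂ)‖) = 3 * ‖(c : ℂ)‖ ^ 2 + 26 * (M * ‖(c : ℂ)‖) := by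
        field_simp
      rw [this]; nlinarith [sq_nonneg ‖(c : ℂ)‖]
    have h0 := C0_nonneg
    have h3 := mul_le_mul_of_nonneg_left this (by positivity : 0 ≤ C0 * (Real.exp (1/2) + 4 * Real.exp 2) * ∑ m ∈ s, ‖b m‖ ^ 2)
    linarith
  linarith

end KT

namespace KT

open MeasureTheory

/-- complex-analytic version of the theta function -/
noncomputable def thetaC (P : ℝ) (z : ℂ) : ℂ :=
  ((Real.sqrt π * P : ℝ) : ℂ) * (cexp (-((P : ℂ) ^ 2 * z ^ 2)) * jacobiTheta₂ (I * (P : ℂ) ^ 2 * z) (I * π * (P : ℂ) ^ 2))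

lemma theta_eq (P ω : ℝ) : ((thetafun P ω : ℝ) : ℂ) = thetaC P ω := by
  rw [thetafun, thetaC, Complex.ofReal_mul, Complex.ofReal_tsum, jacobiTheta₂]
  congr 1
  rw [← tsum_mul_left]
  refine tsum_congr fun q => ?_
  rw [jacobiTheta₂_term, ← Complex.exp_add]
  push_cast
  congr 1
  linear_combination (-(2 * π * q * P ^ 2 * ω + π ^ 2 * q ^ 2 * P ^ 2) : ℂ) * Complex.I_sq

lemma thetaC_diff {P : ℝ} (hP : 0 < P) : Differentiable ℂ (thetaC P) := by
  intro z
  unfold thetaC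
  have him : 0 < (I * π * (P : ℂ) ^ 2).im := by
    have : I * π * (P : ℂ) ^ 2 = I * ((π * P ^ 2 : ℝ) : ℂ) := by push_cast; ring
    rw [this]; simp only [Complex.mul_im, Complex.I_re, Complex.I_im, Complex.ofReal_re, Complex.ofReal_im]
    have := Real.pi_pos
    simp; positivity
  have h := differentiableAt_jacobiTheta₂_fst (I * (P : ℂ) ^ 2 * z) him
  have h2 : DifferentiableAt ℂ (fun z => jacobiTheta₂ (I * (P : ℂ) ^ 2 * z) (I * π * (P : ℂ) ^ 2)) z :=
    DifferentiableAt.comp (f := fun z => I * (P : ℂ) ^ 2 * z) z h (by fun_prop)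
  fun_prop

lemma theta_contDiff {P : ℝ} (hP : 0 < P) : ContDiff ℝ 2 (thetafun P) := by
  have h1 : ContDiff ℂ 2 (thetaC P) := (thetaC_diff hP).contDiff
  have h2 : ContDiff ℝ 2 (fun ω : ℝ => thetaC P (ω : ℂ)) := (h1.restrict_scalars ℝ).comp Complex.ofRealCLM.contDiff
  have h3 : ContDiff ℝ 2 (fun ω : ℝ => (thetaC P (ω : ℂ)).re) := Complex.reCLM.contDiff.comp h2
  have : thetafun P = fun ω : ℝ => (thetaC P (ω : ℂ)).re := by
    ext ω; rw [← theta_eq, Complex.ofReal_re]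
  rw [this]; exact h3

lemma theta_periodic (P : ℝ) : Function.Periodic (thetafun P) π := by
  intro ω
  simp only [thetafun]
  congr 1
  rw [← (Equiv.addRight (1:ℤ)).tsum_eq (fun q : ℤ => Real.exp (-(P ^ 2 * (ω + π * q) ^ 2)))]
  congr 1; ext q
  simp only [Equiv.coe_addRight]
  push_cast
  congr 3; ring

lemma theta_nonneg {P : ℝ} (hP : 0 ≤ P) (ω : ℝ) : 0 ≤ thetafun P ω := by
  unfold thetafun
  have := tsum_nonneg (L := .unconditional ℤ) (g := fun q : ℤ => Real.exp (-(P ^ 2 * (ω + π * q) ^ 2))) fun _ => (Real.exp_pos _).le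
  positivity

lemma summable_exp_int : Summable fun q : ℤ => Real.exp (-(q : ℝ) ^ 2) := by
  refine Summable.of_nonneg_of_le (fun a => by positivity) (fun z => ?_)
    ((summable_int_aux (s := 2) (by norm_num)).mul_left 2)
  have key : ∀ x : ℝ, Real.exp (-x ^ 2) ≤ 2 * (1 + |x|) ^ (-2 : ℝ) := by
    intro x
    rw [Real.rpow_neg (by positivity), Real.exp_neg, Real.rpow_two, ← div_eq_mul_inv, inv_eq_one_div,
      div_le_div_iff₀ (Real.exp_pos _) (by positivity)]
    have := Real.add_one_le_exp (x ^ 2)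
    have e1 := sq_abs x
    nlinarith [sq_nonneg (|x| - 1)]
  exact key _

/-- constant in the theta bound -/
noncomputable def Cθ : ℝ := Real.sqrt π * ∑' q : ℤ, (Real.exp (-(q : ℝ) ^ 2) + Real.exp (-((q + 1 : ℤ) : ℝ) ^ 2))

lemma Cθ_nonneg : 0 ≤ Cθ := by
  unfold Cθ
  have := tsum_nonneg (L := .unconditional ℤ) (g := fun q : ℤ => (Real.exp (-(q : ℝ) ^ 2) + Real.exp (-((q + 1 : ℤ) : ℝ) ^ 2)))
    fun _ => by positivity
  positivity

lemma theta_le {P : ℝ} (hP : 1/2 ≤ P) {ω : ℝ} (h0 : 0 ≤ ω) (h1 : ω ≤ π) :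
    thetafun P ω ≤ Cθ * (P * (Real.exp (-(P ^ 2 * ω ^ 2)) + Real.exp (-(P ^ 2 * (π - ω) ^ 2)))) := by
  have hp := Real.pi_gt_three
  have hS : Summable fun q : ℤ => (Real.exp (-(q : ℝ) ^ 2) + Real.exp (-((q + 1 : ℤ) : ℝ) ^ 2)) :=
    summable_exp_int.add (summable_exp_int.comp_injective (Equiv.addRight (1:ℤ)).injective)
  set E := (Real.exp (-(P ^ 2 * ω ^ 2)) + Real.exp (-(P ^ 2 * (π - ω) ^ 2))) with hE
  have hP2 : 1/4 ≤ P ^ 2 := by nlinarith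
  have hpp : 1 ≤ P ^ 2 * π ^ 2 := by nlinarith
  have hterm : ∀ q : ℤ, Real.exp (-(P ^ 2 * (ω + π * q) ^ 2)) ≤
      E * (Real.exp (-(q : ℝ) ^ 2) + Real.exp (-((q + 1 : ℤ) : ℝ) ^ 2)) := by
    intro q
    have p1 := Real.exp_pos (-(P ^ 2 * ω ^ 2))
    have p2 := Real.exp_pos (-(P ^ 2 * (π - ω) ^ 2))
    have p3 := Real.exp_pos (-(q : ℝ) ^ 2)
    have p4 := Real.exp_pos (-((q + 1 : ℤ) : ℝ) ^ 2)
    rcases le_or_gt 0 q with hq | hq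
    · have hq' : (0:ℝ) ≤ q := by exact_mod_cast hq
      have : Real.exp (-(P ^ 2 * (ω + π * q) ^ 2)) ≤ Real.exp (-(P ^ 2 * ω ^ 2)) * Real.exp (-(q : ℝ) ^ 2) := by
        rw [← Real.exp_add]; apply Real.exp_le_exp.2
        have e1 := mul_le_mul_of_nonneg_right hpp (sq_nonneg (q : ℝ))
        have e2 : 0 ≤ P ^ 2 * (2 * ω * π * q) := by positivity
        nlinarith
      nlinarith
    · have hq' : ((q + 1 : ℤ) : ℝ) ≤ 0 := by exact_mod_cast hq
      have : Real.exp (-(P ^ 2 * (ω + π * q) ^ 2)) ≤ Real.exp (-(P ^ 2 * (π - ω) ^ 2)) * Real.exp (-((q + 1 : ℤ) : ℝ) ^ 2) := by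
        rw [← Real.exp_add]; apply Real.exp_le_exp.2
        have e0 : (q : ℝ) = ((q + 1 : ℤ) : ℝ) - 1 := by push_cast; ring
        rw [e0]
        generalize ((q + 1 : ℤ) : ℝ) = t at hq' ⊢
        have e1 := mul_le_mul_of_nonneg_right hpp (sq_nonneg t)
        have e2 : 0 ≤ P ^ 2 * (2 * (π - ω) * π * (-t)) := by
          have : 0 ≤ π - ω := by linarith
          have : 0 ≤ -t := by linarith
          positivity
        nlinarith
      nlinarith
  have hsum := Summable.of_nonneg_of_le (fun q => (Real.exp_pos _).le) hterm (hS.mul_left E)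
  have := hsum.tsum_le_tsum hterm (hS.mul_left E)
  rw [tsum_mul_left] at this
  unfold thetafun Cθ
  calc _ ≤ Real.sqrt π * P * (E * ∑' q : ℤ, (Real.exp (-(q : ℝ) ^ 2) + Real.exp (-((q + 1 : ℤ) : ℝ) ^ 2))) := by
        gcongr
    _ = _ := by ring

/-! derivatives of the Gaussian -/

lemma kfun_hasDeriv (K r : ℝ) : HasDerivAt (kfun K) (-(2 * K ^ 2 * r) * kfun K r) r := by
  have h : HasDerivAt (fun r : ℝ => -(K ^ 2 * r ^ 2)) (-(K ^ 2 * (2 * r))) r := by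
    exact ((hasDerivAt_pow 2 r).const_mul (K ^ 2)).fun_neg.congr_deriv (by simp)
  exact ((h.exp).const_mul (Real.sqrt π * K)).congr_deriv (by unfold kfun; ring)

lemma kfun_deriv (K : ℝ) : deriv (kfun K) = fun r => -(2 * K ^ 2 * r) * kfun K r :=
  funext fun r => (kfun_hasDeriv K r).deriv

lemma kfun_hasDeriv2 (K r : ℝ) :
    HasDerivAt (fun r => -(2 * K ^ 2 * r) * kfun K r) ((4 * K ^ 4 * r ^ 2 - 2 * K ^ 2) * kfun K r) r := by
  have h : HasDerivAt (fun r : ℝ => -(2 * K ^ 2 * r)) (-(2 * K ^ 2)) r := by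
    exact ((hasDerivAt_id r).const_mul (2 * K ^ 2)).fun_neg.congr_deriv (by simp)
  exact (h.fun_mul (kfun_hasDeriv K r)).congr_deriv (by ring)

lemma kfun_deriv2 (K r : ℝ) : deriv (deriv (kfun K)) r = (4 * K ^ 4 * r ^ 2 - 2 * K ^ 2) * kfun K r := by
  rw [kfun_deriv]; exact (kfun_hasDeriv2 K r).deriv

lemma kfun_nonneg {K : ℝ} (hK : 0 ≤ K) (r : ℝ) : 0 ≤ kfun K r := by unfold kfun; positivity

lemma kfun_cont (K : ℝ) : Continuous (kfun K) := by unfold kfun; fun_prop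

/-- Gaussian beats exponentials -/
lemma integrable_gauss_exp {K : ℝ} (hK : 0 < K) (a : ℝ) :
    Integrable fun r : ℝ => kfun K r * Real.exp (a * |r|) := by
  have h := ((integrable_exp_neg_mul_sq (b := K ^ 2 / 2) (by positivity)).const_mul
    (Real.sqrt π * K * Real.exp (a ^ 2 / (2 * K ^ 2))))
  refine h.mono' (by unfold kfun; fun_prop) (Filter.Eventually.of_forall fun r => ?_)
  rw [Real.norm_of_nonneg (by have := kfun_nonneg hK.le r; positivity), kfun, mul_assoc, mul_assoc (Real.sqrt π * K),
    ← Real.exp_add, ← Real.exp_add]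
  refine mul_le_mul_of_nonneg_left (Real.exp_le_exp.2 ?_) (by positivity)
  have : a ^ 2 / (2 * K ^ 2) - a * |r| + K ^ 2 / 2 * r ^ 2 = (a / K - K * |r|) ^ 2 / 2 := by
    rw [← sq_abs r]; field_simp; ring
  have : 0 ≤ (a / K - K * |r|) ^ 2 / 2 := by positivity
  linarith

end KT

namespace KT

open MeasureTheory

/-- the phase -/
noncomputable def gg (x y r ω : ℝ) : ℝ := 2 * (x * (Real.cosh r * Real.cos ω) - y * (Real.sinh r * Real.sin ω))
/-- its r-derivative -/
noncomputable def ggr (x y r ω : ℝ) : ℝ := 2 * (x * (Real.sinh r * Real.cos ω) - y * (Real.cosh r * Real.sin ω))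
/-- its angular derivative -/
noncomputable def ggw (x y r ω : ℝ) : ℝ := 2 * (x * (Real.cosh r * -Real.sin ω) - y * (Real.sinh r * Real.cos ω))

lemma gg_eq (z : ℂ) (r ω : ℝ) : 2 * (z * trh r ω).re = gg z.re z.im r ω := by
  simp [trh, gg, -Complex.ofReal_mul, -Complex.ofReal_cosh, -Complex.ofReal_sinh, -Complex.ofReal_cos, -Complex.ofReal_sin]

lemma gg_r (x y r ω : ℝ) : HasDerivAt (fun r => gg x y r ω) (ggr x y r ω) r :=
  ((((Real.hasDerivAt_cosh r).mul_const (Real.cos ω)).const_mul x).fun_sub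
    (((Real.hasDerivAt_sinh r).mul_const (Real.sin ω)).const_mul y)).const_mul 2

lemma ggr_r (x y r ω : ℝ) : HasDerivAt (fun r => ggr x y r ω) (gg x y r ω) r :=
  ((((Real.hasDerivAt_sinh r).mul_const (Real.cos ω)).const_mul x).fun_sub
    (((Real.hasDerivAt_cosh r).mul_const (Real.sin ω)).const_mul y)).const_mul 2

lemma gg_w (x y r ω : ℝ) : HasDerivAt (fun ω => gg x y r ω) (ggw x y r ω) ω :=
  ((((Real.hasDerivAt_cos ω).const_mul (Real.cosh r)).const_mul x).fun_sub
    (((Real.hasDerivAt_sin ω).const_mul (Real.sinh r)).const_mul y)).const_mul 2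

lemma ggw_w (x y r ω : ℝ) : HasDerivAt (fun ω => ggw x y r ω) (-gg x y r ω) ω :=
  (((((Real.hasDerivAt_sin ω).fun_neg.const_mul (Real.cosh r)).const_mul x).fun_sub
    (((Real.hasDerivAt_cos ω).const_mul (Real.sinh r)).const_mul y)).const_mul 2).congr_deriv
      (by unfold gg; ring)

lemma gg_sq (x y r ω : ℝ) : ggr x y r ω ^ 2 + ggw x y r ω ^ 2 =
    4 * (x ^ 2 + y ^ 2) * (Real.sinh r ^ 2 + Real.sin ω ^ 2) := by
  unfold ggr ggw
  linear_combination (4 * (x ^ 2 + y ^ 2) * Real.sin ω ^ 2) * (Real.cosh_sq r) +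
    (4 * (x ^ 2 + y ^ 2) * Real.sinh r ^ 2) * (Real.sin_sq_add_cos_sq ω)

/-- second r-derivative of cos gg -/
noncomputable def frr (x y r ω : ℝ) : ℝ :=
  -(Real.cos (gg x y r ω) * ggr x y r ω * ggr x y r ω + Real.sin (gg x y r ω) * gg x y r ω)
/-- second angular derivative of cos gg -/
noncomputable def fww (x y r ω : ℝ) : ℝ :=
  -(Real.cos (gg x y r ω) * ggw x y r ω * ggw x y r ω + Real.sin (gg x y r ω) * -gg x y r ω)

lemma f_r (x y r ω : ℝ) : HasDerivAt (fun r => Real.cos (gg x y r ω)) (-(Real.sin (gg x y r ω) * ggr x y r ω)) r :=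
  ((gg_r x y r ω).cos).congr_deriv (by ring)
lemma f_rr (x y r ω : ℝ) : HasDerivAt (fun r => -(Real.sin (gg x y r ω) * ggr x y r ω)) (frr x y r ω) r :=
  (((gg_r x y r ω).sin).fun_mul (ggr_r x y r ω)).fun_neg
lemma f_w (x y r ω : ℝ) : HasDerivAt (fun ω => Real.cos (gg x y r ω)) (-(Real.sin (gg x y r ω) * ggw x y r ω)) ω :=
  ((gg_w x y r ω).cos).congr_deriv (by ring)
lemma f_ww (x y r ω : ℝ) : HasDerivAt (fun ω => -(Real.sin (gg x y r ω) * ggw x y r ω)) (fww x y r ω) ω :=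
  (((gg_w x y r ω).sin).fun_mul (ggw_w x y r ω)).fun_neg

lemma cosh_le (r : ℝ) : Real.cosh r ≤ Real.exp |r| := by
  rw [← Real.cosh_abs, Real.cosh_eq]
  have : Real.exp (-|r|) ≤ Real.exp |r| := Real.exp_le_exp.2 (by have := abs_nonneg r; linarith)
  linarith

lemma sinh_le (r : ℝ) : |Real.sinh r| ≤ Real.exp |r| := by
  have h := cosh_le r
  have h2 := Real.cosh_sq r
  have h3 := Real.cosh_pos r
  exact (abs_le_of_sq_le_sq (by linarith) h3.le).trans h

lemma lin_bound (x y A B s c E : ℝ) (hA : |A| ≤ E) (hB : |B| ≤ E) (hs : |s| ≤ 1) (hc : |c| ≤ 1) :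
    |2 * (x * (A * c) - y * (B * s))| ≤ 2 * (|x| + |y|) * E := by
  have h0 : 0 ≤ E := (abs_nonneg _).trans hA
  rw [abs_mul]
  have h1 := abs_sub (x * (A * c)) (y * (B * s))
  rw [abs_mul, abs_mul, abs_mul, abs_mul] at h1
  have h2 : |A| * |c| ≤ E := by nlinarith [abs_nonneg c, abs_nonneg A]
  have h3 : |B| * |s| ≤ E := by nlinarith [abs_nonneg s, abs_nonneg B]
  have h4 := mul_le_mul_of_nonneg_left h2 (abs_nonneg x)
  have h5 := mul_le_mul_of_nonneg_left h3 (abs_nonneg y)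
  rw [abs_two]; linarith

lemma gg_bd (x y r ω : ℝ) : |gg x y r ω| ≤ 2 * (|x| + |y|) * Real.exp |r| :=
  lin_bound _ _ _ _ _ _ _ (by rw [abs_of_pos (Real.cosh_pos r)]; exact cosh_le r) (sinh_le r) (Real.abs_sin_le_one _) (Real.abs_cos_le_one _)
lemma ggr_bd (x y r ω : ℝ) : |ggr x y r ω| ≤ 2 * (|x| + |y|) * Real.exp |r| :=
  lin_bound _ _ _ _ _ _ _ (sinh_le r) (by rw [abs_of_pos (Real.cosh_pos r)]; exact cosh_le r) (Real.abs_sin_le_one _) (Real.abs_cos_le_one _)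
lemma ggw_bd (x y r ω : ℝ) : |ggw x y r ω| ≤ 2 * (|x| + |y|) * Real.exp |r| :=
  lin_bound _ _ _ _ _ _ _ (by rw [abs_of_pos (Real.cosh_pos r)]; exact cosh_le r) (sinh_le r) (Real.abs_cos_le_one _)
    (by rw [abs_neg]; exact Real.abs_sin_le_one _)

lemma sec_bound (g d e Q E : ℝ) (hE : 1 ≤ E) (hQ : 0 ≤ Q) (hd : |d| ≤ Q * E) (he : |e| ≤ Q * E) :
    |-(Real.cos g * d * d + Real.sin g * e)| ≤ (1 + Q) ^ 2 * (E * E) := by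
  rw [abs_neg]
  have h1 := abs_add_le (Real.cos g * d * d) (Real.sin g * e)
  rw [abs_mul, abs_mul, abs_mul] at h1
  have hc := Real.abs_cos_le_one g
  have hs := Real.abs_sin_le_one g
  have h2 : |Real.cos g| * |d| ≤ Q * E := by nlinarith [abs_nonneg d, abs_nonneg (Real.cos g)]
  have h3 : |Real.cos g| * |d| * |d| ≤ (Q * E) * (Q * E) :=
    mul_le_mul h2 hd (abs_nonneg _) (by positivity)
  have h4 : |Real.sin g| * |e| ≤ Q * E := by nlinarith [abs_nonneg e, abs_nonneg (Real.sin g)]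
  have h5 : Q * E ≤ Q * (E * E) := by gcongr; nlinarith
  have h6 : 0 ≤ E * E * (1 + Q) := by positivity
  nlinarith

/-- uniform constant -/
noncomputable def Bc (x y : ℝ) : ℝ := (1 + 2 * (|x| + |y|)) ^ 2

lemma frr_bd (x y r ω : ℝ) : |frr x y r ω| ≤ Bc x y * (Real.exp |r| * Real.exp |r|) :=
  sec_bound _ _ _ _ _ (Real.one_le_exp (abs_nonneg _)) (by positivity) (ggr_bd x y r ω) (gg_bd x y r ω)
lemma fww_bd (x y r ω : ℝ) : |fww x y r ω| ≤ Bc x y * (Real.exp |r| * Real.exp |r|) :=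
  sec_bound _ _ _ _ _ (Real.one_le_exp (abs_nonneg _)) (by positivity) (ggw_bd x y r ω) (by rw [abs_neg]; exact gg_bd x y r ω)
lemma fr_bd (x y r ω : ℝ) : |-(Real.sin (gg x y r ω) * ggr x y r ω)| ≤ Bc x y * (Real.exp |r| * Real.exp |r|) := by
  rw [abs_neg, abs_mul]
  have h1 := Real.abs_sin_le_one (gg x y r ω)
  have h2 := ggr_bd x y r ω
  have hE : 1 ≤ Real.exp |r| := Real.one_le_exp (abs_nonneg _)
  have hQ : 0 ≤ 2 * (|x| + |y|) := by positivity
  unfold Bc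
  generalize 2 * (|x| + |y|) = Q at *
  generalize Real.exp |r| = E at *
  have h4 : |Real.sin (gg x y r ω)| * |ggr x y r ω| ≤ Q * E := by
    nlinarith [abs_nonneg (ggr x y r ω), abs_nonneg (Real.sin (gg x y r ω))]
  have h5 : Q * E ≤ Q * (E * E) := by gcongr; nlinarith
  have h6 : 0 ≤ E * E * (1 + Q + Q ^ 2) := by positivity
  nlinarith
lemma f_bd (x y r ω : ℝ) : |Real.cos (gg x y r ω)| ≤ Bc x y * (Real.exp |r| * Real.exp |r|) := by
  have h1 := Real.abs_cos_le_one (gg x y r ω)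
  have hE : 1 ≤ Real.exp |r| := Real.one_le_exp (abs_nonneg _)
  have hQ : 0 ≤ 2 * (|x| + |y|) := by positivity
  have : 1 ≤ Bc x y := by unfold Bc; nlinarith
  have : 1 ≤ Real.exp |r| * Real.exp |r| := by nlinarith
  nlinarith

/-- constant for the derivatives of k -/
noncomputable def Kc (K : ℝ) : ℝ := 1 + 8 * K ^ 4 + 2 * K ^ 2

lemma Kc_pos (K : ℝ) : 0 < Kc K := by unfold Kc; positivity

lemma k0_bd {K : ℝ} (hK : 0 ≤ K) (r : ℝ) : |kfun K r| ≤ Kc K * (kfun K r * Real.exp |r|) := by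
  rw [abs_of_nonneg (kfun_nonneg hK r)]
  have := kfun_nonneg hK r
  have hE : 1 ≤ Real.exp |r| := Real.one_le_exp (abs_nonneg _)
  have h1 : 1 ≤ Kc K := by unfold Kc; nlinarith [sq_nonneg K, sq_nonneg (K ^ 2)]
  have : 1 ≤ Kc K * Real.exp |r| := by nlinarith
  nlinarith
lemma k1_bd {K : ℝ} (hK : 0 ≤ K) (r : ℝ) : |-(2 * K ^ 2 * r) * kfun K r| ≤ Kc K * (kfun K r * Real.exp |r|) := by
  rw [abs_mul, abs_of_nonneg (kfun_nonneg hK r), abs_neg, abs_mul, abs_of_nonneg (by positivity : 0 ≤ 2 * K ^ 2)]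
  have h0 := kfun_nonneg hK r
  have hE := Real.add_one_le_exp |r|
  have h2 : 2 * K ^ 2 * |r| ≤ Kc K * Real.exp |r| := by
    have : 2 * K ^ 2 ≤ Kc K := by unfold Kc; nlinarith [sq_nonneg (K ^ 2)]
    have : |r| ≤ Real.exp |r| := by linarith
    gcongr
    exact (Kc_pos K).le
  nlinarith
lemma k2_bd {K : ℝ} (hK : 0 ≤ K) (r : ℝ) :
    |(4 * K ^ 4 * r ^ 2 - 2 * K ^ 2) * kfun K r| ≤ Kc K * (kfun K r * Real.exp |r|) := by
  rw [abs_mul, abs_of_nonneg (kfun_nonneg hK r)]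
  have h0 := kfun_nonneg hK r
  have hE := Real.quadratic_le_exp_of_nonneg (abs_nonneg r)
  rw [sq_abs] at hE
  have ha := abs_nonneg r
  have h1 : |4 * K ^ 4 * r ^ 2 - 2 * K ^ 2| ≤ Kc K * Real.exp |r| := by
    have e1 := abs_sub (4 * K ^ 4 * r ^ 2) (2 * K ^ 2)
    rw [abs_of_nonneg (by positivity : 0 ≤ 4 * K ^ 4 * r ^ 2), abs_of_nonneg (by positivity : 0 ≤ 2 * K ^ 2)] at e1
    have e2 : r ^ 2 ≤ 2 * Real.exp |r| := by linarith
    have e3 : 1 ≤ Real.exp |r| := by nlinarith [sq_nonneg r]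
    have e4 := mul_le_mul_of_nonneg_left e2 (by positivity : 0 ≤ 4 * K ^ 4)
    have e5 := mul_le_mul_of_nonneg_left e3 (by positivity : 0 ≤ 2 * K ^ 2)
    unfold Kc; linarith
  nlinarith

lemma combine {a b A B : ℝ} (hA : |a| ≤ A) (hB : |b| ≤ B) : |a * b| ≤ A * B := by
  rw [abs_mul]; exact mul_le_mul hA hB (abs_nonneg _) ((abs_nonneg _).trans hA)

lemma exp3 (r : ℝ) : Real.exp |r| * Real.exp |r| * Real.exp |r| = Real.exp (3 * |r|) := by
  rw [← Real.exp_add, ← Real.exp_add]; congr 1; ring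

lemma dom1 {K x y : ℝ} (hK : 0 < K) {u v : ℝ → ℝ} (hu : Continuous u) (hv : Continuous v)
    (h1 : ∀ r, |u r| ≤ Kc K * (kfun K r * Real.exp |r|))
    (h2 : ∀ r, |v r| ≤ Bc x y * (Real.exp |r| * Real.exp |r|)) : Integrable fun r => u r * v r := by
  refine ((integrable_gauss_exp hK 3).const_mul (Kc K * Bc x y)).mono' (by fun_prop)
    (Filter.Eventually.of_forall fun r => ?_)
  rw [Real.norm_eq_abs]
  refine (combine (h1 r) (h2 r)).trans (le_of_eq ?_)
  rw [← exp3]; ring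

lemma gg_cont (x y : ℝ) : Continuous fun p : ℝ × ℝ => gg x y p.1 p.2 := by unfold gg; fun_prop
lemma ggr_cont (x y : ℝ) : Continuous fun p : ℝ × ℝ => ggr x y p.1 p.2 := by unfold ggr; fun_prop
lemma ggw_cont (x y : ℝ) : Continuous fun p : ℝ × ℝ => ggw x y p.1 p.2 := by unfold ggw; fun_prop
lemma frr_cont (x y : ℝ) : Continuous fun p : ℝ × ℝ => frr x y p.1 p.2 := by unfold frr gg ggr; fun_prop
lemma fww_cont (x y : ℝ) : Continuous fun p : ℝ × ℝ => fww x y p.1 p.2 := by unfold fww gg ggw; fun_prop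

/-- integration by parts in r -/
lemma ibp_r {K : ℝ} (hK : 0 < K) (x y ω : ℝ) :
    ∫ r, (4 * K ^ 4 * r ^ 2 - 2 * K ^ 2) * kfun K r * Real.cos (gg x y r ω) = ∫ r, kfun K r * frr x y r ω := by
  have ck := kfun_cont K
  have c0 : Continuous fun r => Real.cos (gg x y r ω) := by unfold gg; fun_prop
  have c1 : Continuous fun r => -(Real.sin (gg x y r ω) * ggr x y r ω) := by unfold gg ggr; fun_prop
  have c2 : Continuous fun r => frr x y r ω := by unfold frr gg ggr; fun_prop
  have d1 : Continuous fun r => -(2 * K ^ 2 * r) * kfun K r := by fun_prop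
  have d2 : Continuous fun r => (4 * K ^ 4 * r ^ 2 - 2 * K ^ 2) * kfun K r := by fun_prop
  have s1 := integral_mul_deriv_eq_deriv_mul_of_integrable
    (u := fun r => Real.cos (gg x y r ω)) (v := fun r => -(2 * K ^ 2 * r) * kfun K r)
    (u' := fun r => -(Real.sin (gg x y r ω) * ggr x y r ω))
    (v' := fun r => (4 * K ^ 4 * r ^ 2 - 2 * K ^ 2) * kfun K r)
    (fun r _ => f_r x y r ω) (fun r _ => kfun_hasDeriv2 K r)
    ((dom1 hK d2 c0 (k2_bd hK.le) (f_bd x y · ω)).congr (Filter.Eventually.of_forall fun r => by simp only [Pi.mul_apply]; ring))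
    ((dom1 hK d1 c1 (k1_bd hK.le) (fr_bd x y · ω)).congr (Filter.Eventually.of_forall fun r => by simp only [Pi.mul_apply]; ring))
    ((dom1 hK d1 c0 (k1_bd hK.le) (f_bd x y · ω)).congr (Filter.Eventually.of_forall fun r => by simp only [Pi.mul_apply]; ring))
  have s2 := integral_mul_deriv_eq_deriv_mul_of_integrable
    (u := fun r => -(Real.sin (gg x y r ω) * ggr x y r ω)) (v := fun r => kfun K r)
    (u' := fun r => frr x y r ω)
    (v' := fun r => -(2 * K ^ 2 * r) * kfun K r)
    (fun r _ => f_rr x y r ω) (fun r _ => kfun_hasDeriv K r)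
    ((dom1 hK d1 c1 (k1_bd hK.le) (fr_bd x y · ω)).congr (Filter.Eventually.of_forall fun r => by simp only [Pi.mul_apply]; ring))
    ((dom1 hK ck c2 (k0_bd hK.le) (frr_bd x y · ω)).congr (Filter.Eventually.of_forall fun r => by simp only [Pi.mul_apply]; ring))
    ((dom1 hK ck c1 (k0_bd hK.le) (fr_bd x y · ω)).congr (Filter.Eventually.of_forall fun r => by simp only [Pi.mul_apply]; ring))
  rw [s2, neg_neg] at s1
  simp_rw [mul_comm ((4 * K ^ 4 * _ ^ 2 - 2 * K ^ 2) * kfun K _), mul_comm (kfun K _) (frr x y _ _)]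
  exact s1

/-- integration by parts in the angle -/
lemma ibp_w {P : ℝ} (hP : 0 < P) (x y r : ℝ) :
    ∫ ω in (0:ℝ)..π, Real.cos (gg x y r ω) * deriv (deriv (thetafun P)) ω =
    ∫ ω in (0:ℝ)..π, fww x y r ω * thetafun P ω := by
  have hcd := theta_contDiff hP
  have hcd1 : ContDiff ℝ 1 (deriv (thetafun P)) := by
    have : ContDiff ℝ (1 + 1) (thetafun P) := by simpa [one_add_one_eq_two] using hcd
    exact (contDiff_succ_iff_deriv.1 this).2.2
  have t0 : Continuous (thetafun P) := hcd.continuous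
  have t1 : Continuous (deriv (thetafun P)) := hcd1.continuous
  have t2 : Continuous (deriv (deriv (thetafun P))) := hcd1.continuous_deriv le_rfl
  have e1 : ∀ ω, HasDerivAt (thetafun P) (deriv (thetafun P) ω) ω := fun ω =>
    (hcd.differentiable (by norm_num) ω).hasDerivAt
  have e2 : ∀ ω, HasDerivAt (deriv (thetafun P)) (deriv (deriv (thetafun P)) ω) ω := fun ω =>
    (hcd1.differentiable (by norm_num) ω).hasDerivAt
  have c1 : Continuous fun ω => -(Real.sin (gg x y r ω) * ggw x y r ω) := by unfold gg ggw; fun_prop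
  have c2 : Continuous fun ω => fww x y r ω := by unfold fww gg ggw; fun_prop
  have s1 := intervalIntegral.integral_mul_deriv_eq_deriv_mul (a := 0) (b := π)
    (fun ω _ => f_w x y r ω) (fun ω _ => e2 ω) (c1.intervalIntegrable _ _) (t2.intervalIntegrable _ _)
  have s2 := intervalIntegral.integral_mul_deriv_eq_deriv_mul (a := 0) (b := π)
    (fun ω _ => f_ww x y r ω) (fun ω _ => e1 ω) (c2.intervalIntegrable _ _) (t1.intervalIntegrable _ _)
  have p0 : thetafun P π = thetafun P 0 := by simpa using theta_periodic P 0
  have p1 : deriv (thetafun P) π = deriv (thetafun P) 0 := by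
    have : (fun ω => thetafun P (ω + π)) = thetafun P := funext (theta_periodic P)
    have h := deriv_comp_add_const (thetafun P) π 0
    rw [this, zero_add] at h
    exact h.symm
  have g0 : gg x y r π = - gg x y r 0 := by simp [gg]
  have gw0 : ggw x y r π = - ggw x y r 0 := by simp [ggw]
  rw [s1, s2, p0, p1, g0, gw0, Real.cos_neg, Real.sin_neg]
  ring

/-- the reference measure -/
noncomputable def nu : Measure (ℝ × ℝ) := (volume : Measure ℝ).prod (volume.restrict (Set.Ioc 0 π))

/-- the weight -/
noncomputable def wt (K P : ℝ) (p : ℝ × ℝ) : ℝ :=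
  (Real.sinh p.1 ^ 2 + Real.sin p.2 ^ 2) * (kfun K p.1 * thetafun P p.2)

lemma theta_int {P : ℝ} (hP : 0 < P) : Integrable (thetafun P) (volume.restrict (Set.Ioc 0 π)) :=
  ((theta_contDiff hP).continuous.integrableOn_Icc (a := 0) (b := π)).mono_set Set.Ioc_subset_Icc_self

lemma dom2 {K P x y : ℝ} (hK : 0 < K) (hP : 0 < P) {u : ℝ → ℝ} {v : ℝ × ℝ → ℝ} (hu : Continuous u) (hv : Continuous v)
    (h1 : ∀ r, |u r| ≤ Kc K * (kfun K r * Real.exp |r|))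
    (h2 : ∀ p, |v p| ≤ Bc x y * (Real.exp |p.1| * Real.exp |p.1|)) :
    Integrable (fun p : ℝ × ℝ => u p.1 * v p * thetafun P p.2) nu := by
  have ct := (theta_contDiff hP).continuous
  refine ((((integrable_gauss_exp hK 3).const_mul (Kc K * Bc x y)).mul_prod (theta_int hP))).mono'
    (Continuous.aestronglyMeasurable (by fun_prop)) (Filter.Eventually.of_forall fun p => ?_)
  rw [Real.norm_eq_abs, abs_mul, abs_of_nonneg (theta_nonneg hP.le _)]
  have := theta_nonneg hP.le p.2
  refine mul_le_mul_of_nonneg_right ?_ this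
  refine (combine (h1 p.1) (h2 p)).trans (le_of_eq ?_)
  rw [← exp3]; ring

lemma HH_eq {K P : ℝ} (hK : 0 < K) (hP : 0 < P) (z : ℂ) :
    HH K P z = 4 * ‖z‖ ^ 2 * ∫ p, Real.cos (2 * (z * trh p.1 p.2).re) * wt K P p ∂nu := by
  set x := z.re with hx
  set y := z.im with hy
  have ck := kfun_cont K
  have d2 : Continuous fun r => (4 * K ^ 4 * r ^ 2 - 2 * K ^ 2) * kfun K r := by fun_prop
  have cf : Continuous fun p : ℝ × ℝ => Real.cos (gg x y p.1 p.2) := by unfold gg; fun_prop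
  have I1 : Integrable (fun p : ℝ × ℝ => (4 * K ^ 4 * p.1 ^ 2 - 2 * K ^ 2) * kfun K p.1 *
      Real.cos (gg x y p.1 p.2) * thetafun P p.2) nu :=
    dom2 hK hP d2 cf (k2_bd hK.le) (fun p => f_bd x y p.1 p.2)
  have I2 : Integrable (fun p : ℝ × ℝ => kfun K p.1 * fww x y p.1 p.2 * thetafun P p.2) nu :=
    dom2 hK hP ck (fww_cont x y) (k0_bd hK.le) (fun p => fww_bd x y p.1 p.2)
  have I3 : Integrable (fun p : ℝ × ℝ => kfun K p.1 * frr x y p.1 p.2 * thetafun P p.2) nu :=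
    dom2 hK hP ck (frr_cont x y) (k0_bd hK.le) (fun p => frr_bd x y p.1 p.2)
  have hcd := theta_contDiff hP
  have hcd1 : ContDiff ℝ 1 (deriv (thetafun P)) := by
    have : ContDiff ℝ (1 + 1) (thetafun P) := by simpa [one_add_one_eq_two] using hcd
    exact (contDiff_succ_iff_deriv.1 this).2.2
  have t0 : Continuous (thetafun P) := hcd.continuous
  have t2 : Continuous (deriv (deriv (thetafun P))) := hcd1.continuous_deriv le_rfl
  have inner : ∀ r : ℝ, ∫ ω in (0:ℝ)..π, Real.cos (2 * (z * trh r ω).re) *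
        (deriv (deriv (kfun K)) r * thetafun P ω + kfun K r * deriv (deriv (thetafun P)) ω) =
      (∫ ω in Set.Ioc 0 π, (4 * K ^ 4 * r ^ 2 - 2 * K ^ 2) * kfun K r * Real.cos (gg x y r ω) * thetafun P ω) +
      ∫ ω in Set.Ioc 0 π, kfun K r * fww x y r ω * thetafun P ω := by
    intro r
    rw [← intervalIntegral.integral_of_le Real.pi_pos.le, ← intervalIntegral.integral_of_le Real.pi_pos.le]
    have c0 : Continuous fun ω => Real.cos (gg x y r ω) := by unfold gg; fun_prop
    have : ∀ ω, Real.cos (2 * (z * trh r ω).re) *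
        (deriv (deriv (kfun K)) r * thetafun P ω + kfun K r * deriv (deriv (thetafun P)) ω) =
        (4 * K ^ 4 * r ^ 2 - 2 * K ^ 2) * kfun K r * Real.cos (gg x y r ω) * thetafun P ω +
        kfun K r * (Real.cos (gg x y r ω) * deriv (deriv (thetafun P)) ω) := by
      intro ω; rw [gg_eq, kfun_deriv2]; ring
    simp_rw [this]
    rw [intervalIntegral.integral_add (Continuous.intervalIntegrable (by fun_prop) _ _)
      (Continuous.intervalIntegrable (by fun_prop) _ _), intervalIntegral.integral_const_mul, ibp_w hP]
    congr 1
    rw [← intervalIntegral.integral_const_mul]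
    congr 1; ext ω; ring
  have E1 : ∫ p, (4 * K ^ 4 * p.1 ^ 2 - 2 * K ^ 2) * kfun K p.1 *
      Real.cos (gg x y p.1 p.2) * thetafun P p.2 ∂nu = ∫ p, kfun K p.1 * frr x y p.1 p.2 * thetafun P p.2 ∂nu := by
    unfold nu at I1 I3 ⊢
    rw [integral_prod_symm _ I1, integral_prod_symm _ I3]
    congr 1; ext ω
    simp only []
    rw [integral_mul_const, integral_mul_const, ibp_r hK]
  unfold HH
  simp_rw [inner]
  have E2 : ∫ r : ℝ, ((∫ ω in Set.Ioc 0 π, (4 * K ^ 4 * r ^ 2 - 2 * K ^ 2) * kfun K r * Real.cos (gg x y r ω) * thetafun P ω) +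
      ∫ ω in Set.Ioc 0 π, kfun K r * fww x y r ω * thetafun P ω) =
      (∫ p, (4 * K ^ 4 * p.1 ^ 2 - 2 * K ^ 2) * kfun K p.1 * Real.cos (gg x y p.1 p.2) * thetafun P p.2 ∂nu) +
      ∫ p, kfun K p.1 * fww x y p.1 p.2 * thetafun P p.2 ∂nu := by
    unfold nu at I1 I2 ⊢
    rw [integral_prod _ I1, integral_prod _ I2]
    exact integral_add I1.integral_prod_left I2.integral_prod_left
  rw [E2, E1, ← integral_add I3 I2, ← integral_neg, ← integral_const_mul]
  congr 1; ext p
  rw [gg_eq, ← hx, ← hy]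
  have hn : ‖z‖ ^ 2 = x ^ 2 + y ^ 2 := by rw [Complex.sq_norm, Complex.normSq_apply]; ring
  have hg := gg_sq x y p.1 p.2
  rw [hn, frr, fww, wt]
  linear_combination (Real.cos (gg x y p.1 p.2) * kfun K p.1 * thetafun P p.2) * hg

end KT

namespace KT

open MeasureTheory

/-- nonnegative integrable function with given integral -/
def Bd (f : ℝ → ℝ) (c : ℝ) : Prop := Integrable f ∧ (∀ x, 0 ≤ f x) ∧ ∫ x, f x = c

lemma Bd.smul {f : ℝ → ℝ} {c : ℝ} (h : Bd f c) {a : ℝ} (ha : 0 ≤ a) : Bd (fun x => a * f x) (a * c) :=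
  ⟨h.1.const_mul a, fun x => mul_nonneg ha (h.2.1 x), by rw [integral_const_mul, h.2.2]⟩

lemma Bd.add {f g : ℝ → ℝ} {c d : ℝ} (h : Bd f c) (h' : Bd g d) : Bd (fun x => f x + g x) (c + d) :=
  ⟨h.1.add h'.1, fun x => add_nonneg (h.2.1 x) (h'.2.1 x), by rw [integral_add h.1 h'.1, h.2.2, h'.2.2]⟩

lemma Bd.sub_left {f : ℝ → ℝ} {c : ℝ} (h : Bd f c) (a : ℝ) : Bd (fun x => f (a - x)) c :=
  ⟨h.1.comp_sub_left a, fun x => h.2.1 _, by rw [integral_sub_left_eq_self f volume a, h.2.2]⟩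

lemma Bd.sub_right {f : ℝ → ℝ} {c : ℝ} (h : Bd f c) (a : ℝ) : Bd (fun x => f (x - a)) c :=
  ⟨h.1.comp_sub_right a, fun x => h.2.1 _, by rw [integral_sub_right_eq_self f a, h.2.2]⟩

lemma Bd.nonneg {f : ℝ → ℝ} {c : ℝ} (h : Bd f c) : 0 ≤ c := h.2.2 ▸ integral_nonneg h.2.1

lemma bd_gauss {b : ℝ} (hb : 0 < b) : Bd (fun x => Real.exp (-(b * x ^ 2))) (Real.sqrt (π / b)) := by
  refine ⟨?_, fun x => (Real.exp_pos _).le, ?_⟩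
  · simpa [neg_mul] using integrable_exp_neg_mul_sq hb
  · simpa [neg_mul] using integral_gaussian b

lemma bd_lap {a : ℝ} (ha : 0 < a) : Bd (fun x => Real.exp (-(a * |x|))) (2 / a) := by
  have h1 : ∫ x, Real.exp (-(a * |x|)) = 2 / a := by
    rw [integral_comp_abs (f := fun x => Real.exp (-(a * x)))]
    have := integral_exp_mul_Ioi (a := -a) (by linarith) 0
    simp only [neg_mul, mul_zero, neg_zero, Real.exp_zero] at this
    rw [this]; field_simp
  refine ⟨?_, fun x => (Real.exp_pos _).le, h1⟩
  by_contra hc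
  rw [integral_undef hc] at h1
  have : 0 < 2 / a := by positivity
  linarith

lemma prod_bound {f : ℝ × ℝ → ℝ} (hf : AEStronglyMeasurable f nu) (h0 : ∀ p, 0 ≤ f p) {h1 t1 h2 t2 : ℝ → ℝ}
    {a1 b1 a2 b2 : ℝ} (H1 : Bd h1 a1) (T1 : Bd t1 b1) (H2 : Bd h2 a2) (T2 : Bd t2 b2)
    (hle : ∀ r ω, 0 ≤ ω → ω ≤ π → f (r, ω) ≤ h1 r * t1 ω + h2 r * t2 ω) :
    Integrable f nu ∧ ∫ p, f p ∂nu ≤ a1 * b1 + a2 * b2 := by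
  have I1 : Integrable (fun p : ℝ × ℝ => h1 p.1 * t1 p.2) nu := H1.1.mul_prod T1.1.restrict
  have I2 : Integrable (fun p : ℝ × ℝ => h2 p.1 * t2 p.2) nu := H2.1.mul_prod T2.1.restrict
  have hae : ∀ᵐ p ∂nu, f p ≤ h1 p.1 * t1 p.2 + h2 p.1 * t2 p.2 := by
    have : ∀ᵐ ω ∂(volume.restrict (Set.Ioc 0 π)), ω ∈ Set.Ioc 0 π := ae_restrict_mem measurableSet_Ioc
    have h2 := (Measure.quasiMeasurePreserving_snd (μ := (volume : Measure ℝ)) (ν := volume.restrict (Set.Ioc 0 π))).ae this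
    filter_upwards [h2] with p hp
    exact hle p.1 p.2 hp.1.le hp.2
  have If : Integrable f nu := (I1.add I2).mono' hf (by
    filter_upwards [hae] with p hp
    rw [Real.norm_of_nonneg (h0 p)]; exact hp)
  refine ⟨If, (integral_mono_ae If (I1.add I2) hae).trans ?_⟩
  simp only [Pi.add_apply]
  rw [integral_add I1 I2]
  unfold nu
  rw [integral_prod_mul, integral_prod_mul, H1.2.2, H2.2.2]
  have e1 : ∫ y in Set.Ioc 0 π, t1 y ≤ b1 := by
    rw [← T1.2.2]; exact setIntegral_le_integral T1.1 (Filter.Eventually.of_forall T1.2.1)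
  have e2 : ∫ y in Set.Ioc 0 π, t2 y ≤ b2 := by
    rw [← T2.2.2]; exact setIntegral_le_integral T2.1 (Filter.Eventually.of_forall T2.2.1)
  exact add_le_add (mul_le_mul_of_nonneg_left e1 H1.nonneg) (mul_le_mul_of_nonneg_left e2 H2.nonneg)

lemma sinh_sq_le (r : ℝ) : Real.sinh r ^ 2 ≤ r ^ 2 * Real.exp (2 * |r|) := by
  have key : ∀ x : ℝ, 0 ≤ x → Real.sinh x ≤ x * Real.exp x := by
    intro x hx
    rw [Real.sinh_eq]
    have h1 := Real.add_one_le_exp (-2 * x)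
    have h2 : Real.exp (-x) = Real.exp x * Real.exp (-2 * x) := by rw [← Real.exp_add]; congr 1; ring
    rw [h2]
    nlinarith [Real.exp_pos x]
  have h := key |r| (abs_nonneg r)
  have h0 : 0 ≤ Real.sinh |r| := Real.sinh_nonneg_iff.2 (abs_nonneg r)
  have h2 : Real.sinh |r| ^ 2 = Real.sinh r ^ 2 := by
    rcases abs_choice r with h | h <;> rw [h]
    rw [Real.sinh_neg]; ring
  rw [← h2, ← sq_abs r]
  calc _ ≤ (|r| * Real.exp |r|) ^ 2 := pow_le_pow_left₀ h0 h 2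
    _ = _ := by rw [mul_pow, ← Real.exp_nat_mul]; norm_num

/-- r-weight bound, all r -/
lemma A1 {K : ℝ} (hK : 1/2 ≤ K) (r : ℝ) : Real.sinh r ^ 2 * kfun K r ≤
    (Real.sqrt π * K * (4 / K ^ 2) * Real.exp 8) * Real.exp (-(K ^ 2 / 4 * r ^ 2)) := by
  have hK0 : 0 < K := by linarith
  have h1 := sinh_sq_le r
  have h2 : r ^ 2 ≤ 4 / K ^ 2 * Real.exp (K ^ 2 / 4 * r ^ 2) := by
    have := Real.add_one_le_exp (K ^ 2 / 4 * r ^ 2)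
    rw [div_mul_eq_mul_div, le_div_iff₀ (by positivity)]; nlinarith
  have h3 : 2 * |r| - K ^ 2 * r ^ 2 + K ^ 2 / 4 * r ^ 2 ≤ 8 + -(K ^ 2 / 4 * r ^ 2) := by
    have : 1/4 ≤ K ^ 2 := by nlinarith
    have := mul_le_mul_of_nonneg_right this (sq_nonneg r)
    nlinarith [sq_abs r, sq_nonneg (|r| - 8)]
  unfold kfun
  calc Real.sinh r ^ 2 * (Real.sqrt π * K * Real.exp (-(K ^ 2 * r ^ 2)))
      ≤ (4 / K ^ 2 * Real.exp (K ^ 2 / 4 * r ^ 2)) * Real.exp (2 * |r|) * (Real.sqrt π * K * Real.exp (-(K ^ 2 * r ^ 2))) := by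
        refine mul_le_mul_of_nonneg_right (h1.trans ?_) (by positivity)
        exact mul_le_mul_of_nonneg_right h2 (Real.exp_pos _).le
    _ = (Real.sqrt π * K * (4 / K ^ 2)) * Real.exp (2 * |r| - K ^ 2 * r ^ 2 + K ^ 2 / 4 * r ^ 2) := by
        rw [Real.exp_add, sub_eq_add_neg, Real.exp_add]; ring
    _ ≤ (Real.sqrt π * K * (4 / K ^ 2)) * Real.exp (8 + -(K ^ 2 / 4 * r ^ 2)) :=
        mul_le_mul_of_nonneg_left (Real.exp_le_exp.2 h3) (by positivity)
    _ = _ := by rw [Real.exp_add]; ring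

lemma cosh_sq_le (r : ℝ) : Real.cosh r ^ 2 ≤ Real.exp (2 * |r|) := by
  calc _ ≤ (Real.exp |r|) ^ 2 := pow_le_pow_left₀ (Real.cosh_pos r).le (cosh_le r) 2
    _ = _ := by rw [← Real.exp_nat_mul]; norm_num

lemma A3 {K : ℝ} (hK : 1/2 ≤ K) (r : ℝ) : Real.cosh r ^ 2 * kfun K r ≤
    (Real.sqrt π * K * Real.exp 8) * Real.exp (-(K ^ 2 / 2 * r ^ 2)) := by
  have hK0 : 0 < K := by linarith
  have h3 : 2 * |r| - K ^ 2 * r ^ 2 ≤ 8 + -(K ^ 2 / 2 * r ^ 2) := by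
    have : 1/4 ≤ K ^ 2 := by nlinarith
    have := mul_le_mul_of_nonneg_right this (sq_nonneg r)
    nlinarith [sq_abs r, sq_nonneg (|r| - 8)]
  unfold kfun
  calc Real.cosh r ^ 2 * (Real.sqrt π * K * Real.exp (-(K ^ 2 * r ^ 2)))
      ≤ Real.exp (2 * |r|) * (Real.sqrt π * K * Real.exp (-(K ^ 2 * r ^ 2))) :=
        mul_le_mul_of_nonneg_right (cosh_sq_le r) (by positivity)
    _ = (Real.sqrt π * K) * Real.exp (2 * |r| - K ^ 2 * r ^ 2) := by
        rw [sub_eq_add_neg, Real.exp_add]; ring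
    _ ≤ (Real.sqrt π * K) * Real.exp (8 + -(K ^ 2 / 2 * r ^ 2)) :=
        mul_le_mul_of_nonneg_left (Real.exp_le_exp.2 h3) (by positivity)
    _ = _ := by rw [Real.exp_add]; ring

lemma A2 {K : ℝ} (hK : 1/2 ≤ K) (r : ℝ) (hr : 1/3 < |r|) : Real.cosh r ^ 2 * kfun K r ≤
    (Real.sqrt π * K * Real.exp 5 * Real.exp (-K ^ 2 / 9)) *
      (Real.exp (-(2 * K ^ 2 / 3 * |r - 1/3|)) + Real.exp (-(2 * K ^ 2 / 3 * |r - (-1/3)|))) := by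
  have hK0 : 0 < K := by linarith
  have h3 : 2 * |r| - K ^ 2 * r ^ 2 ≤ 5 + (-K ^ 2 / 9) + -(2 * K ^ 2 / 3 * (|r| - 1/3)) := by
    have : 1/4 ≤ K ^ 2 := by nlinarith
    have := mul_le_mul_of_nonneg_right this (sq_nonneg (|r| - 1/3))
    rw [← sq_abs r]
    nlinarith [sq_nonneg (|r| - 1/3 - 4)]
  have h4 : Real.exp (-(2 * K ^ 2 / 3 * (|r| - 1/3))) ≤
      Real.exp (-(2 * K ^ 2 / 3 * |r - 1/3|)) + Real.exp (-(2 * K ^ 2 / 3 * |r - (-1/3)|)) := by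
    have p1 := Real.exp_pos (-(2 * K ^ 2 / 3 * |r - 1/3|))
    have p2 := Real.exp_pos (-(2 * K ^ 2 / 3 * |r - (-1/3)|))
    rcases le_total 0 r with h | h
    · rw [abs_of_nonneg h] at hr ⊢
      rw [abs_of_pos (by linarith : 0 < r - 1/3)] at p1 ⊢; linarith
    · rw [abs_of_nonpos h] at hr ⊢
      have : |r - (-1/3)| = -r - 1/3 := by rw [abs_of_neg (by linarith)]; ring
      rw [this] at p2 ⊢; linarith
  unfold kfun
  calc Real.cosh r ^ 2 * (Real.sqrt π * K * Real.exp (-(K ^ 2 * r ^ 2)))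
      ≤ Real.exp (2 * |r|) * (Real.sqrt π * K * Real.exp (-(K ^ 2 * r ^ 2))) :=
        mul_le_mul_of_nonneg_right (cosh_sq_le r) (by positivity)
    _ = (Real.sqrt π * K) * Real.exp (2 * |r| - K ^ 2 * r ^ 2) := by
        rw [sub_eq_add_neg, Real.exp_add]; ring
    _ ≤ (Real.sqrt π * K) * Real.exp (5 + (-K ^ 2 / 9) + -(2 * K ^ 2 / 3 * (|r| - 1/3))) :=
        mul_le_mul_of_nonneg_left (Real.exp_le_exp.2 h3) (by positivity)
    _ = (Real.sqrt π * K * Real.exp 5 * Real.exp (-K ^ 2 / 9)) * Real.exp (-(2 * K ^ 2 / 3 * (|r| - 1/3))) := by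
        rw [Real.exp_add, Real.exp_add]; ring
    _ ≤ _ := mul_le_mul_of_nonneg_left h4 (by positivity)

lemma T0 {P : ℝ} (hP : 1/2 ≤ P) {ω : ℝ} (h0 : 0 ≤ ω) (h1 : ω ≤ π) :
    thetafun P ω ≤ (Cθ * P) * (Real.exp (-(P ^ 2 * ω ^ 2)) + Real.exp (-(P ^ 2 * (π - ω) ^ 2))) :=
  (theta_le hP h0 h1).trans (le_of_eq (by ring))

lemma xsq {P : ℝ} (hP : 0 < P) (s x : ℝ) (h : s ≤ x ^ 2) :
    s * Real.exp (-(P ^ 2 * x ^ 2)) ≤ 2 / P ^ 2 * Real.exp (-(P ^ 2 / 2 * x ^ 2)) := by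
  have h2 : x ^ 2 ≤ 2 / P ^ 2 * Real.exp (P ^ 2 / 2 * x ^ 2) := by
    have := Real.add_one_le_exp (P ^ 2 / 2 * x ^ 2)
    rw [div_mul_eq_mul_div, le_div_iff₀ (by positivity)]; nlinarith
  calc _ ≤ (2 / P ^ 2 * Real.exp (P ^ 2 / 2 * x ^ 2)) * Real.exp (-(P ^ 2 * x ^ 2)) :=
        mul_le_mul_of_nonneg_right (h.trans h2) (Real.exp_pos _).le
    _ = _ := by rw [mul_assoc, ← Real.exp_add]; congr 2; ring

lemma T1 {P : ℝ} (hP : 1/2 ≤ P) {ω : ℝ} (h0 : 0 ≤ ω) (h1 : ω ≤ π) :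
    Real.sin ω ^ 2 * thetafun P ω ≤ (Cθ * P * (2 / P ^ 2)) *
      (Real.exp (-(P ^ 2 / 2 * ω ^ 2)) + Real.exp (-(P ^ 2 / 2 * (π - ω) ^ 2))) := by
  have hP0 : 0 < P := by linarith
  have hC := Cθ_nonneg
  have hs0 := Real.sin_nonneg_of_nonneg_of_le_pi h0 h1
  have e1 : Real.sin ω ^ 2 ≤ ω ^ 2 := pow_le_pow_left₀ hs0 (Real.sin_le h0) 2
  have e2 : Real.sin ω ^ 2 ≤ (π - ω) ^ 2 :=
    pow_le_pow_left₀ hs0 (by rw [← Real.sin_pi_sub]; exact Real.sin_le (by linarith)) 2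
  calc _ ≤ Real.sin ω ^ 2 * ((Cθ * P) * (Real.exp (-(P ^ 2 * ω ^ 2)) + Real.exp (-(P ^ 2 * (π - ω) ^ 2)))) :=
        mul_le_mul_of_nonneg_left (T0 hP h0 h1) (sq_nonneg _)
    _ = (Cθ * P) * (Real.sin ω ^ 2 * Real.exp (-(P ^ 2 * ω ^ 2)) + Real.sin ω ^ 2 * Real.exp (-(P ^ 2 * (π - ω) ^ 2))) := by ring
    _ ≤ (Cθ * P) * (2 / P ^ 2 * Real.exp (-(P ^ 2 / 2 * ω ^ 2)) + 2 / P ^ 2 * Real.exp (-(P ^ 2 / 2 * (π - ω) ^ 2))) :=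
        mul_le_mul_of_nonneg_left (add_le_add (xsq hP0 _ _ e1) (xsq hP0 _ _ e2)) (by positivity)
    _ = _ := by ring

lemma T2 {P : ℝ} (hP : 1/2 ≤ P) {ω : ℝ} (h0 : 1 < ω) (h1 : ω < π - 1) :
    thetafun P ω ≤ (Cθ * P * Real.exp (-P ^ 2)) *
      (Real.exp (-(2 * P ^ 2 * |ω - 1|)) + Real.exp (-(2 * P ^ 2 * |(π - 1) - ω|))) := by
  have hP0 : 0 < P := by linarith
  have hC := Cθ_nonneg
  have key : ∀ x : ℝ, 1 < x → Real.exp (-(P ^ 2 * x ^ 2)) ≤ Real.exp (-P ^ 2) * Real.exp (-(2 * P ^ 2 * |x - 1|)) := by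
    intro x hx
    rw [← Real.exp_add, abs_of_pos (by linarith)]
    apply Real.exp_le_exp.2
    nlinarith [mul_nonneg (sq_nonneg P) (sq_nonneg (x - 1))]
  have k1 := key ω h0
  have k2 := key (π - ω) (by linarith)
  have : π - ω - 1 = π - 1 - ω := by ring
  rw [this] at k2
  calc _ ≤ (Cθ * P) * (Real.exp (-(P ^ 2 * ω ^ 2)) + Real.exp (-(P ^ 2 * (π - ω) ^ 2))) :=
        T0 hP (by linarith) (by linarith)
    _ ≤ (Cθ * P) * (Real.exp (-P ^ 2) * Real.exp (-(2 * P ^ 2 * |ω - 1|)) + Real.exp (-P ^ 2) * Real.exp (-(2 * P ^ 2 * |(π - 1) - ω|))) :=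
        mul_le_mul_of_nonneg_left (add_le_add k1 k2) (by positivity)
    _ = _ := by ring

/-- exterior region -/
def Ext : Set (ℝ × ℝ) := {p | 1/3 < |p.1|} ∪ {p | 1 < p.2 ∧ p.2 < π - 1}

lemma Ext_meas : MeasurableSet Ext := by
  apply MeasurableSet.union
  · exact (isOpen_lt continuous_const (by fun_prop)).measurableSet
  · exact (measurableSet_lt measurable_const measurable_snd).inter (measurableSet_lt measurable_snd measurable_const)

lemma wt_cont {P : ℝ} (hP : 0 < P) (K : ℝ) : Continuous (wt K P) := by
  have := (theta_contDiff hP).continuous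
  have := kfun_cont K
  unfold wt; fun_prop

lemma wt_nonneg {K P : ℝ} (hK : 0 ≤ K) (hP : 0 ≤ P) (p : ℝ × ℝ) : 0 ≤ wt K P p := by
  have := kfun_nonneg hK p.1
  have := theta_nonneg hP p.2
  unfold wt; positivity

lemma sqrt_div_sq {a K : ℝ} (hK : 0 < K) : Real.sqrt (a / K ^ 2) = Real.sqrt a / K := by
  rw [Real.sqrt_div' _ (by positivity), Real.sqrt_sq hK.le]

lemma weights : ∃ C : ℝ, 0 ≤ C ∧ ∀ K P : ℝ, 1/2 ≤ K → 1/2 ≤ P → Integrable (wt K P) nu ∧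
    ∫ p, wt K P p ∂nu ≤ C * (1 / K ^ 2 + 1 / P ^ 2) ∧
    ∫ p, Ext.indicator (wt K P) p ∂nu ≤ C * (Real.exp (-K ^ 2 / 9) / K + Real.exp (-P ^ 2) / P) := by
  have hC := Cθ_nonneg
  set D := Real.sqrt π + Real.sqrt (2 * π) + Real.sqrt (4 * π) with hD
  have d1 : Real.sqrt π ≤ D := by rw [hD]; have := Real.sqrt_nonneg (2*π); have := Real.sqrt_nonneg (4*π); linarith
  have d2 : Real.sqrt (2 * π) ≤ D := by rw [hD]; have := Real.sqrt_nonneg π; have := Real.sqrt_nonneg (4*π); linarith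
  have d3 : Real.sqrt (4 * π) ≤ D := by rw [hD]; have := Real.sqrt_nonneg (2*π); have := Real.sqrt_nonneg π; linarith
  have hD0 : 0 ≤ D := (Real.sqrt_nonneg _).trans d1
  have e5 : Real.exp 5 ≤ Real.exp 8 := Real.exp_le_exp.2 (by norm_num)
  have e8 : 1 ≤ Real.exp 8 := Real.one_le_exp (by norm_num)
  refine ⟨100 * D * D * D * Cθ * Real.exp 8 + 100 * D * D * Cθ * Real.exp 8, by positivity, fun K P hK hP => ?_⟩
  have hK0 : 0 < K := by linarith
  have hP0 : 0 < P := by linarith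
  have cw := wt_cont hP0 K
  have w0 := wt_nonneg hK0.le hP0.le
  -- bounds
  have bT0 : Bd _ _ := (((bd_gauss (b := P ^ 2) (by positivity)).add ((bd_gauss (b := P ^ 2) (by positivity)).sub_left π)).smul
    (a := Cθ * P) (by positivity))
  have bT1 : Bd _ _ := (((bd_gauss (b := P ^ 2 / 2) (by positivity)).add ((bd_gauss (b := P ^ 2 / 2) (by positivity)).sub_left π)).smul
    (a := Cθ * P * (2 / P ^ 2)) (by positivity))
  have bT2 : Bd _ _ := (((bd_lap (a := 2 * P ^ 2) (by positivity)).sub_right 1).add ((bd_lap (a := 2 * P ^ 2) (by positivity)).sub_left (π - 1))).smul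
    (a := Cθ * P * Real.exp (-P ^ 2)) (by positivity)
  have bA0 : Bd _ _ := (bd_gauss (b := K ^ 2) (by positivity)).smul (a := Real.sqrt π * K) (by positivity)
  have bA1 : Bd _ _ := (bd_gauss (b := K ^ 2 / 4) (by positivity)).smul (a := Real.sqrt π * K * (4 / K ^ 2) * Real.exp 8) (by positivity)
  have bA3 : Bd _ _ := (bd_gauss (b := K ^ 2 / 2) (by positivity)).smul (a := Real.sqrt π * K * Real.exp 8) (by positivity)
  have bA2 : Bd _ _ := (((bd_lap (a := 2 * K ^ 2 / 3) (by positivity)).sub_right (1/3)).add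
    ((bd_lap (a := 2 * K ^ 2 / 3) (by positivity)).sub_right (-1/3))).smul
    (a := Real.sqrt π * K * Real.exp 5 * Real.exp (-K ^ 2 / 9)) (by positivity)
  obtain ⟨i1, b1⟩ := prod_bound cw.aestronglyMeasurable w0 bA1 bT0 bA0 bT1 (fun r ω h0 h1 => by
    have t0 := theta_nonneg hP0.le ω
    have k0 := kfun_nonneg hK0.le r
    have s0 : 0 ≤ Real.sin ω ^ 2 * thetafun P ω := by positivity
    have u1 := mul_le_mul (A1 hK r) (T0 hP h0 h1) t0 (by positivity)
    have u2 := mul_le_mul_of_nonneg_left (T1 hP h0 h1) k0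
    have : wt K P (r, ω) = Real.sinh r ^ 2 * kfun K r * thetafun P ω + kfun K r * (Real.sin ω ^ 2 * thetafun P ω) := by
      unfold wt; ring
    rw [this]
    exact add_le_add u1 u2)
  obtain ⟨i2, b2⟩ := prod_bound (f := Ext.indicator (wt K P)) (cw.aestronglyMeasurable.indicator Ext_meas)
    (fun p => Set.indicator_nonneg (fun p _ => w0 p) p) bA2 bT0 bA3 bT2 (fun r ω h0 h1 => by
    have t0 := theta_nonneg hP0.le ω
    have k0 := kfun_nonneg hK0.le r
    have n1 := mul_nonneg (bA2.2.1 r) (bT0.2.1 ω)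
    have n2 := mul_nonneg (bA3.2.1 r) (bT2.2.1 ω)
    have hw : wt K P (r, ω) ≤ (Real.cosh r ^ 2 * kfun K r) * thetafun P ω := by
      have : wt K P (r, ω) = (Real.sinh r ^ 2 + Real.sin ω ^ 2) * (kfun K r * thetafun P ω) := rfl
      rw [this, mul_assoc]
      refine mul_le_mul_of_nonneg_right ?_ (by positivity)
      rw [Real.cosh_sq]
      linarith [Real.sin_sq_le_one ω]
    by_cases hE : (r, ω) ∈ Ext
    · rw [Set.indicator_of_mem hE]
      rcases hE with hE | hE
      · have u1 := mul_le_mul (A2 hK r hE) (T0 hP h0 h1) t0 (by positivity)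
        exact (hw.trans u1).trans (le_add_of_nonneg_right n2)
      · have u1 := mul_le_mul (A3 hK r) (T2 hP hE.1 hE.2) t0 (by positivity)
        exact (hw.trans u1).trans (le_add_of_nonneg_left n1)
    · rw [Set.indicator_of_notMem hE]
      exact add_nonneg n1 n2)
  refine ⟨i1, b1.trans ?_, b2.trans ?_⟩
  · rw [show π / (K ^ 2 / 4) = (4 * π) / K ^ 2 by field_simp, show π / (P ^ 2 / 2) = (2 * π) / P ^ 2 by field_simp,
      sqrt_div_sq hK0, sqrt_div_sq hK0, sqrt_div_sq hP0, sqrt_div_sq hP0]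
    have g1 : Real.sqrt π * K * (4 / K ^ 2) * Real.exp 8 * (Real.sqrt (4 * π) / K) *
        (Cθ * P * (Real.sqrt π / P + Real.sqrt π / P)) =
        8 * Real.sqrt π * Real.sqrt (4 * π) * Real.sqrt π * Cθ * Real.exp 8 * (1 / K ^ 2) := by field_simp; ring
    have g2 : Real.sqrt π * K * (Real.sqrt π / K) * (Cθ * P * (2 / P ^ 2) * (Real.sqrt (2 * π) / P + Real.sqrt (2 * π) / P)) =
        4 * Real.sqrt π * Real.sqrt π * Real.sqrt (2 * π) * Cθ * 1 * (1 / P ^ 2) := by field_simp; ring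
    rw [g1, g2]
    have f1 : 8 * Real.sqrt π * Real.sqrt (4 * π) * Real.sqrt π * Cθ * Real.exp 8 * (1 / K ^ 2) ≤
       8 * D * D * D * Cθ * Real.exp 8 * (1 / K ^ 2) := by gcongr
    have f2 : 4 * Real.sqrt π * Real.sqrt π * Real.sqrt (2 * π) * Cθ * 1 * (1 / P ^ 2) ≤
       4 * D * D * D * Cθ * Real.exp 8 * (1 / P ^ 2) := by gcongr
    have q1 : 0 ≤ D * D * D * Cθ * Real.exp 8 * (1 / K ^ 2) := by positivity
    have q2 : 0 ≤ D * D * D * Cθ * Real.exp 8 * (1 / P ^ 2) := by positivity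
    have q3 : 0 ≤ D * D * Cθ * Real.exp 8 * (1 / K ^ 2) := by positivity
    have q4 : 0 ≤ D * D * Cθ * Real.exp 8 * (1 / P ^ 2) := by positivity
    linarith
  · rw [show π / (K ^ 2 / 2) = (2 * π) / K ^ 2 by field_simp,
      sqrt_div_sq hK0, sqrt_div_sq hP0]
    have g1 : Real.sqrt π * K * Real.exp 5 * Real.exp (-K ^ 2 / 9) * (2 / (2 * K ^ 2 / 3) + 2 / (2 * K ^ 2 / 3)) *
        (Cθ * P * (Real.sqrt π / P + Real.sqrt π / P)) =
        12 * Real.sqrt π * Real.sqrt π * Cθ * Real.exp 5 * (Real.exp (-K ^ 2 / 9) / K) := by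
      generalize Real.exp (-K ^ 2 / 9) = X
      field_simp; ring
    have g2 : Real.sqrt π * K * Real.exp 8 * (Real.sqrt (2 * π) / K) * (Cθ * P * Real.exp (-P ^ 2) * (2 / (2 * P ^ 2) + 2 / (2 * P ^ 2))) =
        2 * Real.sqrt π * Real.sqrt (2 * π) * Cθ * Real.exp 8 * (Real.exp (-P ^ 2) / P) := by
      generalize Real.exp (-P ^ 2) = X
      field_simp; ring
    rw [g1, g2]
    have f1 : 12 * Real.sqrt π * Real.sqrt π * Cθ * Real.exp 5 * (Real.exp (-K ^ 2 / 9) / K) ≤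
       12 * D * D * Cθ * Real.exp 8 * (Real.exp (-K ^ 2 / 9) / K) := by gcongr
    have f2 : 2 * Real.sqrt π * Real.sqrt (2 * π) * Cθ * Real.exp 8 * (Real.exp (-P ^ 2) / P) ≤
       2 * D * D * Cθ * Real.exp 8 * (Real.exp (-P ^ 2) / P) := by gcongr
    have hX : 0 ≤ Real.exp (-K ^ 2 / 9) / K := by positivity
    generalize Real.exp (-K ^ 2 / 9) / K = X at *
    have q1 : 0 ≤ D * D * D * Cθ * Real.exp 8 * X := by positivity
    have q2 : 0 ≤ D * D * D * Cθ * Real.exp 8 * (Real.exp (-P ^ 2) / P) := by positivity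
    have q3 : 0 ≤ D * D * Cθ * Real.exp 8 * X := by positivity
    have q4 : 0 ≤ D * D * Cθ * Real.exp 8 * (Real.exp (-P ^ 2) / P) := by positivity
    linarith

lemma trh_interior {p : ℝ × ℝ} (h0 : 0 < p.2) (h1 : p.2 ≤ π) (hp : p ∉ Ext) : 1/2 ≤ ‖trh p.1 p.2‖ ∧ ‖trh p.1 p.2‖ ≤ 2 := by
  obtain ⟨r, ω⟩ := p
  simp only [Ext, Set.mem_union, Set.mem_setOf_eq, not_or, not_lt, not_and] at hp h0 h1 ⊢
  obtain ⟨hr, hω⟩ := hp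
  have hn : ‖trh r ω‖ ^ 2 = Real.cos ω ^ 2 + Real.sinh r ^ 2 := by
    have e : trh r ω = ⟨Real.cosh r * Real.cos ω, Real.sinh r * Real.sin ω⟩ := by
      apply Complex.ext <;> simp [trh, -Complex.ofReal_mul, -Complex.ofReal_cosh, -Complex.ofReal_sinh, -Complex.ofReal_cos, -Complex.ofReal_sin]
    rw [Complex.sq_norm, e, Complex.normSq_mk]
    linear_combination Real.cos ω ^ 2 * Real.cosh_sq r + Real.sinh r ^ 2 * Real.sin_sq_add_cos_sq ω
  have c1 : 1/2 ≤ Real.cos 1 := by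
    rw [← Real.cos_pi_div_three]
    exact Real.cos_le_cos_of_nonneg_of_le_pi (by norm_num) (by linarith [Real.pi_pos]) (by linarith [Real.pi_gt_three])
  have hc : 1/4 ≤ Real.cos ω ^ 2 := by
    by_cases hw : ω ≤ 1
    · have := Real.cos_le_cos_of_nonneg_of_le_pi h0.le (by linarith [Real.pi_gt_three]) hw
      nlinarith
    · have h2 := hω (by linarith)
      have := Real.cos_le_cos_of_nonneg_of_le_pi (x := π - ω) (y := 1) (by linarith) (by linarith [Real.pi_gt_three]) (by linarith)
      rw [Real.cos_pi_sub] at this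
      nlinarith
  have hs := sinh_sq_le r
  have he : Real.exp (2 * |r|) ≤ Real.exp 1 := Real.exp_le_exp.2 (by linarith)
  have he1 := Real.exp_one_lt_d9
  have hr2 : r ^ 2 ≤ 1/9 := by rw [← sq_abs]; nlinarith [abs_nonneg r]
  have hs2 : Real.sinh r ^ 2 ≤ 1 := by
    have : r ^ 2 * Real.exp (2 * |r|) ≤ 1/9 * 3 := mul_le_mul hr2 (by linarith) (Real.exp_pos _).le (by norm_num)
    linarith
  have hcc := Real.cos_sq_le_one ω
  have hz := sq_nonneg (Real.sinh r)
  constructor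
  · nlinarith [norm_nonneg (trh r ω)]
  · nlinarith [norm_nonneg (trh r ω)]

end KT

namespace KT

open MeasureTheory

/-- nonzero Gaussian integers -/
abbrev NZ := {c : GaussianInt // c ≠ 0}

lemma summable_T {s : ℝ} (hs : 1 < s) :
    Summable fun c : NZ => (‖((c : GaussianInt) : ℂ)‖ ^ 2) ^ (-s) * (facT c : ℝ) := by
  set f : NZ → ℝ := fun z => (‖((z : GaussianInt) : ℂ)‖ ^ 2) ^ (-s) with hf
  have hsum : Summable f := summable_q hs
  have hf0 : 0 ≤ f := fun z => by positivity
  have h2 : Summable fun x : NZ × NZ => f x.1 * f x.2 := hsum.mul_of_nonneg hsum hf0 hf0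
  let g : NZ × NZ → NZ := fun x => ⟨x.1.1 * x.2.1, mul_ne_zero x.1.2 x.2.2⟩
  have h3 := ((Equiv.sigmaFiberEquiv g).summable_iff.2 h2).sigma
  refine h3.congr fun c => ?_
  have hfib : ∀ y : {x : NZ × NZ // g x = c}, ((fun x : NZ × NZ => f x.1 * f x.2) ∘ (Equiv.sigmaFiberEquiv g)) ⟨c, y⟩ = f c := by
    rintro ⟨⟨d, e⟩, h⟩
    simp only [Function.comp, Equiv.sigmaFiberEquiv_apply, hf]
    rw [← Real.mul_rpow (by positivity) (by positivity), ← h]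
    simp [g, mul_pow]
  rw [tsum_congr hfib, tsum_const]
  have hcard : Nat.card {x : NZ × NZ // g x = c} = facT c := by
    unfold facT
    refine Nat.card_congr ⟨fun x => ⟨(x.1.1.1, x.1.2.1), congrArg Subtype.val x.2⟩,
      fun p => ⟨(⟨p.1.1, fun h => c.2 (by rw [← p.2, h, zero_mul])⟩, ⟨p.1.2, fun h => c.2 (by rw [← p.2, h, mul_zero])⟩),
        Subtype.ext p.2⟩, fun x => rfl, fun x => rfl⟩
  rw [hcard, nsmul_eq_mul, mul_comm]

/-- interpolated individual bound -/
lemma kloo_interp {c m : GaussianInt} (hc : c ≠ 0) (hm : m ≠ 0) (n : GaussianInt) {M η : ℝ} (hmM : ‖(m : ℂ)‖ ≤ M)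
    (h0 : 0 ≤ η) (h1 : η ≤ 1/5) :
    ‖kloosterman m n c‖ ≤ ‖(c : ℂ)‖ ^ 2 * (4 * M ^ 2 * (facT c : ℝ) ^ 2 / ‖(c : ℂ)‖ ^ 2) ^ η := by
  have hq : 1 ≤ ‖(c : ℂ)‖ ^ 2 := by have := one_le_norm hc; nlinarith
  have hm1 := one_le_norm hm
  have hM : 1 ≤ M := hm1.trans hmM
  have hT : (1 : ℝ) ≤ facT c := by exact_mod_cast facT_pos hc
  have t := kloosterman_trivial hc m n
  have f := kloosterman_five hc hm n
  set q := ‖(c : ℂ)‖ ^ 2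
  set T := (facT c : ℝ)
  set S := ‖kloosterman m n c‖
  have hS : 0 ≤ S := norm_nonneg _
  set Y := 4 * M ^ 2 * T ^ 2 / q with hY
  have hY0 : 0 < Y := by positivity
  rcases le_total 1 Y with h | h
  · have := Real.one_le_rpow h h0
    nlinarith
  · have e1 : S ^ 5 ≤ (q * Y ^ (1/5 : ℝ)) ^ 5 := by
      rw [mul_pow, ← Real.rpow_natCast (Y ^ (1/5 : ℝ)), ← Real.rpow_mul hY0.le]
      norm_num
      have : q ^ 5 * Y = 4 * M ^ 2 * q ^ 4 * T ^ 2 := by rw [hY]; field_simp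
      rw [this]
      refine f.trans ?_
      gcongr
    have e2 : S ≤ q * Y ^ (1/5 : ℝ) := le_of_pow_le_pow_left₀ (by norm_num) (by positivity) e1
    have e3 : Y ^ (1/5 : ℝ) ≤ Y ^ η := Real.rpow_le_rpow_of_exponent_ge hY0 h h1
    exact e2.trans (mul_le_mul_of_nonneg_left e3 (by linarith))

lemma kloo_ext {c m : GaussianInt} (hc : c ≠ 0) (hm : m ≠ 0) (n : GaussianInt) {M η : ℝ} (hmM : ‖(m : ℂ)‖ ≤ M)
    (h0 : 0 ≤ η) (h1 : η ≤ 1/5) :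
    ‖kloosterman m n c‖ ≤ 4 * M ^ (2 * η) * (facT c : ℝ) * (‖(c : ℂ)‖ ^ 2) ^ (1 - η) := by
  have hq : 1 ≤ ‖(c : ℂ)‖ ^ 2 := by have := one_le_norm hc; nlinarith
  have hm1 := one_le_norm hm
  have hM : 1 ≤ M := hm1.trans hmM
  have hT : (1 : ℝ) ≤ facT c := by exact_mod_cast facT_pos hc
  refine (kloo_interp hc hm n hmM h0 h1).trans ?_
  set q := ‖(c : ℂ)‖ ^ 2
  set T := (facT c : ℝ)
  have e : q * (4 * M ^ 2 * T ^ 2 / q) ^ η = 4 ^ η * M ^ (2 * η) * T ^ (2 * η) * q ^ (1 - η) := by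
    rw [Real.div_rpow (by positivity) (by positivity), Real.mul_rpow (by positivity) (by positivity),
      Real.mul_rpow (by positivity) (by positivity), Real.rpow_sub (by positivity), Real.rpow_one,
      Real.rpow_mul (by positivity), Real.rpow_mul (by positivity)]
    norm_num; field_simp
  rw [e]
  have a1 : (4:ℝ) ^ η ≤ 4 := by
    simpa using Real.rpow_le_rpow_of_exponent_le (by norm_num : (1:ℝ) ≤ 4) (by linarith : η ≤ 1)
  have a2 : T ^ (2 * η) ≤ T := by
    simpa using Real.rpow_le_rpow_of_exponent_le hT (by linarith : 2 * η ≤ 1)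
  have a3 : 0 ≤ M ^ (2 * η) := by positivity
  have a4 : 0 ≤ q ^ (1 - η) := by positivity
  have a5 : 0 ≤ T ^ (2 * η) := by positivity
  exact mul_le_mul_of_nonneg_right (mul_le_mul (mul_le_mul_of_nonneg_right a1 a3) a2 a5 (by positivity)) a4

/-- trivial estimate of the bilinear form -/
lemma form_trivial (s : Finset GaussianInt) (b : GaussianInt → ℂ) (S : GaussianInt → GaussianInt → ℂ)
    (u : GaussianInt → GaussianInt → ℝ) (hu : ∀ m n, |u m n| ≤ 1) {M L : ℝ} (hM : 1 ≤ M) (hL : 0 ≤ L)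
    (hs : ∀ m ∈ s, ‖(m : ℂ)‖ ≤ M) (hS : ∀ m ∈ s, ∀ n ∈ s, ‖S m n‖ ≤ L) :
    ‖∑ m ∈ s, ∑ n ∈ s, b m * conj (b n) * S m n * ((u m n : ℝ) : ℂ)‖ ≤ 9 * M ^ 2 * L * ∑ m ∈ s, ‖b m‖ ^ 2 := by
  calc _ ≤ ∑ m ∈ s, ∑ n ∈ s, ‖b m‖ * ‖b n‖ * L := by
        refine (norm_sum_le _ _).trans (Finset.sum_le_sum fun m hm => (norm_sum_le _ _).trans (Finset.sum_le_sum fun n hn => ?_))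
        rw [norm_mul, norm_mul, norm_mul, RCLike.norm_conj, Complex.norm_real, Real.norm_eq_abs]
        have h1 := hu m n
        have h2 := hS m hm n hn
        calc _ ≤ ‖b m‖ * ‖b n‖ * L * 1 := by gcongr
          _ = _ := mul_one _
    _ = (∑ m ∈ s, ‖b m‖) ^ 2 * L := by
        rw [sq, Finset.sum_mul_sum, Finset.sum_mul]
        simp_rw [Finset.sum_mul]
    _ ≤ (s.card * ∑ m ∈ s, ‖b m‖ ^ 2) * L :=
        mul_le_mul_of_nonneg_right (sq_sum_le_card_mul_sum_sq) hL
    _ ≤ ((9 * M ^ 2) * ∑ m ∈ s, ‖b m‖ ^ 2) * L := by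
        have := finset_ball_card hM s hs
        have h3 : 0 ≤ ∑ m ∈ s, ‖b m‖ ^ 2 := Finset.sum_nonneg fun _ _ => by positivity
        gcongr
    _ = _ := by ring

lemma interior_interp {B D q M T V : ℝ} (hD : 1 ≤ D) (hq : 1 ≤ q) (hM : 1 ≤ M) (hT : 1 ≤ T) (hS : 0 ≤ V)
    (h1 : B ≤ D * (q + M * Real.sqrt q) * V)
    (h2 : B ≤ 9 * M ^ 2 * (q * (4 * M ^ 2 * T ^ 2 / q) ^ (1/5 : ℝ)) * V) :
    B ≤ 10 * D * M * T * q ^ (11/12 : ℝ) * V := by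
  set X := 4 * 9 ^ 5 * M ^ 12 * T ^ 2 / q with hX
  have hX0 : 0 < X := by positivity
  have e1 : 9 * M ^ 2 * (q * (4 * M ^ 2 * T ^ 2 / q) ^ (1/5 : ℝ)) = q * X ^ (1/5 : ℝ) := by
    have : X = (9 * M ^ 2) ^ 5 * (4 * M ^ 2 * T ^ 2 / q) := by rw [hX]; ring
    rw [this, Real.mul_rpow (by positivity) (by positivity), ← Real.rpow_natCast (9 * M ^ 2), ← Real.rpow_mul (by positivity)]
    norm_num; ring
  rw [e1] at h2
  have hXp : 0 < X ^ (1/12 : ℝ) := by positivity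
  have e2 : B ≤ D * (q * X ^ (1/12 : ℝ) + M * Real.sqrt q) * V := by
    rcases le_total 1 X with h | h
    · refine h1.trans (mul_le_mul_of_nonneg_right (mul_le_mul_of_nonneg_left ?_ (by linarith)) hS)
      have := Real.one_le_rpow h (by norm_num : (0:ℝ) ≤ 1/12)
      nlinarith
    · refine h2.trans (mul_le_mul_of_nonneg_right ?_ hS)
      have e3 : X ^ (1/5 : ℝ) ≤ X ^ (1/12 : ℝ) := Real.rpow_le_rpow_of_exponent_ge hX0 h (by norm_num)
      have := mul_le_mul_of_nonneg_left e3 (by linarith : 0 ≤ q)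
      have h4 : 0 ≤ q * X ^ (1/12 : ℝ) + M * Real.sqrt q := by positivity
      have h5 : 0 ≤ M * Real.sqrt q := by positivity
      nlinarith
  have e4 : q * X ^ (1/12 : ℝ) ≤ 9 * (M * T * q ^ (11/12 : ℝ)) := by
    have e5 : X ≤ (9 * M * T) ^ 12 / q := by
      rw [hX]
      refine div_le_div_of_nonneg_right ?_ (by linarith)
      have : (9 * M * T) ^ 12 = 9 ^ 12 * M ^ 12 * T ^ 12 := by ring
      rw [this]
      have : T ^ 2 ≤ T ^ 12 := pow_le_pow_right₀ hT (by norm_num)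
      gcongr
      norm_num
    have e6 : X ^ (1/12 : ℝ) ≤ (9 * M * T) / q ^ (1/12 : ℝ) := by
      refine (Real.rpow_le_rpow hX0.le e5 (by norm_num)).trans (le_of_eq ?_)
      rw [Real.div_rpow (by positivity) (by positivity), ← Real.rpow_natCast (9 * M * T), ← Real.rpow_mul (by positivity)]
      norm_num
    have e7 : q ^ (11/12 : ℝ) = q / q ^ (1/12 : ℝ) := by
      rw [show (11/12 : ℝ) = 1 - 1/12 by norm_num, Real.rpow_sub (by positivity), Real.rpow_one]
    calc _ ≤ q * ((9 * M * T) / q ^ (1/12 : ℝ)) := by gcongr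
      _ = _ := by rw [e7]; ring
  have e8 : M * Real.sqrt q ≤ M * T * q ^ (11/12 : ℝ) := by
    have : Real.sqrt q ≤ q ^ (11/12 : ℝ) := by
      rw [Real.sqrt_eq_rpow]; exact Real.rpow_le_rpow_of_exponent_le hq (by norm_num)
    have h0 := Real.sqrt_nonneg q
    rw [mul_assoc]
    refine mul_le_mul_of_nonneg_left ?_ (by linarith)
    nlinarith
  refine e2.trans (mul_le_mul_of_nonneg_right ?_ hS)
  have : D * (q * X ^ (1/12 : ℝ) + M * Real.sqrt q) ≤ D * (10 * (M * T * q ^ (11/12 : ℝ))) :=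
    mul_le_mul_of_nonneg_left (by linarith) (by linarith)
  linarith

end KT

namespace KT

open MeasureTheory

/-- the integrand form -/
noncomputable def FF (s : Finset GaussianInt) (b : GaussianInt → ℂ) (c : GaussianInt) (θ : ℂ) : ℂ :=
  ∑ m ∈ s, ∑ n ∈ s, b m * conj (b n) * kloosterman m n c *
      ((Real.cos (4 * π * (((m : ℂ) * (n : ℂ)) ^ ((1:ℂ)/2) * θ / (c : ℂ)).re) : ℝ) : ℂ)

lemma trh_cont : Continuous fun p : ℝ × ℝ => trh p.1 p.2 := by unfold trh; fun_prop

lemma phi_eq {K P : ℝ} (hK : 0 < K) (hP : 0 < P) (hI : Integrable (wt K P) nu) (s : Finset GaussianInt)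
    (hs : ∀ m ∈ s, IsGen m) (a : GaussianInt → ℂ) {c : GaussianInt} (hc : c ≠ 0) :
    ∑ m ∈ s, ∑ n ∈ s, a m * conj (a n) * kloosterman m n c *
      ((HH K P (2 * Real.pi * ((m : ℂ) * (n : ℂ)) ^ ((1:ℂ)/2) / (c : ℂ)) : ℝ) : ℂ) =
    ((16 * π ^ 2 / ‖(c : ℂ)‖ ^ 2 : ℝ) : ℂ) * ∫ p, FF s (fun m => ((‖(m : ℂ)‖ : ℝ) : ℂ) * a m) c (trh p.1 p.2) * ((wt K P p : ℝ) : ℂ) ∂nu := by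
  have hcn : ‖(c : ℂ)‖ ≠ 0 := by have := one_le_norm hc; linarith
  have hIntg : ∀ m n : GaussianInt, Integrable (fun p : ℝ × ℝ =>
      (((Real.cos (4 * π * (((m : ℂ) * (n : ℂ)) ^ ((1:ℂ)/2) * trh p.1 p.2 / (c : ℂ)).re) * wt K P p : ℝ)) : ℂ)) nu := by
    intro m n
    suffices hr : Integrable (fun p : ℝ × ℝ =>
      (Real.cos (4 * π * (((m : ℂ) * (n : ℂ)) ^ ((1:ℂ)/2) * trh p.1 p.2 / (c : ℂ)).re) * wt K P p)) nu from hr.ofReal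
    have ct := trh_cont
    have cw := wt_cont hP K
    refine hI.norm.mono' ?_ (Filter.Eventually.of_forall fun p => ?_)
    · refine Continuous.aestronglyMeasurable ?_
      have : Continuous fun p : ℝ × ℝ => (((m : ℂ) * (n : ℂ)) ^ ((1:ℂ)/2) * trh p.1 p.2 / (c : ℂ)) :=
        (continuous_const.mul ct).div_const _
      exact (Real.continuous_cos.comp (continuous_const.mul (Complex.continuous_re.comp this))).mul cw
    · rw [norm_mul]
      have := Real.abs_cos_le_one (4 * π * (((m : ℂ) * (n : ℂ)) ^ ((1:ℂ)/2) * trh p.1 p.2 / (c : ℂ)).re)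
      rw [← Real.norm_eq_abs] at this
      exact (mul_le_mul_of_nonneg_right this (norm_nonneg _)).trans (by rw [one_mul])
  have hFF : ∀ p : ℝ × ℝ, FF s (fun m => ((‖(m : ℂ)‖ : ℝ) : ℂ) * a m) c (trh p.1 p.2) * ((wt K P p : ℝ) : ℂ) =
      ∑ m ∈ s, ∑ n ∈ s, (((‖(m : ℂ)‖ : ℝ) : ℂ) * a m * (((‖(n : ℂ)‖ : ℝ) : ℂ) * conj (a n)) * kloosterman m n c) *
       (((Real.cos (4 * π * (((m : ℂ) * (n : ℂ)) ^ ((1:ℂ)/2) * trh p.1 p.2 / (c : ℂ)).re) * wt K P p : ℝ)) : ℂ) := by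
    intro p
    unfold FF
    simp_rw [Finset.sum_mul]
    refine Finset.sum_congr rfl fun m _ => Finset.sum_congr rfl fun n _ => ?_
    rw [map_mul, Complex.conj_ofReal, Complex.ofReal_mul]; ring
  simp_rw [hFF]
  rw [integral_finsetSum _ (fun m _ => integrable_finsetSum _ fun n _ => (hIntg m n).const_mul _), Finset.mul_sum]
  refine Finset.sum_congr rfl fun m hm => ?_
  rw [integral_finsetSum _ (fun n _ => (hIntg m n).const_mul _), Finset.mul_sum]
  refine Finset.sum_congr rfl fun n hn => ?_
  rw [integral_const_mul, integral_complex_ofReal, HH_eq hK hP]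
  have hz : ‖2 * (π : ℂ) * ((m : ℂ) * (n : ℂ)) ^ ((1:ℂ)/2) / (c : ℂ)‖ ^ 2 = 4 * π ^ 2 * (‖(m : ℂ)‖ * ‖(n : ℂ)‖) / ‖(c : ℂ)‖ ^ 2 := by
    rw [rt_mul (hs m hm) (hs n hn), norm_div, norm_mul, norm_mul, norm_mul, Complex.norm_real,
      Real.norm_of_nonneg Real.pi_pos.le, div_pow, mul_pow, mul_pow, mul_pow, rt_norm_sq, rt_norm_sq]
    norm_num
  have hcos : ∀ p : ℝ × ℝ, 2 * (2 * (π : ℂ) * ((m : ℂ) * (n : ℂ)) ^ ((1:ℂ)/2) / (c : ℂ) * trh p.1 p.2).re =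
      4 * π * (((m : ℂ) * (n : ℂ)) ^ ((1:ℂ)/2) * trh p.1 p.2 / (c : ℂ)).re := by
    intro p
    have : 2 * (π : ℂ) * ((m : ℂ) * (n : ℂ)) ^ ((1:ℂ)/2) / (c : ℂ) * trh p.1 p.2 =
      ((2 * π : ℝ) : ℂ) * (((m : ℂ) * (n : ℂ)) ^ ((1:ℂ)/2) * trh p.1 p.2 / (c : ℂ)) := by push_cast; ring
    rw [this, Complex.re_ofReal_mul]; ring
  simp_rw [hcos]
  rw [hz, Complex.ofReal_mul]
  push_cast
  ring

lemma phi_bound : ∃ D : ℝ, 1 ≤ D ∧ ∀ (K P : ℝ), 0 < K → 0 < P → Integrable (wt K P) nu → ∀ (s : Finset GaussianInt) (M : ℝ),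
    1 ≤ M → (∀ m ∈ s, IsGen m ∧ ‖(m : ℂ)‖ ≤ M) → ∀ a : GaussianInt → ℂ, ∀ c : GaussianInt, c ≠ 0 → ∀ η : ℝ, 0 ≤ η → η ≤ 1/5 →
    ‖∑ m ∈ s, ∑ n ∈ s, a m * conj (a n) * kloosterman m n c *
      ((HH K P (2 * Real.pi * ((m : ℂ) * (n : ℂ)) ^ ((1:ℂ)/2) / (c : ℂ)) : ℝ) : ℂ)‖ ≤
    16 * π ^ 2 / ‖(c : ℂ)‖ ^ 2 *
      ((10 * D * M * (facT c : ℝ) * (‖(c : ℂ)‖ ^ 2) ^ (11/12 : ℝ)) * (∫ p, wt K P p ∂nu) +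
       (9 * M ^ 2 * (4 * M ^ (2 * η) * (facT c : ℝ) * (‖(c : ℂ)‖ ^ 2) ^ (1 - η))) * ∫ p, Ext.indicator (wt K P) p ∂nu) *
      (M ^ 2 * ∑ m ∈ s, ‖a m‖ ^ 2) := by
  obtain ⟨C, hC, HB⟩ := B_bound
  refine ⟨C + 1, by linarith, fun K P hK hP hI s M hM hs a c hc η h0 h1 => ?_⟩
  rw [phi_eq hK hP hI s (fun m hm => (hs m hm).1) a hc, norm_mul, Complex.norm_real,
    Real.norm_of_nonneg (by positivity), mul_assoc (16 * π ^ 2 / ‖(c : ℂ)‖ ^ 2)]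
  refine mul_le_mul_of_nonneg_left ?_ (by positivity)
  set b : GaussianInt → ℂ := fun m => ((‖(m : ℂ)‖ : ℝ) : ℂ) * a m with hb
  have hq : 1 ≤ ‖(c : ℂ)‖ ^ 2 := by have := one_le_norm hc; nlinarith
  have hT : (1 : ℝ) ≤ facT c := by exact_mod_cast facT_pos hc
  have hS : ∑ m ∈ s, ‖b m‖ ^ 2 ≤ M ^ 2 * ∑ m ∈ s, ‖a m‖ ^ 2 := by
    rw [Finset.mul_sum]
    refine Finset.sum_le_sum fun m hm => ?_
    rw [hb]; simp only []
    rw [norm_mul, Complex.norm_real, norm_norm, mul_pow]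
    have := (hs m hm).2
    gcongr
  have hS0 : 0 ≤ ∑ m ∈ s, ‖b m‖ ^ 2 := Finset.sum_nonneg fun _ _ => by positivity
  set V := ∑ m ∈ s, ‖b m‖ ^ 2
  have hcos : ∀ θ : ℂ, ∀ m n : GaussianInt, |Real.cos (4 * π * (((m : ℂ) * (n : ℂ)) ^ ((1:ℂ)/2) * θ / (c : ℂ)).re)| ≤ 1 :=
    fun θ m n => Real.abs_cos_le_one _
  have triv : ∀ η : ℝ, 0 ≤ η → η ≤ 1/5 → ∀ θ, ‖FF s b c θ‖ ≤
      9 * M ^ 2 * (‖(c : ℂ)‖ ^ 2 * (4 * M ^ 2 * (facT c : ℝ) ^ 2 / ‖(c : ℂ)‖ ^ 2) ^ η) * V := fun η h0 h1 θ =>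
    form_trivial s b (fun m n => kloosterman m n c) _ (hcos θ) hM (by positivity) (fun m hm => (hs m hm).2)
      (fun m hm n hn => kloo_interp hc (hs m hm).1.1 n (hs m hm).2 h0 h1)
  have ext : ∀ θ, ‖FF s b c θ‖ ≤
      9 * M ^ 2 * (4 * M ^ (2 * η) * (facT c : ℝ) * (‖(c : ℂ)‖ ^ 2) ^ (1 - η)) * V := fun θ =>
    form_trivial s b (fun m n => kloosterman m n c) _ (hcos θ) hM (by positivity) (fun m hm => (hs m hm).2)
      (fun m hm n hn => kloo_ext hc (hs m hm).1.1 n (hs m hm).2 h0 h1)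
  have int : ∀ θ : ℂ, 1/2 ≤ ‖θ‖ → ‖θ‖ ≤ 2 → ‖FF s b c θ‖ ≤ 10 * (C + 1) * M * (facT c : ℝ) * (‖(c : ℂ)‖ ^ 2) ^ (11/12 : ℝ) * V := by
    intro θ t1 t2
    refine interior_interp (by linarith) hq hM hT hS0 ?_ (triv (1/5) (by norm_num) le_rfl θ)
    rw [Real.sqrt_sq (norm_nonneg _)]
    refine (HB c hc s M (by linarith) hs θ t1 t2 b).trans ?_
    refine mul_le_mul_of_nonneg_right (mul_le_mul_of_nonneg_right (by linarith) (by positivity)) hS0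
  set U1 := 10 * (C + 1) * M * (facT c : ℝ) * (‖(c : ℂ)‖ ^ 2) ^ (11/12 : ℝ) with hU1
  set U2 := 9 * M ^ 2 * (4 * M ^ (2 * η) * (facT c : ℝ) * (‖(c : ℂ)‖ ^ 2) ^ (1 - η)) with hU2
  have u1 : 0 ≤ U1 := by positivity
  have u2 : 0 ≤ U2 := by positivity
  have w0 := wt_nonneg hK.le hP.le
  have i2 : Integrable (Ext.indicator (wt K P)) nu := hI.indicator Ext_meas
  have hae : ∀ᵐ p ∂nu, 0 < p.2 ∧ p.2 ≤ π := by
    have : ∀ᵐ ω ∂(volume.restrict (Set.Ioc 0 π)), ω ∈ Set.Ioc 0 π := ae_restrict_mem measurableSet_Ioc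
    exact (Measure.quasiMeasurePreserving_snd (μ := (volume : Measure ℝ)) (ν := volume.restrict (Set.Ioc 0 π))).ae this
  have key : ‖∫ p, FF s b c (trh p.1 p.2) * ((wt K P p : ℝ) : ℂ) ∂nu‖ ≤
      ∫ p, (U1 * V * wt K P p + U2 * V * Ext.indicator (wt K P) p) ∂nu := by
    refine norm_integral_le_of_norm_le ((hI.const_mul _).add (i2.const_mul _)) ?_
    filter_upwards [hae] with p hp
    rw [norm_mul, Complex.norm_real, Real.norm_of_nonneg (w0 p)]
    by_cases hE : p ∈ Ext
    · rw [Set.indicator_of_mem hE]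
      have := mul_le_mul_of_nonneg_right (ext (trh p.1 p.2)) (w0 p)
      have h4 : 0 ≤ U1 * V * wt K P p := mul_nonneg (by positivity) (w0 p)
      linarith
    · rw [Set.indicator_of_notMem hE]
      obtain ⟨t1, t2⟩ := trh_interior hp.1 hp.2 hE
      have := mul_le_mul_of_nonneg_right (int (trh p.1 p.2) t1 t2) (w0 p)
      linarith
  rw [integral_add (hI.const_mul _) (i2.const_mul _), integral_const_mul, integral_const_mul] at key
  have W1 : 0 ≤ ∫ p, wt K P p ∂nu := integral_nonneg w0
  have W2 : 0 ≤ ∫ p, Ext.indicator (wt K P) p ∂nu := integral_nonneg (fun p => Set.indicator_nonneg (fun p _ => w0 p) p)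
  calc _ ≤ (U1 * (∫ p, wt K P p ∂nu) + U2 * ∫ p, Ext.indicator (wt K P) p ∂nu) * V := by linarith
    _ ≤ _ := mul_le_mul_of_nonneg_left hS (by positivity)

end KT

namespace KT

open MeasureTheory

lemma ann_finite (N : ℝ) : {n : GaussianInt | InAnn N n}.Finite :=
  (finite_ball (Real.sqrt 2 * N)).subset fun _ hn => hn.2.2

lemma final_num {ε N M wA wE : ℝ} (hε : 0 < ε) (hN : 0 < N) (hM : M = Real.sqrt 2 * N) (hM1 : 1 ≤ M) (hA : 0 ≤ wA) (hE : 0 ≤ wE) :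
    M ^ 2 * (M * wA + M ^ 2 * M ^ ε * wE) ≤ 2 * Real.sqrt 2 ^ (2 + ε) * N ^ (2 + ε) * (wE * N ^ 2 + wA * N) := by
  have h2 : Real.sqrt 2 ^ 2 = 2 := Real.sq_sqrt (by norm_num)
  have h3 : Real.sqrt 2 ≤ 2 := by nlinarith [Real.sqrt_nonneg 2]
  have e1 : Real.sqrt 2 ^ (2 + ε) * N ^ (2 + ε) = M ^ 2 * M ^ ε := by
    rw [← Real.mul_rpow (by positivity) hN.le, ← hM, Real.rpow_add (by linarith)]; norm_num
  have e2 : 1 ≤ M ^ ε := Real.one_le_rpow hM1 hε.le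
  have e3 : M ≤ 2 * N := by rw [hM]; nlinarith
  have e4 : M ^ 2 = 2 * N ^ 2 := by rw [hM, mul_pow, h2]
  have e5 : 2 * Real.sqrt 2 ^ (2 + ε) * N ^ (2 + ε) * (wE * N ^ 2 + wA * N) = M ^ 2 * M ^ ε * (wE * (2 * N ^ 2) + wA * (2 * N)) := by
    rw [← e1]; ring
  rw [e5, ← e4, mul_assoc (M ^ 2) (M ^ ε) (wE * M ^ 2 + wA * (2 * N))]
  refine mul_le_mul_of_nonneg_left ?_ (by positivity)
  have f1 : M * wA ≤ M ^ ε * (wA * (2 * N)) := by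
    have : 0 ≤ wA * (2 * N) := by positivity
    nlinarith
  nlinarith

theorem main (ε : ℝ) (hε : 0 < ε) : ∃ C : ℝ,
      ∀ K P : ℝ, 1/2 ≤ K → 1/2 ≤ P → ∀ N : ℝ, 0 < N → 
        ∀ a : GaussianInt → ℂ, 
          (∑' c : {c : GaussianInt // c ≠ 0},
              ‖PhiSum K P N a c‖ / ‖((c : GaussianInt) : ℂ)‖ ^ 2) ≤
            C * N ^ (2 + ε) *
              ((Real.exp (-K ^ 2 / 9) / K + Real.exp (-P ^ 2) / P) * N ^ 2 +
                (1 / K ^ 2 + 1 / P ^ 2) * N) *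
              sqNorm a N := by
  obtain ⟨D, hD, HPhi⟩ := phi_bound
  obtain ⟨Cw, hCw, HW⟩ := weights
  set η := min (ε / 2) (1/5) with hη
  have hη0 : 0 < η := lt_min (by linarith) (by norm_num)
  have hη1 : η ≤ 1/5 := min_le_right _ _
  have hη2 : 2 * η ≤ ε := by have := min_le_left (ε / 2) (1/5 : ℝ); linarith
  have S1 := summable_T (s := 13/12) (by norm_num)
  have S2 := summable_T (s := 1 + η) (by linarith)
  set Z1 := ∑' c : NZ, (‖((c : GaussianInt) : ℂ)‖ ^ 2) ^ (-(13/12) : ℝ) * (facT c : ℝ) with hZ1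
  set Z2 := ∑' c : NZ, (‖((c : GaussianInt) : ℂ)‖ ^ 2) ^ (-(1 + η) : ℝ) * (facT c : ℝ) with hZ2
  have z1 : 0 ≤ Z1 := tsum_nonneg fun c => by positivity
  have z2 : 0 ≤ Z2 := tsum_nonneg fun c => by positivity
  set C1 := 16 * π ^ 2 * (10 * D * Cw * Z1 + 36 * Cw * Z2) with hC1
  have hC10 : 0 ≤ C1 := by have := zero_le_one.trans hD; positivity
  refine ⟨C1 * (2 * Real.sqrt 2 ^ (2 + ε)), fun K P hK hP N hN a => ?_⟩
  have hfin := ann_finite N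
  have hK0 : 0 < K := by linarith
  have hP0 : 0 < P := by linarith
  have hPhi : ∀ c, PhiSum K P N a c = ∑ m ∈ hfin.toFinset, ∑ n ∈ hfin.toFinset, a m * conj (a n) * kloosterman m n c *
      ((HH K P (2 * Real.pi * ((m : ℂ) * (n : ℂ)) ^ ((1:ℂ)/2) / (c : ℂ)) : ℝ) : ℂ) := by
    intro c
    unfold PhiSum
    rw [finsum_mem_eq_finite_toFinset_sum _ hfin]
    refine Finset.sum_congr rfl fun m _ => ?_
    rw [finsum_mem_eq_finite_toFinset_sum _ hfin]
  have hsq : sqNorm a N = ∑ m ∈ hfin.toFinset, ‖a m‖ ^ 2 := by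
    unfold sqNorm
    rw [finsum_mem_eq_finite_toFinset_sum _ hfin]
  have hs : ∀ m ∈ hfin.toFinset, IsGen m ∧ ‖(m : ℂ)‖ ≤ Real.sqrt 2 * N := by
    intro m hm
    have : InAnn N m := by simpa using hm
    exact ⟨this.1, this.2.2⟩
  rw [hsq]
  simp_rw [hPhi]
  set s := hfin.toFinset
  clear_value s
  rcases s.eq_empty_or_nonempty with he | ⟨m0, hm0⟩
  · subst he; simp
  set M := Real.sqrt 2 * N with hM
  have hM1 : 1 ≤ M := (one_le_norm (hs m0 hm0).1.1).trans (hs m0 hm0).2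
  obtain ⟨hI, hW1, hW2⟩ := HW K P hK hP
  set wA := 1 / K ^ 2 + 1 / P ^ 2 with hwA
  set wE := Real.exp (-K ^ 2 / 9) / K + Real.exp (-P ^ 2) / P with hwE
  have hwA0 : 0 ≤ wA := by positivity
  have hwE0 : 0 ≤ wE := by positivity
  set A2 := ∑ m ∈ s, ‖a m‖ ^ 2 with hA2
  have hA0 : 0 ≤ A2 := Finset.sum_nonneg fun _ _ => by positivity
  have hMη : M ^ (2 * η) ≤ M ^ ε := Real.rpow_le_rpow_of_exponent_le hM1 hη2
  set c1 := 16 * π ^ 2 * (M ^ 2 * A2) * (10 * D * M * (Cw * wA)) with hc1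
  set c2 := 16 * π ^ 2 * (M ^ 2 * A2) * (9 * M ^ 2 * (4 * M ^ ε) * (Cw * wE)) with hc2
  have hD0 : 0 ≤ D := by linarith
  have hterm : ∀ c : NZ, ‖∑ m ∈ s, ∑ n ∈ s, a m * conj (a n) * kloosterman m n c *
      ((HH K P (2 * Real.pi * ((m : ℂ) * (n : ℂ)) ^ ((1:ℂ)/2) / ((c : GaussianInt) : ℂ)) : ℝ) : ℂ)‖ / ‖((c : GaussianInt) : ℂ)‖ ^ 2 ≤
      c1 * ((‖((c : GaussianInt) : ℂ)‖ ^ 2) ^ (-(13/12) : ℝ) * (facT c : ℝ)) +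
      c2 * ((‖((c : GaussianInt) : ℂ)‖ ^ 2) ^ (-(1 + η) : ℝ) * (facT c : ℝ)) := by
    intro c
    have hb := HPhi K P hK0 hP0 hI s M hM1 hs a c c.2 η hη0.le hη1
    have hq : 1 ≤ ‖((c : GaussianInt) : ℂ)‖ ^ 2 := by have := one_le_norm c.2; nlinarith
    set q := ‖((c : GaussianInt) : ℂ)‖ ^ 2
    set T := (facT c : ℝ)
    have hT0 : 0 ≤ T := by positivity
    have r1 : q ^ (-(13/12) : ℝ) = q ^ (11/12 : ℝ) / q / q := by
      rw [show (-(13/12) : ℝ) = 11/12 - 1 - 1 by norm_num, Real.rpow_sub_one (by positivity), Real.rpow_sub_one (by positivity)]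
    have r2 : q ^ (-(1 + η) : ℝ) = q ^ (1 - η) / q / q := by
      rw [show (-(1 + η) : ℝ) = 1 - η - 1 - 1 by ring, Real.rpow_sub_one (by positivity), Real.rpow_sub_one (by positivity)]
    rw [div_le_iff₀ (by linarith)]
    refine hb.trans ?_
    have step : (10 * D * M * T * q ^ (11/12 : ℝ)) * (∫ p, wt K P p ∂nu) +
       (9 * M ^ 2 * (4 * M ^ (2 * η) * T * q ^ (1 - η))) * (∫ p, Ext.indicator (wt K P) p ∂nu) ≤
       (10 * D * M * T * q ^ (11/12 : ℝ)) * (Cw * wA) +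
       (9 * M ^ 2 * (4 * M ^ ε * T * q ^ (1 - η))) * (Cw * wE) := by
      refine add_le_add (mul_le_mul_of_nonneg_left hW1 (by positivity)) ?_
      refine (mul_le_mul_of_nonneg_left hW2 (by positivity)).trans ?_
      refine mul_le_mul_of_nonneg_right ?_ (by positivity)
      gcongr
    have step2 := mul_le_mul_of_nonneg_right (mul_le_mul_of_nonneg_left step (by positivity : 0 ≤ 16 * π ^ 2 / q))
      (by positivity : 0 ≤ M ^ 2 * A2)
    refine step2.trans (le_of_eq ?_)
    rw [r1, r2, hc1, hc2]
    field_simp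
  have hSum := (S1.mul_left c1).add (S2.mul_left c2)
  have hS0 := Summable.of_nonneg_of_le (fun c => by positivity) hterm hSum
  refine (hS0.tsum_le_tsum hterm hSum).trans ?_
  rw [(S1.mul_left c1).tsum_add (S2.mul_left c2), tsum_mul_left, tsum_mul_left, ← hZ1, ← hZ2]
  have fn := final_num (ε := ε) (N := N) (M := M) hε hN hM hM1 hwA0 hwE0
  have fn2 := mul_le_mul_of_nonneg_left (mul_le_mul_of_nonneg_right fn hA0) hC10
  have hMε : 0 ≤ M ^ ε := by positivity
  calc c1 * Z1 + c2 * Z2 ≤ C1 * (M ^ 2 * (M * wA + M ^ 2 * M ^ ε * wE) * A2) := by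
        rw [hc1, hc2, hC1]
        have p1 : 0 ≤ 16 * π ^ 2 * M ^ 2 * A2 * (10 * D * Cw * Z1) * (M ^ 2 * M ^ ε * wE) := by positivity
        have p2 : 0 ≤ 16 * π ^ 2 * M ^ 2 * A2 * (36 * Cw * Z2) * (M * wA) := by positivity
        linarith
    _ ≤ _ := fn2
    _ = _ := by ring

end KT

/-- Bound for the Kloosterman-term in the range `N < KP`. -/
theorem kloosterman_term_bound_small_N :
    ∀ ε : ℝ, 0 < ε → ∃ C : ℝ,
      ∀ K P : ℝ, 1/2 ≤ K → 1/2 ≤ P → ∀ N : ℝ, 0 < N → N < K * P →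
        ∀ a : GaussianInt → ℂ, (∀ m n : GaussianInt, Associated m n → a m = a n) →
          (∑' c : {c : GaussianInt // c ≠ 0},
              ‖PhiSum K P N a c‖ / ‖((c : GaussianInt) : ℂ)‖ ^ 2) ≤
            C * N ^ (2 + ε) *
              ((Real.exp (-K ^ 2 / 9) / K + Real.exp (-P ^ 2) / P) * N ^ 2 +
                (1 / K ^ 2 + 1 / P ^ 2) * N) *
              sqNorm a N := by
  intro ε hε
  obtain ⟨C, hC⟩ := KT.main ε hε
  exact ⟨C, fun K P hK hP N hN _ a _ => hC K P hK hP N hN a⟩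
end

section
/- Let η : ℝ → ℝ be a fixed smooth function supported in the interval [2^{−1/6}, 2]. Then there is a constant C_η such that for every N > 0 and every b ∈ ℂ∖{0}, one has |N² ∫∫_ℂ η(|z|²)·|z|²·exp(−4πi·Re(b·√N·z)) dA(z)| ≤ C_η·N/|b|², where dA denotes Lebesgue measure on ℂ. -/
open scoped Real
open Complex

open FourierTransform
/-- Stationary-phase bound: for smooth `η` supported in `[2^{−1/6}, 2]`,
`|N² ∫∫_ℂ η(|z|²) |z|² e(−2 b√N z) dA(z)| ≤ C_η N/|b|²`. -/
theorem oscillatory_integral_bound (η : ℝ → ℝ) (hη : ContDiff ℝ (⊤ : ℕ∞) η)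
    (hsupp : Function.support η ⊆ Set.Icc ((2:ℝ) ^ (-(1/6 : ℝ))) 2) :
    ∃ C : ℝ, ∀ N : ℝ, 0 < N → ∀ b : ℂ, b ≠ 0 →
      ‖(((N : ℂ) ^ 2) *
          ∫ z : ℂ, ((η (‖z‖ ^ 2) * ‖z‖ ^ 2 : ℝ) : ℂ) *
            Complex.exp (-(4 * Real.pi * Complex.I) *
              (((b * (Real.sqrt N : ℂ) * z).re : ℝ) : ℂ)))‖ ≤
        C * N / ‖b‖ ^ 2 := by
  have hsm : ContDiff ℝ (⊤ : ℕ∞) (fun z : ℂ => ((η (‖z‖ ^ 2) * ‖z‖ ^ 2 : ℝ) : ℂ)) := by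
    have h1 : ContDiff ℝ (⊤ : ℕ∞) (fun z : ℂ => ‖z‖ ^ 2) := contDiff_norm_sq ℝ
    exact Complex.ofRealCLM.contDiff.comp ((hη.comp h1).mul h1)
  have hcs : HasCompactSupport (fun z : ℂ => ((η (‖z‖ ^ 2) * ‖z‖ ^ 2 : ℝ) : ℂ)) := by
    refine HasCompactSupport.intro (isCompact_closedBall (0:ℂ) 2) ?_
    intro z hz
    have h0 : η (‖z‖ ^ 2) = 0 := by
      by_contra h
      have := (hsupp h).2
      simp only [Metric.mem_closedBall, dist_zero_right, not_le] at hz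
      nlinarith
    simp [h0]
  let f : SchwartzMap ℂ ℂ := hcs.toSchwartzMap hsm
  obtain ⟨C, hC⟩ := (𝓕 f).decay 2 0
  refine ⟨C / 4, fun N hN b hb => ?_⟩
  have key := hC.2 (2 * (starRingEnd ℂ) b * (Real.sqrt N : ℂ))
  have hint : (∫ z : ℂ, ((η (‖z‖ ^ 2) * ‖z‖ ^ 2 : ℝ) : ℂ) *
            Complex.exp (-(4 * Real.pi * Complex.I) *
              (((b * (Real.sqrt N : ℂ) * z).re : ℝ) : ℂ))) =
      (𝓕 f) (2 * (starRingEnd ℂ) b * (Real.sqrt N : ℂ)) := by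
    rw [SchwartzMap.fourier_coe, Real.fourier_eq']
    refine MeasureTheory.integral_congr_ae (Filter.Eventually.of_forall fun z => ?_)
    have hf : f z = ((η (‖z‖ ^ 2) * ‖z‖ ^ 2 : ℝ) : ℂ) := rfl
    have hin : inner ℝ z (2 * (starRingEnd ℂ) b * (Real.sqrt N : ℂ))
        = 2 * (b * (Real.sqrt N : ℂ) * z).re := by
      rw [Complex.inner]
      simp
      ring
    simp only [hf, hin, smul_eq_mul]
    rw [mul_comm]
    congr 2
    push_cast
    ring
  rw [hint, norm_mul]
  rw [norm_iteratedFDeriv_zero] at key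
  have hw : ‖2 * (starRingEnd ℂ) b * (Real.sqrt N : ℂ)‖ ^ 2 = 4 * ‖b‖ ^ 2 * N := by
    simp only [norm_mul, mul_pow, RCLike.norm_conj, Complex.norm_real, Real.norm_eq_abs, sq_abs,
      Real.sq_sqrt hN.le]
    norm_num
  rw [hw] at key
  have hb' : 0 < ‖b‖ := norm_pos_iff.mpr hb
  have hNn : ‖(N : ℂ) ^ 2‖ = N ^ 2 := by simp
  rw [hNn, le_div_iff₀ (by positivity)]
  nlinarith
end
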